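/- arXiv:1303.4065 — 3 statements merged into one kernel-verified Lean document; each statement's English description precedes it below -/
import Mathlib

section
/- For all integers k and t with k > t ≥ 2 there exists n₀ such that for every n ≥ n₀ there is a family 𝓕 of k-element subsets of an n-element set X with the property that every t-element subset of X is contained in either exactly one or exactly two members of 𝓕 (i.e., a t-(n,k,{1,2})-design exists). -/
open Finset

namespace AlmostSteiner

theorem sum_exp_le_of_mean {ι : Type*} (J : Finset ι) (a : ι → ℝ) {h b B μ ε g s : ℝ}
    (hs : s = 1 ∨ s = -1) (hJ : (#J : ℝ) ≤ h) (ha : ∀ i ∈ J, 0 ≤ a i) (hb : 0 ≤ b) (hμ : 0 ≤ μ)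
    (hμb : μ * b ≤ 1) (hB0 : 0 ≤ B) (hB : ∀ i ∈ J, |b - a i| ≤ B) (hμB : μ * B ≤ 1)
    (hmean : |h * b - ∑ i ∈ J, a i| ≤ h * ε) (hg : ε + μ * B * (2 * b + ε) ≤ g) :
    ∑ i ∈ J, Real.exp (s * μ * (b - a i)) ≤ h * Real.exp (μ * g) := by
  have hs1 : |s| = 1 := by rcases hs with rfl | rfl <;> simp
  have hh : 0 ≤ h := le_trans (Nat.cast_nonneg _) hJ
  have hpt : ∀ i ∈ J, Real.exp (s * μ * (b - a i)) ≤
      (1 + s * μ * b) + μ ^ 2 * B * b + (μ ^ 2 * B - s * μ) * a i := by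
    intro i hi
    have h1 : |s * μ * (b - a i)| ≤ 1 := by
      rw [abs_mul, abs_mul, hs1, one_mul, abs_of_nonneg hμ]
      exact (mul_le_mul_of_nonneg_left (hB i hi) hμ).trans hμB
    have h2 := (abs_le.1 (Real.abs_exp_sub_one_sub_id_le h1)).2
    have h3 : (s * μ * (b - a i)) ^ 2 = μ ^ 2 * (|b - a i| * |b - a i|) := by
      rw [abs_mul_abs_self, mul_pow, mul_pow, ← sq_abs s, hs1]; ring
    have h4 : |b - a i| * |b - a i| ≤ B * (b + a i) := by
      refine mul_le_mul (hB i hi) ?_ (abs_nonneg _) hB0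
      have := ha i hi
      rw [abs_le]; constructor <;> linarith
    have h5 := mul_le_mul_of_nonneg_left h4 (sq_nonneg μ)
    rw [h3] at h2
    linarith
  have hmean' := abs_le.1 hmean
  have hsm : s * (h * b - ∑ i ∈ J, a i) ≤ h * ε := by
    rcases hs with rfl | rfl <;> linarith
  have hcoef : 0 ≤ (1 + s * μ * b) + μ ^ 2 * B * b := by
    have : 0 ≤ μ ^ 2 * B * b := by positivity
    have : 0 ≤ μ * b := by positivity
    rcases hs with rfl | rfl <;> linarith
  calc ∑ i ∈ J, Real.exp (s * μ * (b - a i))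
      ≤ ∑ i ∈ J, ((1 + s * μ * b) + μ ^ 2 * B * b + (μ ^ 2 * B - s * μ) * a i) := sum_le_sum hpt
    _ = #J * ((1 + s * μ * b) + μ ^ 2 * B * b) + (μ ^ 2 * B - s * μ) * ∑ i ∈ J, a i := by
        rw [sum_add_distrib, sum_const, nsmul_eq_mul, mul_sum]
    _ ≤ h * ((1 + s * μ * b) + μ ^ 2 * B * b) + (μ ^ 2 * B - s * μ) * ∑ i ∈ J, a i := by
        gcongr
    _ = h + μ * (s * (h * b - ∑ i ∈ J, a i)) + μ ^ 2 * B * (h * b + ∑ i ∈ J, a i) := by ring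
    _ ≤ h + μ * (h * ε) + μ ^ 2 * B * (h * b + (h * b + h * ε)) := by
        gcongr
        linarith
    _ = h * (μ * (ε + μ * B * (2 * b + ε)) + 1) := by ring
    _ ≤ h * (μ * g + 1) := by gcongr
    _ ≤ h * Real.exp (μ * g) := by gcongr; exact Real.add_one_le_exp _

section Hypergraph

variable {α ι : Type*} [DecidableEq α]

/-- The edges all of whose vertices lie in `U`. -/
def live (I : Finset ι) (e : ι → Finset α) (U : Finset α) : Finset ι := {i ∈ I | e i ⊆ U}

/-- The number of edges inside `U` through `v`. -/
def liveDeg (I : Finset ι) (e : ι → Finset α) (U : Finset α) (v : α) : ℕ :=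
  #{i ∈ live I e U | v ∈ e i}

/-- The number of edges of `J` through `v` that meet the set `s`. -/
def hits (J : Finset ι) (e : ι → Finset α) (v : α) (s : Finset α) : ℕ :=
  #{f ∈ J | v ∈ e f ∧ ¬Disjoint (e f) s}

theorem sum_card_inter_eq_sum_deg (J : Finset ι) (e : ι → Finset α) (Y : Finset α) :
    ∑ i ∈ J, #(Y ∩ e i) = ∑ u ∈ Y, #{i ∈ J | u ∈ e i} := by
  simp only [← filter_mem_eq_inter, card_filter]
  exact sum_comm

theorem liveDeg_sdiff_add_hits (I : Finset ι) (e : ι → Finset α) (U s : Finset α) (v : α) :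
    liveDeg I e (U \ s) v + hits (live I e U) e v s = liveDeg I e U v := by
  rw [liveDeg, liveDeg, hits, ← card_filter_add_card_filter_not (s := {i ∈ live I e U | v ∈ e i})
    (fun i => Disjoint (e i) s), live, live]
  congr 2 <;> ext i <;> simp [subset_sdiff] <;> tauto

theorem hits_le {J : Finset ι} {e : ι → Finset α} {v : α} {s : Finset α} {Δ : ℕ} (hv : v ∉ s)
    (hΔ : ∀ u v, u ≠ v → #{i ∈ J | u ∈ e i ∧ v ∈ e i} ≤ Δ) : hits J e v s ≤ #s * Δ := by
  classical
  refine (card_le_card (t := s.biUnion fun u => {i ∈ J | u ∈ e i ∧ v ∈ e i}) ?_).trans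
    (card_biUnion_le_card_mul _ _ _ fun u hu => hΔ u v (by rintro rfl; exact hv hu))
  intro f hf
  simp only [mem_filter, not_disjoint_iff, mem_biUnion] at hf ⊢
  obtain ⟨hf, hvf, u, hu, hus⟩ := hf
  exact ⟨u, hus, hf, hu, hvf⟩

theorem sum_hits_comm (J : Finset ι) (e : ι → Finset α) (v : α) :
    ∑ i ∈ J with v ∉ e i, hits J e v (e i) =
      ∑ f ∈ J with v ∈ e f, #{i ∈ J | v ∉ e i ∧ ¬Disjoint (e f) (e i)} := by
  simp only [hits, ← filter_filter, card_filter]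
  exact sum_comm

theorem card_meeting_le (J : Finset ι) (e : ι → Finset α) (v : α) (s : Finset α) :
    #{i ∈ J | v ∉ e i ∧ ¬Disjoint s (e i)} ≤ ∑ u ∈ s.erase v, #{i ∈ J | u ∈ e i} := by
  classical
  refine (card_le_card (t := (s.erase v).biUnion fun u => {i ∈ J | u ∈ e i}) ?_).trans
    card_biUnion_le
  intro f hf
  simp only [mem_filter, not_disjoint_iff, mem_biUnion] at hf ⊢
  obtain ⟨hf, hvf, u, hu, hus⟩ := hf
  exact ⟨u, mem_erase.2 ⟨by rintro rfl; exact hvf hus, hu⟩, hf, hus⟩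

theorem sum_deg_le_card_meeting {J : Finset ι} {e : ι → Finset α} {v : α} {s : Finset α} {Δ : ℕ}
    (hv : v ∈ s) (hΔ : ∀ u v, u ≠ v → #{i ∈ J | u ∈ e i ∧ v ∈ e i} ≤ Δ) :
    ∑ u ∈ s.erase v, #{i ∈ J | u ∈ e i} ≤
      #{i ∈ J | v ∉ e i ∧ ¬Disjoint s (e i)} + #s ^ 2 * Δ := by
  have hpair : ∑ i ∈ J, #((s ∩ e i).offDiag) ≤ #s ^ 2 * Δ := by
    calc ∑ i ∈ J, #((s ∩ e i).offDiag)
        = ∑ i ∈ J, #{p ∈ s.offDiag | p.1 ∈ e i ∧ p.2 ∈ e i} := by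
          refine sum_congr rfl fun i _ => congrArg card ?_
          ext p; simp only [mem_offDiag, mem_inter, mem_filter]; tauto
      _ = ∑ p ∈ s.offDiag, #{i ∈ J | p.1 ∈ e i ∧ p.2 ∈ e i} := by
          simp only [card_filter]; exact sum_comm
      _ ≤ #s.offDiag * Δ := by
          refine sum_le_card_nsmul _ _ _ fun p hp => hΔ _ _ (mem_offDiag.1 hp).2.2
      _ ≤ #s ^ 2 * Δ := by
          gcongr; rw [offDiag_card, sq]; exact Nat.sub_le _ _
  rw [← sum_card_inter_eq_sum_deg, card_filter]
  refine le_trans ?_ (Nat.add_le_add_left hpair _)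
  rw [← sum_add_distrib]
  refine sum_le_sum fun i _ => ?_
  rw [erase_inter, offDiag_card]
  by_cases hvi : v ∈ e i
  · have hvs : v ∈ s ∩ e i := mem_inter.2 ⟨hv, hvi⟩
    rw [card_erase_of_mem hvs]
    have := card_pos.2 ⟨v, hvs⟩
    obtain ⟨c, hc⟩ := Nat.exists_eq_add_of_lt this
    rw [hc]
    simp only [hvi, not_true, false_and, if_false, zero_add]
    rw [Nat.le_sub_iff_add_le (Nat.le_mul_self _)]
    simp only [Nat.add_sub_cancel]
    nlinarith
  · rw [erase_eq_of_notMem (by simp [hvi])]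
    by_cases hd : Disjoint s (e i)
    · simp [disjoint_iff_inter_eq_empty.1 hd]
    · have hne : 0 < #(s ∩ e i) := by
        rw [card_pos, nonempty_iff_ne_empty]
        exact fun h => hd (disjoint_iff_inter_eq_empty.2 h)
      obtain ⟨c, hc⟩ := Nat.exists_eq_add_of_lt hne
      rw [hc]
      simp only [hvi, hd, not_false_eq_true, and_self, if_true]
      have : (0 + c + 1) * (0 + c + 1) - (0 + c + 1) = c * c + c := by
        rw [Nat.sub_eq_iff_eq_add (Nat.le_mul_self _)]; ring
      rw [this]
      nlinarith [Nat.zero_le (c * c)]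

theorem abs_sum_card_inter_sub_le {I : Finset ι} {e : ι → Finset α} {U Y : Finset α} {d E : ℝ}
    (hdeg : ∀ u ∈ Y, |(liveDeg I e U u : ℝ) - d| ≤ E) :
    |(∑ i ∈ live I e U, (#(Y ∩ e i) : ℝ)) - #Y * d| ≤ #Y * E := by
  have h1 : (∑ i ∈ live I e U, (#(Y ∩ e i) : ℝ)) - #Y * d =
      ∑ u ∈ Y, ((liveDeg I e U u : ℝ) - d) := by
    rw [sum_sub_distrib, sum_const, nsmul_eq_mul]
    congr 1
    exact_mod_cast sum_card_inter_eq_sum_deg (live I e U) e Y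
  rw [h1]
  refine (abs_sum_le_sum_abs _ _).trans ((sum_le_card_nsmul _ _ _ hdeg).trans_eq ?_)
  rw [nsmul_eq_mul]

theorem abs_card_live_mul_sub_le {I : Finset ι} {e : ι → Finset α} {U : Finset α} {d E : ℝ} {r : ℕ}
    (hr : ∀ i ∈ I, #(e i) = r) (hdeg : ∀ u ∈ U, |(liveDeg I e U u : ℝ) - d| ≤ E) :
    |(#(live I e U) : ℝ) * r - #U * d| ≤ #U * E := by
  convert abs_sum_card_inter_sub_le hdeg using 3
  rw [← nsmul_eq_mul, ← sum_const]
  refine sum_congr rfl fun i hi => ?_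
  obtain ⟨hi, hiU⟩ := mem_filter.1 hi
  rw [inter_eq_right.2 hiU, hr i hi]

theorem abs_mul_sub_le_of_near {r d E q x S D : ℝ} (hr : 1 ≤ r) (hE : 0 < E) (hEd : 4 * E ≤ d)
    (hq : d - E ≤ q) (hq' : q ≤ d + E) (hx : d - E ≤ x) (hx' : x ≤ d + E) (hD : D ≤ E)
    (hS : S ≤ x * ((r - 1) * (d + E))) (hS' : x * ((r - 1) * (d - E) - D) ≤ S) :
    |(r - 1) * d * q - S| ≤ 8 * r * E * q := by
  have hr0 : 0 ≤ r - 1 := by linarith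
  have hd : 0 < d := by linarith
  have hrd : 0 ≤ (r - 1) * d := mul_nonneg hr0 hd.le
  have a1 : (r - 1) * d * q ≤ (r - 1) * d * (d + E) := mul_le_mul_of_nonneg_left hq' hrd
  have a2 : (r - 1) * d * (d - E) ≤ (r - 1) * d * q := mul_le_mul_of_nonneg_left hq hrd
  have a3 : x * ((r - 1) * (d + E)) ≤ (d + E) * ((r - 1) * (d + E)) :=
    mul_le_mul_of_nonneg_right hx' (mul_nonneg hr0 (by linarith))
  have a4 : (d - E) * ((r - 1) * (d - E)) ≤ x * ((r - 1) * (d - E)) :=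
    mul_le_mul_of_nonneg_right hx (mul_nonneg hr0 (by linarith))
  have a5 : x * D ≤ x * E := mul_le_mul_of_nonneg_left hD (by linarith)
  have a6 : x * E ≤ (d + E) * E := mul_le_mul_of_nonneg_right hx' hE.le
  have a7 : 8 * r * E * (d - E) ≤ 8 * r * E * q :=
    mul_le_mul_of_nonneg_left hq (by positivity)
  have a8 : 0 ≤ E * (d - 4 * E) := mul_nonneg hE.le (by linarith)
  have a9 : 0 ≤ (r - 1) * (E * (d - 4 * E)) := mul_nonneg hr0 a8
  have a10 : 0 ≤ (r - 1) * (E * E) := by positivity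
  have a11 : 0 ≤ (r - 1) * d * E := by positivity
  have a12 : 0 ≤ d * E := by positivity
  rw [abs_le]
  constructor <;> linarith

theorem sum_exp_hits_le {I : Finset ι} {e : ι → Finset α} {U : Finset α} {d E μ B s : ℝ} {r Δ : ℕ}
    {v : α} (hs : s = 1 ∨ s = -1) (hr1 : 1 ≤ r) (hr : ∀ i ∈ I, #(e i) = r)
    (hΔ : ∀ u v, u ≠ v → #{i ∈ I | u ∈ e i ∧ v ∈ e i} ≤ Δ) (hv : v ∈ U)
    (hdeg : ∀ u ∈ U, |(liveDeg I e U u : ℝ) - d| ≤ E) (hE : 0 < E) (hEd : 4 * E ≤ d)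
    (hΔE : (r : ℝ) ^ 2 * Δ ≤ E) (hB : (r : ℝ) * Δ ≤ B) (hB' : d * (r ^ 2 / #U) ≤ B)
    (hμ : 0 ≤ μ) (hμB : μ * B ≤ 1) (hμBd : μ * B * d ≤ E) :
    ∑ i ∈ live I e U with v ∉ e i,
        Real.exp (s * μ * (d * (r * (r - 1) / #U) - hits (live I e U) e v (e i))) ≤
      #(live I e U) * Real.exp (μ * (12 * r ^ 2 * E / #U)) := by
  set J := live I e U with hJ
  have hJI : J ⊆ I := filter_subset _ _
  have hw : (0 : ℝ) < #U := by exact_mod_cast card_pos.2 ⟨v, hv⟩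
  set w : ℝ := (#U : ℝ) with hw_def
  have hrr : (1 : ℝ) ≤ r := by exact_mod_cast hr1
  have hd : 0 < d := by linarith
  have hΔJ : ∀ u v, u ≠ v → #{i ∈ J | u ∈ e i ∧ v ∈ e i} ≤ Δ := fun u v huv =>
    (card_le_card (filter_subset_filter _ hJI)).trans (hΔ u v huv)
  have hB0 : 0 ≤ B := le_trans (by positivity) hB
  have hbB : d * (r * (r - 1) / w) ≤ B := by
    refine le_trans ?_ hB'
    gcongr
    nlinarith
  have hb0 : 0 ≤ d * (r * (r - 1) / w) :=
    mul_nonneg hd.le (div_nonneg (mul_nonneg (by linarith) (by linarith)) hw.le)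
  have hcard := abs_le.1 (abs_card_live_mul_sub_le hr hdeg)
  rw [← hJ, ← hw_def] at hcard
  set h : ℝ := (#J : ℝ) with hh
  have hx := abs_le.1 (hdeg v hv)
  have hxJ : (liveDeg I e U v : ℝ) = #{f ∈ J | v ∈ e f} := rfl
  set x : ℝ := (liveDeg I e U v : ℝ) with hx_def
  -- bounds for the total number of hits
  have hswap : (∑ i ∈ J with v ∉ e i, (hits J e v (e i) : ℝ)) =
      ∑ f ∈ J with v ∈ e f, (#{i ∈ J | v ∉ e i ∧ ¬Disjoint (e f) (e i)} : ℝ) := by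
    exact_mod_cast sum_hits_comm J e v
  have herase : ∀ f ∈ {f ∈ J | v ∈ e f},
      |(∑ u ∈ (e f).erase v, (#{i ∈ J | u ∈ e i} : ℝ)) - (r - 1) * d| ≤ (r - 1) * E := by
    intro f hf
    obtain ⟨hfJ, hvf⟩ := mem_filter.1 hf
    obtain ⟨hfI, hfU⟩ := mem_filter.1 hfJ
    have hc : (#((e f).erase v) : ℝ) = r - 1 := by
      rw [card_erase_of_mem hvf, hr f hfI, Nat.cast_sub hr1, Nat.cast_one]
    rw [← hc, ← nsmul_eq_mul, ← nsmul_eq_mul, ← sum_const, ← sum_sub_distrib]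
    refine (abs_sum_le_sum_abs _ _).trans ?_
    exact sum_le_card_nsmul _ _ _ fun u hu => hdeg u (hfU (mem_of_mem_erase hu))
  have hub : (∑ i ∈ J with v ∉ e i, (hits J e v (e i) : ℝ)) ≤ x * ((r - 1) * (d + E)) := by
    rw [hswap, hxJ, ← nsmul_eq_mul]
    refine sum_le_card_nsmul _ _ _ fun f hf => ?_
    have h1 : (#{i ∈ J | v ∉ e i ∧ ¬Disjoint (e f) (e i)} : ℝ) ≤
        ∑ u ∈ (e f).erase v, (#{i ∈ J | u ∈ e i} : ℝ) := by
      exact_mod_cast card_meeting_le J e v (e f)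
    have h2 := (abs_le.1 (herase f hf)).2
    linarith
  have hlb : x * ((r - 1) * (d - E) - r ^ 2 * Δ) ≤
      ∑ i ∈ J with v ∉ e i, (hits J e v (e i) : ℝ) := by
    rw [hswap, hxJ, ← nsmul_eq_mul]
    refine card_nsmul_le_sum _ _ _ fun f hf => ?_
    obtain ⟨hfJ, hvf⟩ := mem_filter.1 hf
    have h1 : (∑ u ∈ (e f).erase v, (#{i ∈ J | u ∈ e i} : ℝ)) ≤
        (#{i ∈ J | v ∉ e i ∧ ¬Disjoint (e f) (e i)} : ℝ) + r ^ 2 * Δ := by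
      have := sum_deg_le_card_meeting hvf hΔJ
      rw [hr f (hJI hfJ)] at this
      exact_mod_cast this
    have h2 := (abs_le.1 (herase f hf)).1
    linarith
  set S : ℝ := ∑ i ∈ J with v ∉ e i, (hits J e v (e i) : ℝ) with hS
  have hwd : w * d ≤ 2 * (h * r) := by nlinarith
  refine sum_exp_le_of_mean _ _ (ε := 8 * r ^ 2 * E / w) (B := B) hs ?_
    (fun i _ => Nat.cast_nonneg _) hb0 hμ ((mul_le_mul_of_nonneg_left hbB hμ).trans hμB) hB0 ?_
    hμB ?_ ?_
  · exact Nat.cast_le.2 (card_le_card (filter_subset _ _))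
  · intro i hi
    obtain ⟨hiJ, hvi⟩ := mem_filter.1 hi
    have h1 : (hits J e v (e i) : ℝ) ≤ r * Δ := by
      have := hits_le hvi hΔJ
      rw [hr i (hJI hiJ)] at this
      exact_mod_cast this
    have h0 : (0 : ℝ) ≤ hits J e v (e i) := Nat.cast_nonneg _
    rw [abs_le]
    constructor <;> linarith
  · have e1 : h * (d * (r * (r - 1) / w)) = (r - 1) * d * (h * r / w) := by ring
    have hq1 : h * r / w ≤ d + E := by rw [div_le_iff₀ hw]; linarith
    have hq2 : d - E ≤ h * r / w := by rw [le_div_iff₀ hw]; linarith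
    have e2 : h * (8 * r ^ 2 * E / w) = 8 * r * E * (h * r / w) := by ring
    rw [e1, e2]
    exact abs_mul_sub_le_of_near hrr hE hEd hq2 hq1 (by linarith) (by linarith) hΔE hub hlb
  · have e1 : μ * B * (2 * (d * (r * (r - 1) / w)) + 8 * r ^ 2 * E / w) ≤
        μ * B * (d * (4 * r ^ 2 / w)) := by
      have hm : 0 ≤ μ * B := mul_nonneg hμ hB0
      refine mul_le_mul_of_nonneg_left ?_ hm
      have : d * (4 * r ^ 2 / w) - (2 * (d * (r * (r - 1) / w)) + 8 * r ^ 2 * E / w) =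
        (2 * r ^ 2 * (d - 4 * E) + 2 * r * d) / w := by field_simp; ring
      have h3 : 0 ≤ (2 * r ^ 2 * (d - 4 * E) + 2 * r * d) / w := by
        have : 0 ≤ d - 4 * E := by linarith
        positivity
      linarith
    have e2 : μ * B * (d * (4 * r ^ 2 / w)) ≤ E * (4 * r ^ 2 / w) := by
      rw [← mul_assoc]; gcongr
    have e3 : 12 * r ^ 2 * E / w = 8 * r ^ 2 * E / w + E * (4 * r ^ 2 / w) := by ring
    linarith

theorem sum_exp_card_inter_le {I : Finset ι} {e : ι → Finset α} {U Y : Finset α}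
    {d E μ ε m : ℝ} {r : ℕ} (hr1 : 1 ≤ r) (hr : ∀ i ∈ I, #(e i) = r) (hYU : Y ⊆ U)
    (hY : (#Y : ℝ) ≤ m) (hU : U.Nonempty)
    (hdeg : ∀ u ∈ U, |(liveDeg I e U u : ℝ) - d| ≤ E) (hE : 0 < E) (hEd : 4 * E ≤ d)
    (hEε : E ≤ ε * d) (hμ : 0 ≤ μ) (hμr : μ * r ≤ ε) (hε : ε ≤ 1) :
    ∑ i ∈ live I e U, Real.exp (μ * (#Y * (r / #U) - #(Y ∩ e i))) ≤
      #(live I e U) * Real.exp (μ * (10 * ε * m * r / #U)) := by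
  set J := live I e U with hJ
  have hw : (0 : ℝ) < #U := by exact_mod_cast card_pos.2 hU
  have hYU' : (#Y : ℝ) ≤ #U := by exact_mod_cast card_le_card hYU
  have hcard := abs_le.1 (abs_card_live_mul_sub_le hr hdeg)
  have hsum := abs_le.1 (abs_sum_card_inter_sub_le (Y := Y) fun u hu => hdeg u (hYU hu))
  rw [← hJ] at hcard hsum
  set w : ℝ := (#U : ℝ) with hw_def
  set y : ℝ := (#Y : ℝ) with hy
  set h : ℝ := (#J : ℝ) with hh
  have hrr : (1 : ℝ) ≤ r := by exact_mod_cast hr1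
  have hd : 0 < d := by linarith
  have hy0 : 0 ≤ y := Nat.cast_nonneg _
  have hm0 : 0 ≤ m := hy0.trans hY
  have hε0 : 0 ≤ ε := le_trans (by positivity) hμr
  have key := sum_exp_le_of_mean J (fun i => (#(Y ∩ e i) : ℝ)) (h := h) (b := y * (r / w))
    (B := r) (μ := μ) (ε := 4 * ε * m * r / w) (g := 10 * ε * m * r / w) (s := 1) (Or.inl rfl)
    le_rfl (fun i _ => Nat.cast_nonneg _) (by positivity) hμ ?_ (by positivity) ?_ (hμr.trans hε)
    ?_ ?_
  · simpa using key
  · have : y * (r / w) ≤ r := by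
      rw [← mul_div_assoc, div_le_iff₀ hw]; nlinarith
    nlinarith
  · intro i hi
    have h1 : (#(Y ∩ e i) : ℝ) ≤ r := by
      have := card_le_card (inter_subset_right (s₁ := Y) (s₂ := e i))
      rw [hr i (mem_filter.1 hi).1] at this
      exact_mod_cast this
    have h2 : y * (r / w) ≤ r := by
      rw [← mul_div_assoc, div_le_iff₀ hw]; nlinarith
    have h3 : 0 ≤ y * (r / w) := by positivity
    have h4 : (0 : ℝ) ≤ #(Y ∩ e i) := Nat.cast_nonneg _
    rw [abs_le]; constructor <;> linarith
  · have hq1 : h * r / w ≤ d + E := by rw [div_le_iff₀ hw]; linarith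
    have hq2 : d - E ≤ h * r / w := by rw [le_div_iff₀ hw]; linarith
    have e1 : h * (y * (r / w)) = y * (h * r / w) := by ring
    have e2 : h * (4 * ε * m * r / w) = 4 * ε * m * (h * r / w) := by ring
    rw [e1, e2]
    set q := h * r / w
    have a1 : y * q ≤ y * (d + E) := by gcongr
    have a2 : y * (d - E) ≤ y * q := by gcongr
    have a3 : 4 * ε * m * (d / 2) ≤ 4 * ε * m * q := by gcongr; linarith
    have a4 : y * E ≤ m * (ε * d) := by gcongr
    rw [abs_le]; constructor <;> linarith
  · have hyr : y * (r / w) ≤ m * r / w := by rw [mul_div_assoc]; gcongr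
    have e1 : μ * r * (2 * (y * (r / w)) + 4 * ε * m * r / w) ≤ ε * (6 * (m * r / w)) := by
      have h1 : 4 * ε * m * r / w ≤ 4 * (m * r / w) := by
        have : 4 * ε * m * r / w = ε * (4 * (m * r / w)) := by ring
        rw [this]
        exact mul_le_of_le_one_left (by positivity) hε
      refine mul_le_mul hμr ?_ (by positivity) hε0
      linarith
    have e3 : 10 * ε * m * r / w = 4 * ε * m * r / w + ε * (6 * (m * r / w)) := by ring
    linarith

/-- The potential controlling the random greedy matching: `U` is the set of uncovered vertices,
`d` and `E` the expected degree and the permitted error, `q` the density of `U`, and `c` the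
permitted size of a test set divided by `q`. -/
noncomputable def potential {τ : Type*} (I : Finset ι) (e : ι → Finset α) (𝒯 : Finset τ)
    (Y : τ → Finset α) (μ ν : ℝ) (U : Finset α) (d E q c : ℝ) : ℝ :=
  ∑ v ∈ U, (Real.exp (μ * (liveDeg I e U v - d - E)) + Real.exp (μ * (d - liveDeg I e U v - E))) +
    ∑ T ∈ 𝒯, Real.exp (ν * (#(Y T ∩ U) / q - c))

variable {τ : Type*} {I : Finset ι} {e : ι → Finset α} {𝒯 : Finset τ} {Y : τ → Finset α}
  {μ ν d E q c : ℝ} {U : Finset α}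

theorem abs_liveDeg_sub_le_of_potential_le_one (hμ : 0 < μ)
    (hpot : potential I e 𝒯 Y μ ν U d E q c ≤ 1) {v : α} (hv : v ∈ U) :
    |(liveDeg I e U v : ℝ) - d| ≤ E := by
  have h1 := single_le_sum (f := fun v => Real.exp (μ * (liveDeg I e U v - d - E)) +
    Real.exp (μ * (d - liveDeg I e U v - E))) (fun v _ => by positivity) hv
  have h2 : 0 ≤ ∑ T ∈ 𝒯, Real.exp (ν * (#(Y T ∩ U) / q - c)) := by positivity
  have h3 : Real.exp (μ * (liveDeg I e U v - d - E)) +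
    Real.exp (μ * (d - liveDeg I e U v - E)) ≤ 1 := by
    unfold potential at hpot; linarith
  have h4 := Real.exp_pos (μ * (liveDeg I e U v - d - E))
  have h5 := Real.exp_pos (μ * (d - liveDeg I e U v - E))
  have h6 : μ * (liveDeg I e U v - d - E) ≤ 0 := Real.exp_le_one_iff.1 (by linarith)
  have h7 : μ * (d - liveDeg I e U v - E) ≤ 0 := Real.exp_le_one_iff.1 (by linarith)
  have h8 := nonpos_of_mul_nonpos_right h6 hμ
  have h9 := nonpos_of_mul_nonpos_right h7 hμ
  rw [abs_le]; constructor <;> linarith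

theorem card_inter_le_of_potential_le_one (hν : 0 < ν) (hq : 0 < q)
    (hpot : potential I e 𝒯 Y μ ν U d E q c ≤ 1) {T : τ} (hT : T ∈ 𝒯) :
    (#(Y T ∩ U) : ℝ) ≤ q * c := by
  have h1 := single_le_sum (f := fun T => Real.exp (ν * (#(Y T ∩ U) / q - c)))
    (fun v _ => by positivity) hT
  have h2 : 0 ≤ ∑ v ∈ U, (Real.exp (μ * (liveDeg I e U v - d - E)) +
    Real.exp (μ * (d - liveDeg I e U v - E))) := by positivity
  have h3 : Real.exp (ν * (#(Y T ∩ U) / q - c)) ≤ 1 := by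
    unfold potential at hpot; linarith
  have h8 := nonpos_of_mul_nonpos_right (Real.exp_le_one_iff.1 h3) hν
  have h9 : (#(Y T ∩ U) : ℝ) / q ≤ c := by linarith
  rwa [div_le_iff₀' hq] at h9

theorem exists_potential_sdiff_le {E' c' B ε m : ℝ} {r Δ : ℕ}
    (hr1 : 1 ≤ r) (hr : ∀ i ∈ I, #(e i) = r)
    (hΔ : ∀ u v, u ≠ v → #{i ∈ I | u ∈ e i ∧ v ∈ e i} ≤ Δ) (hU : U.Nonempty)
    (hY : ∀ T ∈ 𝒯, (#(Y T) : ℝ) ≤ m)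
    (hpot : potential I e 𝒯 Y μ ν U d E q c ≤ 1) (hE : 0 < E) (hEd : 4 * E ≤ d)
    (hEε : E ≤ ε * d) (hε : ε ≤ 1)
    (hΔE : (r : ℝ) ^ 2 * Δ ≤ E) (hB : (r : ℝ) * Δ ≤ B) (hB' : d * (r ^ 2 / #U) ≤ B)
    (hμ : 0 < μ) (hμB : μ * B ≤ 1) (hμBd : μ * B * d ≤ E) (hν : 0 < ν)
    (hq' : 0 < q * (1 - r / #U)) (hq : 0 < q) (hνr : ν / (q * (1 - r / #U)) * r ≤ ε)
    (hE' : E + 12 * r ^ 2 * E / #U ≤ E')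
    (hc' : c + 10 * ε * m * r / #U / (q * (1 - r / #U)) ≤ c') :
    ∃ i ∈ live I e U, potential I e 𝒯 Y μ ν (U \ e i) (d * (1 - r * (r - 1) / #U)) E'
      (q * (1 - r / #U)) c' ≤ potential I e 𝒯 Y μ ν U d E q c := by
  have hdeg : ∀ u ∈ U, |(liveDeg I e U u : ℝ) - d| ≤ E := fun u hu =>
    abs_liveDeg_sub_le_of_potential_le_one hμ hpot hu
  have hw : (0 : ℝ) < #U := by exact_mod_cast card_pos.2 hU
  have hne : (live I e U).Nonempty := by
    rw [← card_pos]
    by_contra h0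
    have h0 : #(live I e U) = 0 := by omega
    have := abs_le.1 (abs_card_live_mul_sub_le hr hdeg)
    rw [h0] at this
    have h2 : 0 < (#U : ℝ) * (d - E) := mul_pos hw (by linarith)
    norm_num at this
    linarith
  refine exists_le_of_sum_le hne ?_
  rw [sum_const, nsmul_eq_mul]
  set w : ℝ := (#U : ℝ) with hw_def
  set q' := q * (1 - r / w) with hq'_def
  set J := live I e U with hJ
  -- the two degree terms
  have hdegterm : ∀ v ∈ U, ∀ s : ℝ, s = 1 ∨ s = -1 →
      ∑ i ∈ J with v ∉ e i, Real.exp (μ * (s * (liveDeg I e (U \ e i) v -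
        d * (1 - r * (r - 1) / w)) - E')) ≤
      #J * Real.exp (μ * (s * (liveDeg I e U v - d) - E)) := by
    intro v hv s hs
    have key := sum_exp_hits_le hs hr1 hr hΔ hv hdeg hE hEd hΔE hB hB' hμ.le hμB hμBd
    have hpos := (Real.exp_pos (μ * (s * (liveDeg I e U v - d) - E - 12 * r ^ 2 * E / w))).le
    have key2 := mul_le_mul_of_nonneg_left key hpos
    rw [mul_sum, mul_left_comm, ← Real.exp_add] at key2
    refine le_trans (sum_le_sum fun i _ => ?_) (key2.trans_eq ?_)
    · rw [← Real.exp_add]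
      refine Real.exp_le_exp.2 ?_
      have h1 : (liveDeg I e (U \ e i) v : ℝ) + hits J e v (e i) = liveDeg I e U v := by
        exact_mod_cast liveDeg_sdiff_add_hits I e U (e i) v
      rw [← h1]
      have h2 := mul_le_mul_of_nonneg_left hE' hμ.le
      linarith
    · congr 2; ring
  have htest : ∀ T ∈ 𝒯, ∑ i ∈ J, Real.exp (ν * (#(Y T ∩ (U \ e i)) / q' - c')) ≤
      #J * Real.exp (ν * (#(Y T ∩ U) / q - c)) := by
    intro T hT
    have hym : (#(Y T ∩ U) : ℝ) ≤ m :=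
      le_trans (by exact_mod_cast card_le_card inter_subset_left) (hY T hT)
    have key := sum_exp_card_inter_le (Y := Y T ∩ U) (μ := ν / q') hr1 hr inter_subset_right hym hU
      hdeg hE hEd hEε (by positivity) hνr hε
    have hpos := (Real.exp_pos (ν * (#(Y T ∩ U) / q - c) -
      ν / q' * (10 * ε * m * r / w))).le
    have key2 := mul_le_mul_of_nonneg_left key hpos
    rw [mul_sum, mul_left_comm, ← Real.exp_add] at key2
    refine le_trans (sum_le_sum fun i _ => ?_) (key2.trans_eq ?_)
    · rw [← Real.exp_add]
      refine Real.exp_le_exp.2 ?_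
      have h1 : (#(Y T ∩ (U \ e i)) : ℝ) = #(Y T ∩ U) - #(Y T ∩ U ∩ e i) := by
        rw [eq_sub_iff_add_eq, ← inter_sdiff_assoc]
        exact_mod_cast card_sdiff_add_card_inter _ _
      rw [h1]
      have h2 := mul_le_mul_of_nonneg_left hc' hν.le
      have h3 : (#(Y T ∩ U) : ℝ) / q = #(Y T ∩ U) * (1 - r / w) / q' := by
        rw [hq'_def, mul_div_mul_right _ _ (pos_of_mul_pos_right hq' hq.le).ne']
      rw [h3]
      have h4 : ν * (((#(Y T ∩ U) : ℝ) - #(Y T ∩ U ∩ e i)) / q' - c') =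
        ν * (#(Y T ∩ U) * (1 - r / w) / q') + ν / q' * (#(Y T ∩ U) * (r / w) - #(Y T ∩ U ∩ e i))
        - ν * c' := by ring
      rw [h4]
      have h5 : ν * (c + 10 * ε * m * r / w / q') = ν * c + ν / q' * (10 * ε * m * r / w) := by
        ring
      linarith
    · congr 2; ring
  have hswap : ∀ f : ι → α → ℝ, ∑ i ∈ J, ∑ v ∈ U \ e i, f i v =
      ∑ v ∈ U, ∑ i ∈ J with v ∉ e i, f i v := by
    intro f
    refine sum_comm' fun i v => ?_
    simp only [mem_sdiff, mem_filter]; tauto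
  simp only [potential, sum_add_distrib]
  rw [hswap, hswap, sum_comm (s := J), mul_add, mul_add, mul_sum, mul_sum, mul_sum]
  refine add_le_add (add_le_add ?_ ?_) (sum_le_sum htest)
  · refine sum_le_sum fun v hv => ?_
    have := hdegterm v hv 1 (Or.inl rfl)
    simpa only [one_mul] using this
  · refine sum_le_sum fun v hv => ?_
    have := hdegterm v hv (-1) (Or.inr rfl)
    simpa only [neg_one_mul, neg_sub] using this

end Hypergraph

section Hypergraph

variable {α ι : Type*} [DecidableEq α]

theorem exp_neg_two_mul_le_one_sub {y : ℝ} (h0 : 0 ≤ y) (h1 : y ≤ 1 / 2) :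
    Real.exp (-(2 * y)) ≤ 1 - y := by
  rw [Real.exp_neg, inv_le_comm₀ (Real.exp_pos _) (by linarith)]
  refine le_trans ?_ (Real.add_one_le_exp _)
  rw [inv_le_iff_one_le_mul₀ (by linarith)]
  nlinarith

set_option maxHeartbeats 1600000 in
/-- The random greedy algorithm can be run for `j` steps, as long as a proportion `δ` of the
vertices stays uncovered, keeping all degrees and test sets under control. -/
theorem exists_partial_matching {τ : Type*} {I : Finset ι} {e : ι → Finset α} {V : Finset α}
    {𝒯 : Finset τ} {Y : τ → Finset α} {r D Δ : ℕ} {δ ε η m : ℝ}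
    (hr1 : 1 ≤ r) (hr : ∀ i ∈ I, #(e i) = r) (hV : ∀ i ∈ I, e i ⊆ V)
    (hD : ∀ v ∈ V, #{i ∈ I | v ∈ e i} = D)
    (hΔ : ∀ u v, u ≠ v → #{i ∈ I | u ∈ e i ∧ v ∈ e i} ≤ Δ)
    (hm : 0 ≤ m) (hY : ∀ T ∈ 𝒯, (#(Y T) : ℝ) ≤ m)
    (hδ : 0 < δ) (hδ1 : δ ≤ 1) (hε : 0 < ε) (hε4 : ε ≤ 1 / 4)
    (hη : η = ε * Real.exp (-(14 * r ^ 2 / δ))) (hD0 : 0 < D) (hΔ0 : 0 < Δ)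
    (hΔD : (r : ℝ) ^ 2 * Δ ≤ η * D) (hDN : D ≤ #V * Δ) (hN : 2 * (r : ℝ) ^ 2 ≤ δ * #V)
    (hpot : 2 * #V * Real.exp (-(η * δ / (r ^ 2 * Δ) * (η * D))) +
      #𝒯 * Real.exp (-(ε * δ / r * (m / 2))) ≤ 1) (j : ℕ) (hj : δ * #V ≤ #V - r * j) :
    ∃ (U : Finset α) (M : Finset ι) (d : ℝ), (#U : ℝ) = #V - r * j ∧ M ⊆ I ∧
      (∀ i ∈ M, ∀ i' ∈ M, i ≠ i' → Disjoint (e i) (e i')) ∧ (∀ i ∈ M, Disjoint (e i) U) ∧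
      (∀ u ∈ V, u ∉ U → ∃ i ∈ M, u ∈ e i) ∧
      D * Real.exp (-(2 * (r ^ 2 / (δ * #V)) * j)) ≤ d ∧ d ≤ D ∧
      potential I e 𝒯 Y (η * δ / (r ^ 2 * Δ)) (ε * δ / r) U d
        (η * D * (1 + 12 * r ^ 2 / (δ * #V)) ^ j) ((#V - r * j) / #V)
        (3 * m / 2 + j * (10 * ε * m * r / (δ ^ 2 * #V))) ≤ 1 := by
  classical
  have hrr : (1 : ℝ) ≤ r := by exact_mod_cast hr1
  have hN0 : (0 : ℝ) < #V := by
    by_contra h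
    have : δ * #V ≤ 0 := mul_nonpos_of_nonneg_of_nonpos hδ.le (not_lt.1 h)
    nlinarith
  have hD0' : (0 : ℝ) < D := by exact_mod_cast hD0
  have hΔ0' : (0 : ℝ) < Δ := by exact_mod_cast hΔ0
  have hη0 : 0 < η := by rw [hη]; positivity
  have hη1 : η ≤ 1 := by
    rw [hη]
    have : Real.exp (-(14 * r ^ 2 / δ)) ≤ 1 := Real.exp_le_one_iff.2 (by
      rw [neg_nonpos]; positivity)
    nlinarith [Real.exp_pos (-(14 * (r : ℝ) ^ 2 / δ))]
  induction j with
  | zero =>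
    refine ⟨V, ∅, D, by simp, by simp, by simp, by simp, fun u hu hu' => absurd hu hu', by simp,
      le_rfl, ?_⟩
    refine le_trans ?_ hpot
    have hlive : live I e V = I := filter_true_of_mem hV
    have hdeg : ∀ v ∈ V, liveDeg I e V v = D := fun v hv => by rw [liveDeg, hlive, hD v hv]
    rw [potential]
    refine add_le_add (le_of_eq ?_) ?_
    · rw [sum_congr rfl fun v hv => by rw [hdeg v hv], sum_const, nsmul_eq_mul]
      ring_nf
    · refine (sum_le_card_nsmul _ _ _ fun T hT => Real.exp_le_exp.2 ?_).trans_eq (nsmul_eq_mul _ _)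
      have h1 : (#(Y T ∩ V) : ℝ) ≤ m :=
        le_trans (by exact_mod_cast card_le_card inter_subset_left) (hY T hT)
      have h2 : (0 : ℝ) ≤ ε * δ / r := by positivity
      have h3 : ((#V : ℝ) - r * (0 : ℕ)) / #V = 1 := by
        rw [Nat.cast_zero, mul_zero, sub_zero, div_self hN0.ne']
      rw [h3, ← mul_neg]
      refine mul_le_mul_of_nonneg_left ?_ h2
      simp only [div_one, Nat.cast_zero, zero_mul]
      linarith
  | succ j ih =>
    push_cast at hj ⊢
    have hj' : δ * #V ≤ #V - r * j := by linarith
    obtain ⟨U, M, d, hU, hMI, hM, hMU, hcov, hd, hdD, hp⟩ := ih hj'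
    set N : ℝ := (#V : ℝ) with hN_def
    set w : ℝ := (#U : ℝ) with hw_def
    have hδN : 0 < δ * N := mul_pos hδ hN0
    have hw : δ * N ≤ w := by rw [hU]; exact hj'
    have hw0 : 0 < w := lt_of_lt_of_le hδN hw
    have hUne : U.Nonempty := card_pos.1 (Nat.cast_pos.1 (hw_def ▸ hw0))
    have hjN : (j : ℝ) ≤ N := by nlinarith [Nat.cast_nonneg (α := ℝ) j]
    set a : ℝ := r ^ 2 / (δ * N) with ha
    have ha0 : 0 ≤ a := by positivity
    have haj : a * j ≤ r ^ 2 / δ := by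
      calc a * j ≤ a * N := by gcongr
        _ = r ^ 2 / δ := by rw [ha]; field_simp
    have haw : (r : ℝ) ^ 2 / w ≤ a := by rw [ha]; gcongr
    have ha2 : a ≤ 1 / 2 := by rw [ha, div_le_iff₀ hδN]; linarith
    set ρ : ℝ := 1 + 12 * r ^ 2 / (δ * N) with hρ
    have hρa : ρ = 1 + 12 * a := by rw [hρ, ha]; ring
    have hρj : ρ ^ j ≤ Real.exp (12 * (r ^ 2 / δ)) := by
      calc ρ ^ j ≤ Real.exp (12 * a) ^ j := by
            rw [hρa]; gcongr; rw [add_comm]; exact Real.add_one_le_exp _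
        _ = Real.exp (12 * (a * j)) := by rw [← Real.exp_nat_mul]; ring_nf
        _ ≤ _ := by gcongr
    have hρ1 : 1 ≤ ρ ^ j := one_le_pow₀ (by rw [hρa]; linarith)
    set E : ℝ := η * D * ρ ^ j with hE_def
    have hηE : η * D ≤ E := le_mul_of_one_le_right (by positivity) hρ1
    have hE0 : 0 < E := lt_of_lt_of_le (by positivity) hηE
    have hEε : E ≤ ε * d := by
      calc E ≤ η * D * Real.exp (12 * (r ^ 2 / δ)) := by rw [hE_def]; gcongr
        _ = ε * (D * Real.exp (-(2 * (r ^ 2 / δ)))) := by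
          rw [hη, mul_right_comm, mul_assoc ε, ← Real.exp_add]; ring_nf
        _ ≤ ε * (D * Real.exp (-(2 * a * j))) := by
          rw [mul_assoc 2]; gcongr
        _ ≤ ε * d := by gcongr
    have hd0 : 0 < d := lt_of_lt_of_le (by positivity) hd
    have hq'eq : (N - r * j) / N * (1 - r / w) = (N - r * (j + 1)) / N := by
      rw [← hU, one_sub_div hw0.ne']
      field_simp
      rw [hU]; ring
    have hq'δ : δ ≤ (N - r * (j + 1)) / N := by rwa [le_div_iff₀ hN0]
    have hB0 : 0 < (r : ℝ) ^ 2 * Δ / δ := by positivity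
    refine (exists_potential_sdiff_le (I := I) (e := e) (𝒯 := 𝒯) (Y := Y) (U := U)
      (d := d) (E := E) (E' := E * ρ) (q := (N - r * j) / N)
      (c := 3 * m / 2 + j * (10 * ε * m * r / (δ ^ 2 * N)))
      (c' := 3 * m / 2 + (j + 1) * (10 * ε * m * r / (δ ^ 2 * N))) (B := r ^ 2 * Δ / δ)
      (ε := ε) (m := m) (μ := η * δ / (r ^ 2 * Δ)) (ν := ε * δ / r)
      hr1 hr hΔ hUne hY hp hE0 (by nlinarith) hEε (by linarith) (hΔD.trans hηE) ?_ ?_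
      (by positivity) ?_ ?_ (by positivity) ?_ ?_ ?_ ?_ ?_).elim fun i hh => ?_
    rotate_right
    · obtain ⟨hi, hle⟩ := hh
      obtain ⟨hiI, hiU⟩ := mem_filter.1 hi
      have hcardU : (#(U \ e i) : ℝ) = w - r := by
        have := card_sdiff_add_card_inter U (e i)
        rw [inter_eq_right.2 hiU, hr i hiI] at this
        rw [eq_sub_iff_add_eq, hw_def]; exact_mod_cast this
      refine ⟨U \ e i, insert i M, d * (1 - r * (r - 1) / w), ?_, ?_, ?_, ?_, ?_, ?_, ?_, ?_⟩
      · rw [hcardU, hU]; ring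
      · exact insert_subset hiI hMI
      · have hnew : ∀ i' ∈ M, Disjoint (e i') (e i) := fun i' hi' => (hMU i' hi').mono_right hiU
        intro i₁ h₁ i₂ h₂ hne
        rw [mem_insert] at h₁ h₂
        rcases h₁ with rfl | h₁ <;> rcases h₂ with rfl | h₂
        · exact absurd rfl hne
        · exact (hnew _ h₂).symm
        · exact hnew _ h₁
        · exact hM _ h₁ _ h₂ hne
      · intro i' hi'
        rcases mem_insert.1 hi' with rfl | hi'
        · exact disjoint_sdiff
        · exact (hMU i' hi').mono_right sdiff_subset
      · intro u hu hu'
        by_cases huU : u ∈ U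
        · refine ⟨i, mem_insert_self _ _, ?_⟩
          by_contra h
          exact hu' (mem_sdiff.2 ⟨huU, h⟩)
        · obtain ⟨i', hi', h⟩ := hcov u hu huU
          exact ⟨i', mem_insert_of_mem hi', h⟩
      · have h1 : Real.exp (-(2 * a)) ≤ 1 - r * (r - 1) / w := by
          refine (exp_neg_two_mul_le_one_sub ha0 ha2).trans ?_
          have : r * (r - 1) / w ≤ r ^ 2 / w := by gcongr; nlinarith
          linarith
        have h2 : D * Real.exp (-(2 * a * (j + 1))) =
            D * Real.exp (-(2 * a * j)) * Real.exp (-(2 * a)) := by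
          rw [mul_assoc (D : ℝ), ← Real.exp_add]; ring_nf
        rw [h2]
        exact mul_le_mul hd h1 (Real.exp_pos _).le hd0.le
      · refine le_trans (mul_le_of_le_one_right hd0.le ?_) hdD
        have : 0 ≤ r * (r - 1) / w :=
          div_nonneg (mul_nonneg (by linarith) (by linarith)) hw0.le
        linarith
      · rw [hq'eq] at hle
        have h3 : η * D * ρ ^ (j + 1) = E * ρ := by rw [hE_def, pow_succ]; ring
        rw [h3]
        exact hle.trans hp
    · rw [le_div_iff₀ hδ]
      have h1 : (r : ℝ) ≤ r ^ 2 := by nlinarith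
      calc (r : ℝ) * Δ * δ ≤ r ^ 2 * Δ * 1 := by gcongr
        _ = _ := mul_one _
    · have hDN' : (D : ℝ) ≤ N * Δ := by rw [hN_def]; exact_mod_cast hDN
      calc d * (r ^ 2 / w) ≤ (N * Δ) * a := by gcongr; exact hdD.trans hDN'
        _ = r ^ 2 * Δ / δ := by rw [ha]; field_simp
    · have : η * δ / (r ^ 2 * Δ) * (r ^ 2 * Δ / δ) = η := by field_simp
      rw [this]; exact hη1
    · have : η * δ / (r ^ 2 * Δ) * (r ^ 2 * Δ / δ) = η := by field_simp
      rw [this]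
      exact le_trans (by gcongr) hηE
    · rw [hq'eq]; exact lt_of_lt_of_le hδ hq'δ
    · rw [← hU]; positivity
    · rw [hq'eq]
      calc ε * δ / r / ((N - r * (j + 1)) / N) * r ≤ ε * δ / r / δ * r := by gcongr
        _ = ε := by field_simp
    · rw [hρa]
      have : 12 * r ^ 2 * E / w = E * (12 * (r ^ 2 / w)) := by ring
      rw [this]
      have : E * (12 * (r ^ 2 / w)) ≤ E * (12 * a) := by gcongr
      linarith
    · rw [hq'eq]
      have : 10 * ε * m * r / w / ((N - r * (j + 1)) / N) ≤ 10 * ε * m * r / (δ * N) / δ := by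
        gcongr
      have h2 : 10 * ε * m * r / (δ * N) / δ = 10 * ε * m * r / (δ ^ 2 * N) := by
        field_simp
      linarith

set_option maxHeartbeats 1600000 in
/-- Nearly perfect matchings in nearly disjoint regular hypergraphs, leaving only a small part
of every test set uncovered. -/
theorem exists_matching_of_regular (r : ℕ) (hr1 : 1 ≤ r) (δ : ℝ) (hδ : 0 < δ) (hδ1 : δ ≤ 1) :
    ∃ γ : ℝ, 0 < γ ∧ ∀ (α ι τ : Type) [DecidableEq α] (I : Finset ι) (e : ι → Finset α)
      (V : Finset α) (𝒯 : Finset τ) (Y : τ → Finset α) (D Δ : ℕ) (m : ℝ),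
      (∀ i ∈ I, #(e i) = r) → (∀ i ∈ I, e i ⊆ V) → (∀ v ∈ V, #{i ∈ I | v ∈ e i} = D) →
      (∀ u v, u ≠ v → #{i ∈ I | u ∈ e i ∧ v ∈ e i} ≤ Δ) →
      0 ≤ m → (∀ T ∈ 𝒯, (#(Y T) : ℝ) ≤ m) → (∀ T ∈ 𝒯, Y T ⊆ V) →
      0 < D → 0 < Δ → (Δ : ℝ) ≤ γ * D → D ≤ #V * Δ → 1 ≤ γ * #V →
      2 * #V * Real.exp (-(γ * (D / Δ))) + #𝒯 * Real.exp (-(γ * m)) ≤ 1 →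
      ∃ M ⊆ I, (∀ i ∈ M, ∀ i' ∈ M, i ≠ i' → Disjoint (e i) (e i')) ∧
        ∀ T ∈ 𝒯, (#{u ∈ Y T | ∀ i ∈ M, u ∉ e i} : ℝ) ≤ 4 * δ * m := by
  have hrr : (1 : ℝ) ≤ r := by exact_mod_cast hr1
  obtain ⟨ε, hε⟩ : ∃ ε : ℝ, ε = δ ^ 2 / 20 := ⟨_, rfl⟩
  obtain ⟨η, hη⟩ : ∃ η : ℝ, η = ε * Real.exp (-(14 * r ^ 2 / δ)) := ⟨_, rfl⟩
  have hε0 : 0 < ε := by rw [hε]; positivity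
  have hη0 : 0 < η := by rw [hη]; positivity
  refine ⟨min (min (η / r ^ 2) (η ^ 2 * δ / r ^ 2)) (min (ε * δ / (2 * r)) (δ / (2 * r ^ 2))),
    by positivity, ?_⟩
  set γ := min (min (η / r ^ 2) (η ^ 2 * δ / r ^ 2)) (min (ε * δ / (2 * r)) (δ / (2 * r ^ 2)))
  have hγ1 : γ ≤ η / r ^ 2 := (min_le_left _ _).trans (min_le_left _ _)
  have hγ2 : γ ≤ η ^ 2 * δ / r ^ 2 := (min_le_left _ _).trans (min_le_right _ _)
  have hγ3 : γ ≤ ε * δ / (2 * r) := (min_le_right _ _).trans (min_le_left _ _)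
  have hγ4 : γ ≤ δ / (2 * r ^ 2) := (min_le_right _ _).trans (min_le_right _ _)
  intro α ι τ _ I e V 𝒯 Y D Δ m hr hV hD hΔ hm hY hYV hD0 hΔ0 hΔD hDN hN hpot
  have hD0' : (0 : ℝ) < D := by exact_mod_cast hD0
  have hΔ0' : (0 : ℝ) < Δ := by exact_mod_cast hΔ0
  have hr2 : (0 : ℝ) < r ^ 2 := by positivity
  have hNr : 2 * (r : ℝ) ^ 2 ≤ δ * #V := by
    have h1 : 1 ≤ δ / (2 * r ^ 2) * #V := hN.trans (by gcongr)
    rw [div_mul_eq_mul_div, one_le_div (by positivity)] at h1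
    exact h1
  have hN0 : (0 : ℝ) < #V := by
    by_contra h
    have : δ * #V ≤ 0 := mul_nonpos_of_nonneg_of_nonpos hδ.le (not_lt.1 h)
    nlinarith
  have hj0 : 0 ≤ (1 - δ) * #V / r :=
    div_nonneg (mul_nonneg (by linarith) hN0.le) (by linarith)
  obtain ⟨j, hjdef⟩ : ∃ j, j = ⌊(1 - δ) * #V / r⌋₊ := ⟨_, rfl⟩
  have hj1 : (j : ℝ) * r ≤ (1 - δ) * #V := by
    rw [← le_div_iff₀ (by linarith), hjdef]; exact Nat.floor_le hj0
  have hj2 : (1 - δ) * #V < (j + 1) * r := by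
    rw [← div_lt_iff₀ (by linarith), hjdef]; exact Nat.lt_floor_add_one _
  have hε4 : ε ≤ 1 / 4 := by rw [hε]; nlinarith
  obtain ⟨U, M, d, hU, hMI, hM, -, hcov, -, -, hp⟩ := exists_partial_matching (Y := Y) (𝒯 := 𝒯)
    (j := j) (m := m) hr1 hr hV hD hΔ hm hY hδ hδ1 hε0 hε4 hη hD0 hΔ0
    (by
      have : (Δ : ℝ) ≤ η / r ^ 2 * D := hΔD.trans (by gcongr)
      rw [div_mul_eq_mul_div, le_div_iff₀ hr2] at this
      linarith) hDN hNr
    (by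
      refine le_trans ?_ hpot
      gcongr ?_ + ?_
      · gcongr 2 * _ * Real.exp (-?_)
        calc γ * (D / Δ) ≤ η ^ 2 * δ / r ^ 2 * (D / Δ) := by gcongr
          _ = _ := by field_simp
      · gcongr _ * Real.exp (-?_)
        calc γ * m ≤ ε * δ / (2 * r) * m := by gcongr
          _ = _ := by field_simp)
    (by linarith)
  refine ⟨M, hMI, hM, fun T hT => ?_⟩
  have hq0 : 0 < ((#V : ℝ) - r * j) / #V := div_pos (by nlinarith) hN0
  have hq : ((#V : ℝ) - r * j) / #V ≤ 2 * δ := by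
    rw [div_le_iff₀ hN0]; nlinarith
  have hc : 3 * m / 2 + j * (10 * ε * m * r / (δ ^ 2 * #V)) ≤ 2 * m := by
    have h1 : j * (10 * ε * m * r / (δ ^ 2 * #V)) = (m / 2) * ((j * r) / #V) := by
      rw [hε]; field_simp; ring
    have h2 : (j * r : ℝ) / #V ≤ 1 := by rw [div_le_one hN0]; nlinarith
    rw [h1]
    nlinarith
  have h1 := card_inter_le_of_potential_le_one (by positivity) hq0 hp hT
  have h2 : #{u ∈ Y T | ∀ i ∈ M, u ∉ e i} ≤ #(Y T ∩ U) := by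
    refine card_le_card fun u hu => ?_
    obtain ⟨huY, hu⟩ := mem_filter.1 hu
    refine mem_inter.2 ⟨huY, ?_⟩
    by_contra h
    obtain ⟨i, hi, hui⟩ := hcov u (hYV T hT huY) h
    exact hu i hi hui
  calc (#{u ∈ Y T | ∀ i ∈ M, u ∉ e i} : ℝ) ≤ #(Y T ∩ U) := by exact_mod_cast h2
    _ ≤ _ := h1
    _ ≤ 2 * δ * (2 * m) := by
      refine mul_le_mul hq hc (by positivity) (by positivity)
    _ = 4 * δ * m := by ring

end Hypergraph

variable {α : Type*} [Fintype α] [DecidableEq α]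

theorem card_superset_powersetCard (k : ℕ) {B : Finset α} (hB : #B ≤ k) :
    #{S ∈ powersetCard k univ | B ⊆ S} = (Fintype.card α - #B).choose (k - #B) := by
  rw [← card_compl, ← card_powersetCard]
  refine card_nbij' (· \ B) (· ∪ B) ?_ ?_ ?_ ?_
  · intro S hS
    simp only [coe_filter, mem_powersetCard_univ, Set.mem_ofPred_eq] at hS
    rw [mem_coe, mem_powersetCard, card_sdiff_of_subset hS.2, hS.1]
    exact ⟨fun x hx => mem_compl.2 (mem_sdiff.1 hx).2, rfl⟩
  · intro S hS
    rw [mem_coe, mem_powersetCard] at hS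
    simp only [coe_filter, mem_powersetCard_univ, Set.mem_ofPred_eq]
    refine ⟨?_, subset_union_right⟩
    rw [card_union_of_disjoint (disjoint_of_subset_left hS.1 disjoint_compl_left), hS.2]
    omega
  · intro S hS
    simp only [coe_filter, Set.mem_ofPred_eq] at hS
    exact sdiff_union_of_subset hS.2
  · intro S hS
    rw [mem_coe, mem_powersetCard] at hS
    exact union_sdiff_cancel_right (disjoint_of_subset_left hS.1 disjoint_compl_left)

theorem card_superset_powersetCard_le (k : ℕ) {B : Finset α} (hB : #B ≤ k) :
    #{S ∈ powersetCard k univ | B ⊆ S} ≤ Fintype.card α ^ (k - #B) := by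
  rw [card_superset_powersetCard k hB]
  exact (Nat.choose_le_pow _ _).trans (Nat.pow_le_pow_left (Nat.sub_le _ _) _)

/-- The number of `t`-sets containing `T` that lie in a member of `Q`. -/
def coveredDeg (t : ℕ) (Q : Finset (Finset α)) (T : Finset α) : ℕ :=
  #{A ∈ powersetCard t univ | T ⊆ A ∧ ∃ S ∈ Q, A ⊆ S}

theorem coveredDeg_insert_le (t : ℕ) (Q : Finset (Finset α)) (S T : Finset α) :
    coveredDeg t (insert S Q) T ≤ coveredDeg t Q T + if T ⊆ S then 2 ^ #S else 0 := by
  have hsub : ({A ∈ powersetCard t univ | T ⊆ A ∧ ∃ S' ∈ insert S Q, A ⊆ S'} : Finset (Finset α)) ⊆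
      {A ∈ powersetCard t (univ : Finset α) | T ⊆ A ∧ ∃ S ∈ Q, A ⊆ S} ∪
        {A ∈ S.powerset | T ⊆ A} := by
    intro A
    simp only [mem_filter, mem_union, mem_insert, mem_powerset]
    rintro ⟨hA, hT, S', rfl | hS', h⟩
    · exact Or.inr ⟨h, hT⟩
    · exact Or.inl ⟨hA, hT, S', hS', h⟩
  refine (card_le_card hsub).trans ((card_union_le _ _).trans (Nat.add_le_add_left ?_ _))
  split_ifs with h
  · exact (card_filter_le _ _).trans_eq (card_powerset S)
  · rw [Nat.le_zero, card_eq_zero, filter_eq_empty_iff]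
    exact fun A hA hT => h (hT.trans (mem_powerset.1 hA))

theorem card_conflicting_le {k t : ℕ} (htk : t < k) (ht : 1 ≤ t) {Q : Finset (Finset α)} {z : ℝ}
    (hz : ∀ T : Finset α, #T = t - 1 → (coveredDeg t Q T : ℝ) ≤ z) {A : Finset α} (hA : #A = t)
    (hAQ : ¬∃ S ∈ Q, A ⊆ S) :
    (#{S ∈ powersetCard k univ | A ⊆ S ∧ ∃ B ⊆ S, #B = t ∧ ∃ S' ∈ Q, B ⊆ S'} : ℝ) ≤
      (Fintype.card α : ℝ) ^ (k - t - 1) * (2 ^ k * z) := by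
  set F : Finset α → Finset α → Finset (Finset α) := fun W T =>
    ({B ∈ powersetCard t univ | T ⊆ B ∧ ∃ S ∈ Q, B ⊆ S} : Finset (Finset α)).image (W ∪ ·)
  have hz0 : 0 ≤ z := by
    obtain ⟨T, -, hT⟩ := exists_subset_card_eq (s := A) (n := t - 1) (by omega)
    exact le_trans (Nat.cast_nonneg _) (hz T hT)
  have hsub : ({S ∈ powersetCard k univ | A ⊆ S ∧ ∃ B ⊆ S, #B = t ∧ ∃ S' ∈ Q, B ⊆ S'} :
      Finset (Finset α)) ⊆ (powersetCard (k - t - 1) univ).biUnion fun R =>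
        (powersetCard (t - 1) (A ∪ R)).biUnion fun T => F (A ∪ R) T := by
    intro S hS
    obtain ⟨hS, hAS, B, hBS, hB, S', hS', hBS'⟩ := mem_filter.1 hS
    rw [mem_powersetCard_univ] at hS
    have hBA : ¬B ⊆ A := fun h => hAQ ⟨S', hS', eq_of_subset_of_card_le h (by omega) ▸ hBS'⟩
    obtain ⟨x, hxB, hxA⟩ := not_subset.1 hBA
    simp only [mem_biUnion, mem_powersetCard, F, mem_image, mem_filter]
    refine ⟨(S \ A).erase x, ⟨subset_univ _, ?_⟩, B.erase x, ⟨?_, ?_⟩, B,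
      ⟨⟨subset_univ _, hB⟩, erase_subset _ _, S', hS', hBS'⟩, ?_⟩
    · rw [card_erase_of_mem (mem_sdiff.2 ⟨hBS hxB, hxA⟩), card_sdiff_of_subset hAS, hS, hA]
    · intro y hy
      have := hBS (mem_of_mem_erase hy)
      have := ne_of_mem_erase hy
      by_cases hyA : y ∈ A <;> simp_all
    · rw [card_erase_of_mem hxB, hB]
    · ext y
      have h1 := @hAS y
      have h2 := @hBS y
      simp only [mem_union, mem_erase, mem_sdiff]
      by_cases hyx : y = x
      · subst hyx; tauto
      · tauto
  have hF : ∀ W T, #T = t - 1 → (#(F W T) : ℝ) ≤ z := fun W T hT =>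
    le_trans (by exact_mod_cast card_image_le) (hz T hT)
  calc _ ≤ (#((powersetCard (k - t - 1) univ).biUnion fun R =>
        (powersetCard (t - 1) (A ∪ R)).biUnion fun T => F (A ∪ R) T) : ℝ) := by
        exact_mod_cast card_le_card hsub
    _ ≤ ∑ R ∈ powersetCard (k - t - 1) univ, ∑ T ∈ powersetCard (t - 1) (A ∪ R),
        (#(F (A ∪ R) T) : ℝ) := by
        exact_mod_cast card_biUnion_le.trans (sum_le_sum fun R _ => card_biUnion_le)
    _ ≤ ∑ R ∈ powersetCard (k - t - 1) (univ : Finset α), 2 ^ k * z := by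
        refine sum_le_sum fun R hR => ?_
        rw [mem_powersetCard_univ] at hR
        refine (sum_le_sum fun T hT => hF _ T (mem_powersetCard.1 hT).2).trans ?_
        rw [sum_const, nsmul_eq_mul]
        refine mul_le_mul_of_nonneg_right ?_ hz0
        have h1 : #(powersetCard (t - 1) (A ∪ R)) ≤ 2 ^ k := by
          rw [card_powersetCard]
          refine (Nat.choose_le_two_pow _ _).trans (Nat.pow_le_pow_right two_pos ?_)
          have := card_union_le A R
          omega
        exact_mod_cast h1
    _ ≤ _ := by
        rw [sum_const, nsmul_eq_mul]
        refine mul_le_mul_of_nonneg_right ?_ (by positivity)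
        rw [card_powersetCard, card_univ]
        exact_mod_cast Nat.choose_le_pow _ _

theorem sum_inv_card_pow_le {s : ℕ} {T : Finset α} (hT : #T = s) :
    ∑ B ∈ powersetCard s (univ : Finset α), ((Fintype.card α : ℝ)⁻¹) ^ #(T \ B) ≤ 2 ^ s := by
  rw [← sum_fiberwise_of_maps_to (t := T.powerset) (g := fun B => T ∩ B)
    fun B _ => mem_powerset.2 inter_subset_left]
  refine (sum_le_card_nsmul _ _ 1 fun C hC => ?_).trans_eq ?_
  · rw [mem_powerset] at hC
    have hCs : #C ≤ s := hT ▸ card_le_card hC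
    have h1 : ∀ B ∈ ({B ∈ powersetCard s (univ : Finset α) | T ∩ B = C} : Finset (Finset α)),
        ((Fintype.card α : ℝ)⁻¹) ^ #(T \ B) = ((Fintype.card α : ℝ)⁻¹) ^ (s - #C) := by
      intro B hB
      have h2 := card_sdiff_add_card_inter T B
      rw [(mem_filter.1 hB).2, hT] at h2
      rw [← h2, Nat.add_sub_cancel]
    rw [sum_congr rfl h1, sum_const, nsmul_eq_mul, inv_pow]
    refine mul_inv_le_one_of_le₀ ?_ (by positivity)
    have h3 : #{B ∈ powersetCard s (univ : Finset α) | T ∩ B = C} ≤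
        #{B ∈ powersetCard s (univ : Finset α) | C ⊆ B} :=
      card_le_card fun B hB => by
        rw [mem_filter] at hB ⊢
        exact ⟨hB.1, hB.2 ▸ inter_subset_right⟩
    exact_mod_cast h3.trans (card_superset_powersetCard_le s hCs)
  · rw [card_powerset, hT, nsmul_eq_mul, mul_one]; norm_cast

theorem sum_inv_card_pow_le_of_deg_le {t : ℕ} (ht : 1 ≤ t) {L : Finset (Finset α)}
    (hL : ∀ A ∈ L, #A = t) {m : ℝ} (hm : 0 ≤ m)
    (hdeg : ∀ T : Finset α, #T = t - 1 → (#{A ∈ L | T ⊆ A} : ℝ) ≤ m) {T : Finset α}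
    (hT : #T = t - 1) :
    ∑ A ∈ L, ((Fintype.card α : ℝ)⁻¹) ^ #(T \ A) ≤ 2 ^ (t - 1) * m := by
  set x : ℝ := (Fintype.card α : ℝ)⁻¹
  have hx : 0 ≤ x := by positivity
  calc ∑ A ∈ L, x ^ #(T \ A)
      ≤ ∑ A ∈ L, ∑ B ∈ powersetCard (t - 1) univ with B ⊆ A, x ^ #(T \ B) := by
        refine sum_le_sum fun A hA => ?_
        have hAT : ¬A ⊆ T := fun h => by
          have := card_le_card h
          rw [hL A hA] at this
          omega
        obtain ⟨y, hyA, hyT⟩ := not_subset.1 hAT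
        have h1 : T \ A = T \ A.erase y := by
          ext u
          simp only [mem_sdiff, mem_erase]
          by_cases hu : u = y
          · subst hu; tauto
          · tauto
        rw [h1]
        refine single_le_sum (f := fun B => x ^ #(T \ B)) (fun B _ => by positivity) ?_
        rw [mem_filter, mem_powersetCard_univ, card_erase_of_mem hyA, hL A hA]
        exact ⟨rfl, erase_subset _ _⟩
    _ = ∑ B ∈ powersetCard (t - 1) univ, ∑ A ∈ L with B ⊆ A, x ^ #(T \ B) :=
        sum_comm' fun A B => by simp only [mem_filter]; tauto
    _ ≤ ∑ B ∈ powersetCard (t - 1) univ, m * x ^ #(T \ B) := by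
        refine sum_le_sum fun B hB => ?_
        rw [sum_const, nsmul_eq_mul]
        exact mul_le_mul_of_nonneg_right (hdeg B (mem_powersetCard_univ.1 hB)) (by positivity)
    _ ≤ _ := by
        rw [← mul_sum, mul_comm]
        exact mul_le_mul_of_nonneg_right (sum_inv_card_pow_le hT) hm

/-- The exponential weight of a partial completion `Q` when the sets in `R` are still to be
covered. -/
noncomputable def completionPotential (t : ℕ) (θ : ℝ) (Q R : Finset (Finset α)) : ℝ :=
  ∑ T ∈ powersetCard (t - 1) univ,
    Real.exp (coveredDeg t Q T + θ * ∑ A ∈ R, ((Fintype.card α : ℝ)⁻¹) ^ #(T \ A))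

theorem exists_insert_completionPotential_le {k t : ℕ} {θ : ℝ}
    {Q R G : Finset (Finset α)} {A : Finset α} (hA : #A = t) (hAR : A ∉ R)
    (hG : ∀ S ∈ G, #S = k ∧ A ⊆ S) (hα : 0 < Fintype.card α) (hGne : G.Nonempty)
    (hθ : Real.exp (2 ^ k) * (Fintype.card α : ℝ) ^ (k - t) ≤ θ * #G) :
    ∃ S ∈ G, completionPotential t θ (insert S Q) R ≤ completionPotential t θ Q (insert A R) := by
  refine exists_le_of_sum_le hGne ?_
  simp only [completionPotential]
  rw [sum_comm, sum_const, nsmul_eq_mul, mul_sum]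
  refine sum_le_sum fun T _ => ?_
  set x : ℝ := (Fintype.card α : ℝ)⁻¹ with hx_def
  have hx : 0 ≤ x := by positivity
  set w : ℝ := Real.exp (coveredDeg t Q T + θ * ∑ A ∈ R, x ^ #(T \ A)) with hw
  have hcount : (#{S ∈ G | T ⊆ S} : ℝ) ≤ (Fintype.card α : ℝ) ^ (k - t) * x ^ #(T \ A) := by
    have hU : #(A ∪ T) = t + #(T \ A) := by
      rw [← union_sdiff_self_eq_union, card_union_of_disjoint disjoint_sdiff, hA]
    have hsub : {S ∈ G | T ⊆ S} ⊆
        {S ∈ powersetCard k (univ : Finset α) | A ∪ T ⊆ S} := fun S hS => by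
      obtain ⟨hS, hTS⟩ := mem_filter.1 hS
      exact mem_filter.2 ⟨mem_powersetCard_univ.2 (hG S hS).1, union_subset (hG S hS).2 hTS⟩
    by_cases hk : #(A ∪ T) ≤ k
    · have h1 := (card_le_card hsub).trans (card_superset_powersetCard_le k hk)
      have h2 : (Fintype.card α : ℝ) ^ (k - t) * x ^ #(T \ A) =
          (Fintype.card α : ℝ) ^ (k - #(A ∪ T)) := by
        have h3 : k - t = (k - #(A ∪ T)) + #(T \ A) := by omega
        have h4 : (Fintype.card α : ℝ) * x = 1 := mul_inv_cancel₀ (by positivity)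
        rw [h3, pow_add, mul_assoc, ← mul_pow, h4, one_pow, mul_one]
      rw [h2]
      exact_mod_cast h1
    · have : {S ∈ G | T ⊆ S} = ∅ := by
        refine filter_eq_empty_iff.2 fun S hS hTS => hk ?_
        rw [← (hG S hS).1]
        exact card_le_card (union_subset (hG S hS).2 hTS)
      rw [this, card_empty, Nat.cast_zero]
      positivity
  calc ∑ S ∈ G, Real.exp (coveredDeg t (insert S Q) T + θ * ∑ A ∈ R, x ^ #(T \ A))
      ≤ ∑ S ∈ G, (w + if T ⊆ S then w * Real.exp (2 ^ k) else 0) := by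
        refine sum_le_sum fun S hS => ?_
        have h1 := coveredDeg_insert_le t Q S T
        rw [(hG S hS).1] at h1
        split_ifs at h1 ⊢ with h
        · have h2 : (coveredDeg t (insert S Q) T : ℝ) ≤ coveredDeg t Q T + 2 ^ k := by
            exact_mod_cast h1
          calc _ ≤ w * Real.exp (2 ^ k) := by
                rw [hw, ← Real.exp_add]; exact Real.exp_le_exp.2 (by linarith)
            _ ≤ _ := le_add_of_nonneg_left (Real.exp_pos _).le
        · rw [add_zero] at h1 ⊢
          rw [hw]; gcongr
    _ = w * (#G + Real.exp (2 ^ k) * #{S ∈ G | T ⊆ S}) := by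
        rw [sum_add_distrib, sum_const, nsmul_eq_mul, ← sum_filter, sum_const, nsmul_eq_mul]; ring
    _ ≤ w * (#G + Real.exp (2 ^ k) * ((Fintype.card α : ℝ) ^ (k - t) * x ^ #(T \ A))) := by
        gcongr
    _ ≤ w * (#G * (θ * x ^ #(T \ A) + 1)) := by
        refine mul_le_mul_of_nonneg_left ?_ (Real.exp_pos _).le
        have := mul_le_mul_of_nonneg_right hθ (pow_nonneg hx #(T \ A))
        linarith
    _ ≤ w * (#G * Real.exp (θ * x ^ #(T \ A))) := by
        gcongr; exact Real.add_one_le_exp _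
    _ = #G * Real.exp (coveredDeg t Q T + θ * ∑ A ∈ insert A R, x ^ #(T \ A)) := by
        rw [sum_insert hAR, mul_left_comm, hw, ← Real.exp_add]; ring_nf

theorem exists_packing_covering {k t : ℕ} (htk : t < k) (ht : 1 ≤ t) {θ z c : ℝ} (hθ : 0 ≤ θ)
    (hα : 0 < Fintype.card α) (hc : 0 < c)
    (hcount : c * (Fintype.card α : ℝ) ^ (k - t) ≤
      ((Fintype.card α - t).choose (k - t) : ℕ))
    (hz : (Fintype.card α : ℝ) ^ (k - t - 1) * (2 ^ k * z) ≤
      c / 2 * (Fintype.card α : ℝ) ^ (k - t))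
    (hθc : Real.exp (2 ^ k) ≤ θ * (c / 2)) (R : Finset (Finset α)) :
    ∀ Q : Finset (Finset α), (∀ A ∈ R, #A = t) → (∀ S ∈ Q, #S = k) →
      (∀ A : Finset α, #A = t → #{S ∈ Q | A ⊆ S} ≤ 1) →
      completionPotential t θ Q R ≤ Real.exp z →
      ∃ Q' : Finset (Finset α), Q ⊆ Q' ∧ (∀ S ∈ Q', #S = k) ∧
        (∀ A : Finset α, #A = t → #{S ∈ Q' | A ⊆ S} ≤ 1) ∧ ∀ A ∈ R, ∃ S ∈ Q', A ⊆ S := by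
  induction R using Finset.induction_on with
  | empty => exact fun Q _ hQ hpack _ => ⟨Q, Subset.rfl, hQ, hpack, by simp⟩
  | insert A R hAR ih =>
    intro Q hR hQ hpack hp
    have hA : #A = t := hR A (mem_insert_self _ _)
    have hR' : ∀ B ∈ R, #B = t := fun B hB => hR B (mem_insert_of_mem hB)
    by_cases hcov : ∃ S ∈ Q, A ⊆ S
    · have hle : completionPotential t θ Q R ≤ completionPotential t θ Q (insert A R) := by
        unfold completionPotential
        gcongr
        exact subset_insert _ _
      obtain ⟨Q', hQQ', hQ', hpack', hcov'⟩ := ih Q hR' hQ hpack (hle.trans hp)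
      obtain ⟨S, hS, hAS⟩ := hcov
      exact ⟨Q', hQQ', hQ', hpack',
        forall_mem_insert _ _ _ |>.2 ⟨⟨S, hQQ' hS, hAS⟩, hcov'⟩⟩
    · have hdeg : ∀ T : Finset α, #T = t - 1 → (coveredDeg t Q T : ℝ) ≤ z := by
        intro T hT
        rw [← Real.exp_le_exp]
        refine le_trans ?_ hp
        refine le_trans ?_ (single_le_sum (fun _ _ => (Real.exp_pos _).le)
          (mem_powersetCard_univ.2 hT))
        refine Real.exp_le_exp.2 (le_add_of_nonneg_right ?_)
        positivity
      have hbad := (card_conflicting_le htk ht hdeg hA hcov).trans hz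
      set G : Finset (Finset α) := {S ∈ powersetCard k univ |
        A ⊆ S ∧ ¬∃ B ⊆ S, #B = t ∧ ∃ S' ∈ Q, B ⊆ S'} with hG_def
      have hsplit : (#G : ℝ) +
          #{S ∈ powersetCard k univ | A ⊆ S ∧ ∃ B ⊆ S, #B = t ∧ ∃ S' ∈ Q, B ⊆ S'} =
          ((Fintype.card α - t).choose (k - t) : ℕ) := by
        have h1 := card_superset_powersetCard k (B := A) (by omega)
        rw [hA] at h1
        rw [← h1, ← card_filter_add_card_filter_not (s := {S ∈ powersetCard k univ | A ⊆ S})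
          (fun S => ∃ B ⊆ S, #B = t ∧ ∃ S' ∈ Q, B ⊆ S'), filter_filter, filter_filter, add_comm]
        push_cast
        rfl
      have hGcard : c / 2 * (Fintype.card α : ℝ) ^ (k - t) ≤ #G := by linarith
      have hG0 : (0 : ℝ) < #G := lt_of_lt_of_le (by positivity) hGcard
      obtain ⟨S, hS, hle⟩ := exists_insert_completionPotential_le (k := k) (θ := θ) (Q := Q) hA hAR
        (G := G) (fun S hS => by
          obtain ⟨h1, h2, -⟩ := mem_filter.1 hS
          exact ⟨mem_powersetCard_univ.1 h1, h2⟩) hα (card_pos.1 (by exact_mod_cast hG0))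
        (by
          calc _ ≤ θ * (c / 2) * (Fintype.card α : ℝ) ^ (k - t) := by gcongr
            _ = θ * (c / 2 * (Fintype.card α : ℝ) ^ (k - t)) := mul_assoc _ _ _
            _ ≤ _ := by gcongr)
      obtain ⟨hSk, hAS, hSgood⟩ := mem_filter.1 hS
      obtain ⟨Q', hQQ', hQ', hpack', hcov'⟩ := ih (insert S Q) hR'
        (forall_mem_insert _ _ _ |>.2 ⟨mem_powersetCard_univ.1 hSk, hQ⟩) (fun B hB => by
          rw [filter_insert]
          split_ifs with hBS
          · have : {S ∈ Q | B ⊆ S} = ∅ := filter_eq_empty_iff.2 fun S' hS' hBS' =>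
              hSgood ⟨B, hBS, hB, S', hS', hBS'⟩
            rw [this]; simp
          · exact hpack B hB) (hle.trans hp)
      exact ⟨Q', (subset_insert _ _).trans hQQ', hQ', hpack',
        forall_mem_insert _ _ _ |>.2 ⟨⟨S, hQQ' (mem_insert_self _ _), hAS⟩, hcov'⟩⟩

theorem eventually_mul_pow_le_exp (a : ℝ) (p : ℕ) {b : ℝ} (hb : 0 < b) :
    ∀ᶠ n : ℕ in Filter.atTop, a * (n : ℝ) ^ p ≤ Real.exp (b * n) := by
  have h1 := ((isLittleO_pow_exp_pos_mul_atTop p hb).const_mul_left a).bound one_pos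
  filter_upwards [tendsto_natCast_atTop_atTop.eventually h1] with n hn
  rw [one_mul, Real.norm_eq_abs, Real.norm_eq_abs, Real.abs_exp] at hn
  exact (le_abs_self _).trans hn

theorem mul_pow_le_choose {k t n : ℕ} (htk : t ≤ k) (hn : 2 * k ≤ n) :
    1 / (2 ^ (k - t) * (k - t).factorial) * (n : ℝ) ^ (k - t) ≤ ((n - t).choose (k - t) : ℕ) := by
  refine le_trans ?_ (Nat.pow_le_choose (α := ℝ) (k - t) (n - t))
  rw [div_mul_eq_mul_div, one_mul, ← div_div, ← div_pow]
  gcongr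
  have : (n : ℝ) ≤ 2 * (n - t + 1 - (k - t) : ℕ) := by
    have : n ≤ 2 * (n - t + 1 - (k - t)) := by omega
    exact_mod_cast this
  linarith

theorem le_choose_of_lt {n t : ℕ} (ht : 1 ≤ t) (htn : t < n) : n ≤ n.choose t := by
  induction n generalizing t with
  | zero => omega
  | succ n ih =>
    obtain ⟨s, rfl⟩ := Nat.exists_eq_add_of_le' ht
    rcases Nat.lt_or_ge (s + 1) n with h | h
    · have h1 := ih ht h
      have h2 : 0 < n.choose s := Nat.choose_pos (by omega)
      rw [Nat.choose_succ_succ']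
      omega
    · obtain rfl : n = s + 1 := by omega
      rw [Nat.choose_succ_self_right]

theorem exists_packing_covering_of_sparse {k t : ℕ} (htk : t < k) (ht : 1 ≤ t) :
    ∃ δ : ℝ, 0 < δ ∧ ∀ᶠ n : ℕ in Filter.atTop, ∀ L : Finset (Finset (Fin n)),
      (∀ A ∈ L, #A = t) →
      (∀ T : Finset (Fin n), #T = t - 1 → (#{A ∈ L | T ⊆ A} : ℝ) ≤ δ * n) →
      ∃ Q : Finset (Finset (Fin n)), (∀ S ∈ Q, #S = k) ∧
        (∀ A : Finset (Fin n), #A = t → #{S ∈ Q | A ⊆ S} ≤ 1) ∧ ∀ A ∈ L, ∃ S ∈ Q, A ⊆ S := by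
  set c : ℝ := 1 / (2 ^ (k - t) * (k - t).factorial) with hc_def
  have hc : 0 < c := by positivity
  set ε : ℝ := c / 2 / 2 ^ k with hε_def
  have hε : 0 < ε := by positivity
  set θ : ℝ := Real.exp (2 ^ k) / (c / 2) with hθ_def
  have hθ : 0 < θ := by positivity
  refine ⟨ε / 2 / (θ * 2 ^ (t - 1)), by positivity, ?_⟩
  filter_upwards [eventually_mul_pow_le_exp 1 (t - 1) (half_pos hε),
    Filter.eventually_ge_atTop (2 * k)] with n hn hnk L hL hdeg
  have hn0 : 0 < n := by omega
  have hcomp : completionPotential t θ ∅ L ≤ Real.exp (ε * n) := by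
    have hterm : ∀ T ∈ powersetCard (t - 1) (univ : Finset (Fin n)),
        Real.exp (coveredDeg t ∅ T + θ * ∑ A ∈ L, ((Fintype.card (Fin n) : ℝ)⁻¹) ^ #(T \ A)) ≤
          Real.exp (ε / 2 * n) := by
      intro T hT
      refine Real.exp_le_exp.2 ?_
      have h1 := sum_inv_card_pow_le_of_deg_le ht hL (by positivity) hdeg
        (mem_powersetCard_univ.1 hT)
      have h2 : coveredDeg t ∅ T = 0 := by simp [coveredDeg]
      rw [h2, Nat.cast_zero, zero_add]
      refine (mul_le_mul_of_nonneg_left h1 hθ.le).trans_eq ?_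
      field_simp
    refine (sum_le_card_nsmul _ _ _ hterm).trans ?_
    have h3 : ((n.choose (t - 1) : ℕ) : ℝ) ≤ Real.exp (ε / 2 * n) := by
      rw [one_mul] at hn
      exact le_trans (by exact_mod_cast Nat.choose_le_pow _ _) hn
    rw [nsmul_eq_mul, card_powersetCard, card_univ, Fintype.card_fin]
    calc _ ≤ Real.exp (ε / 2 * n) * Real.exp (ε / 2 * n) := by gcongr
      _ = _ := by rw [← Real.exp_add]; ring_nf
  obtain ⟨Q, -, hQ, hpack, hcov⟩ := exists_packing_covering (α := Fin n) htk ht (θ := θ)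
    (z := ε * n) (c := c) hθ.le (by rwa [Fintype.card_fin]) hc
    (by rw [Fintype.card_fin]; exact mul_pow_le_choose htk.le hnk)
    (by
      rw [Fintype.card_fin]
      have h1 : k - t = (k - t - 1) + 1 := by omega
      rw [h1, Nat.add_sub_cancel, pow_succ, hε_def]
      refine le_of_eq ?_
      field_simp)
    (by rw [hθ_def]; exact (div_mul_cancel₀ _ (by positivity)).ge) L ∅ hL (by simp) (by simp) hcomp
  exact ⟨Q, hQ, hpack, hcov⟩

theorem exists_packing_sparse_leave {k t : ℕ} (htk : t < k) (ht : 1 ≤ t) {δ : ℝ} (hδ : 0 < δ) :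
    ∀ᶠ n : ℕ in Filter.atTop, ∃ P : Finset (Finset (Fin n)), (∀ S ∈ P, #S = k) ∧
      (∀ A : Finset (Fin n), #A = t → #{S ∈ P | A ⊆ S} ≤ 1) ∧
      ∀ T : Finset (Fin n), #T = t - 1 →
        (#{A ∈ powersetCard t (univ : Finset (Fin n)) | T ⊆ A ∧ ∀ S ∈ P, ¬A ⊆ S} : ℝ) ≤ δ * n := by
  obtain ⟨γ, hγ, key⟩ := exists_matching_of_regular (k.choose t) (Nat.choose_pos htk.le)
    (min (δ / 4) 1) (by positivity) (min_le_right _ _)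
  set c : ℝ := 1 / (2 ^ (k - t) * (k - t).factorial) with hc_def
  have hc : 0 < c := by positivity
  filter_upwards [eventually_mul_pow_le_exp 4 t (mul_pos hγ hc), eventually_mul_pow_le_exp 2 t hγ,
    eventually_mul_pow_le_exp 2 (t - 1) hγ, Filter.eventually_ge_atTop (2 * k),
    tendsto_natCast_atTop_atTop.eventually_ge_atTop (1 / (γ * c)),
    tendsto_natCast_atTop_atTop.eventually_ge_atTop (1 / γ)] with n hn₁ hn₂ hn₃ hnk hn₄ hn₅
  have hn0 : 0 < n := by omega
  have hnR : (0 : ℝ) < n := by exact_mod_cast hn0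
  have hkt : k - t = (k - t - 1) + 1 := by omega
  have hD := mul_pow_le_choose htk.le hnk
  rw [← hc_def] at hD
  have hD' : c * n * ((n ^ (k - t - 1) : ℕ) : ℝ) ≤ ((n - t).choose (k - t) : ℕ) := by
    refine le_trans (le_of_eq ?_) hD
    have h1 : (n : ℝ) ^ (k - t) = n ^ (k - t - 1) * n := by rw [← pow_succ, ← hkt]
    rw [h1]; push_cast; ring
  have hV : n ≤ #(powersetCard t (univ : Finset (Fin n))) := by
    rw [card_powersetCard, card_univ, Fintype.card_fin]
    exact le_choose_of_lt ht (by omega)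
  have hVle : #(powersetCard t (univ : Finset (Fin n))) ≤ n ^ t := by
    rw [card_powersetCard, card_univ, Fintype.card_fin]
    exact Nat.choose_le_pow _ _
  obtain ⟨P, hPI, hdisj, hleave⟩ := key (Finset (Fin n)) (Finset (Fin n)) (Finset (Fin n))
    (powersetCard k univ) (powersetCard t) (powersetCard t univ) (powersetCard (t - 1) univ)
    (fun T => {A ∈ powersetCard t univ | T ⊆ A}) ((n - t).choose (k - t)) (n ^ (k - t - 1)) n
    (fun S hS => by rw [card_powersetCard, mem_powersetCard_univ.1 hS])
    (fun S _ => powersetCard_mono (subset_univ _))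
    (fun A hA => by
      rw [mem_powersetCard_univ] at hA
      have h1 := card_superset_powersetCard k (B := A) (by omega)
      rw [Fintype.card_fin, hA] at h1
      rw [← h1]
      simp only [mem_powersetCard, hA, and_true])
    (fun A B hAB => by
      by_cases h : #A = t ∧ #B = t ∧ #(A ∪ B) ≤ k
      · obtain ⟨hA, hB, hABk⟩ := h
        have h1 : t + 1 ≤ #(A ∪ B) := by
          by_contra h2
          have h3 : A = A ∪ B := eq_of_subset_of_card_le subset_union_left (by omega)
          have h4 : B = A ∪ B := eq_of_subset_of_card_le subset_union_right (by omega)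
          exact hAB (h3.trans h4.symm)
        calc _ ≤ #{S ∈ powersetCard k (univ : Finset (Fin n)) | A ∪ B ⊆ S} := by
              refine card_le_card fun S hS => ?_
              simp only [mem_filter, mem_powersetCard] at hS ⊢
              exact ⟨hS.1, union_subset hS.2.1.1 hS.2.2.1⟩
          _ ≤ n ^ (k - #(A ∪ B)) := by
              simpa using card_superset_powersetCard_le k hABk
          _ ≤ _ := Nat.pow_le_pow_right hn0 (by omega)
      · refine (Nat.le_zero.2 ?_).trans (Nat.zero_le _)
        rw [card_eq_zero, filter_eq_empty_iff]
        intro S hS hS'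
        simp only [mem_powersetCard] at hS hS'
        exact h ⟨hS'.1.2, hS'.2.2, hS.2 ▸ card_le_card (union_subset hS'.1.1 hS'.2.1)⟩)
    hnR.le
    (fun T hT => by
      rw [mem_powersetCard_univ] at hT
      have h1 := card_superset_powersetCard_le t (B := T) (by omega)
      rw [Fintype.card_fin, hT, Nat.sub_sub_self ht, pow_one] at h1
      exact_mod_cast h1)
    (fun T _ => filter_subset _ _)
    (Nat.choose_pos (by omega)) (by positivity)
    (by
      rw [div_le_iff₀ (by positivity)] at hn₄
      have h1 : (0 : ℝ) ≤ ((n ^ (k - t - 1) : ℕ) : ℝ) := Nat.cast_nonneg _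
      calc ((n ^ (k - t - 1) : ℕ) : ℝ) ≤ n * (γ * c) * ((n ^ (k - t - 1) : ℕ) : ℝ) :=
            le_mul_of_one_le_left h1 hn₄
        _ = γ * (c * n * ((n ^ (k - t - 1) : ℕ) : ℝ)) := by ring
        _ ≤ _ := by gcongr)
    (by
      calc (n - t).choose (k - t) ≤ n ^ (k - t) :=
            (Nat.choose_le_pow _ _).trans (Nat.pow_le_pow_left (Nat.sub_le _ _) _)
        _ = n * n ^ (k - t - 1) := by rw [← pow_succ', ← hkt]
        _ ≤ _ := Nat.mul_le_mul_right _ hV)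
    (by
      rw [div_le_iff₀ hγ, mul_comm] at hn₅
      refine hn₅.trans ?_
      gcongr)
    (by
      have h1 : 2 * (#(powersetCard t (univ : Finset (Fin n))) : ℝ) *
          Real.exp (-(γ * (((n - t).choose (k - t) : ℕ) / ((n ^ (k - t - 1) : ℕ) : ℝ)))) ≤
            1 / 2 := by
        have h2 : c * n ≤ ((n - t).choose (k - t) : ℕ) / ((n ^ (k - t - 1) : ℕ) : ℝ) := by
          rwa [le_div_iff₀ (by positivity)]
        calc _ ≤ 2 * (n : ℝ) ^ t * Real.exp (-(γ * (c * n))) := by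
              gcongr
              exact_mod_cast hVle
          _ ≤ 1 / 2 := by
              rw [Real.exp_neg, ← div_eq_mul_inv, div_le_iff₀ (Real.exp_pos _), ← mul_assoc γ]
              linarith
      have h3 : (#(powersetCard (t - 1) (univ : Finset (Fin n))) : ℝ) *
          Real.exp (-(γ * n)) ≤ 1 / 2 := by
        have h4 : (#(powersetCard (t - 1) (univ : Finset (Fin n))) : ℝ) ≤ (n : ℝ) ^ (t - 1) := by
          rw [card_powersetCard, card_univ, Fintype.card_fin]
          exact_mod_cast Nat.choose_le_pow _ _
        rw [Real.exp_neg, ← div_eq_mul_inv, div_le_iff₀ (Real.exp_pos _)]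
        linarith
      linarith)
  refine ⟨P, fun S hS => mem_powersetCard_univ.1 (hPI hS), fun A hA => ?_, fun T hT => ?_⟩
  · refine card_le_one.2 fun S hS S' hS' => ?_
    rw [mem_filter] at hS hS'
    by_contra hne
    exact disjoint_left.1 (hdisj S hS.1 S' hS'.1 hne) (mem_powersetCard.2 ⟨hS.2, hA⟩)
      (mem_powersetCard.2 ⟨hS'.2, hA⟩)
  · have h1 := hleave T (mem_powersetCard_univ.2 hT)
    have h2 : 4 * min (δ / 4) 1 * (n : ℝ) ≤ δ * n := by
      have := min_le_left (δ / 4) 1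
      gcongr
      linarith
    refine le_trans (Nat.cast_le.2 (card_le_card fun A hA => ?_)) (h1.trans h2)
    obtain ⟨hAV, hTA, hAP⟩ := mem_filter.1 hA
    simp only [mem_filter, mem_powersetCard, not_and]
    exact ⟨⟨mem_powersetCard.1 hAV, hTA⟩, fun S hS hAS => absurd hAS (hAP S hS)⟩

end AlmostSteiner

/-- For all integers `k > t ≥ 2` there exists `n₀` such that for every `n ≥ n₀` there is a
`t-(n,k,{1,2})`-design: a family of `k`-element subsets of an `n`-element set such that every
`t`-element subset is contained in exactly one or exactly two members. -/
theorem almost_steiner_exists :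
    ∀ k t : ℕ, t < k → 2 ≤ t →
      ∃ n₀ : ℕ, ∀ n : ℕ, n₀ ≤ n →
        ∃ 𝓕 : Finset (Finset (Fin n)),
          (∀ F ∈ 𝓕, F.card = k) ∧
          ∀ A : Finset (Fin n), A.card = t →
            (𝓕.filter fun F => A ⊆ F).card = 1 ∨ (𝓕.filter fun F => A ⊆ F).card = 2 := by
  intro k t htk ht
  have ht1 : 1 ≤ t := by omega
  obtain ⟨δ, hδ, hcover⟩ := AlmostSteiner.exists_packing_covering_of_sparse htk ht1
  rw [← Filter.eventually_atTop]
  filter_upwards [hcover, AlmostSteiner.exists_packing_sparse_leave htk ht1 hδ] with n hn hn'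
  obtain ⟨P, hP, hPpack, hleave⟩ := hn'
  obtain ⟨Q, hQ, hQpack, hcov⟩ := hn {A ∈ powersetCard t univ | ∀ S ∈ P, ¬A ⊆ S}
    (fun A hA => mem_powersetCard_univ.1 (mem_filter.1 hA).1) (fun T hT => by
      rw [filter_filter]
      simpa only [and_comm] using hleave T hT)
  refine ⟨P ∪ Q, fun F hF => (mem_union.1 hF).elim (hP F) (hQ F), fun A hA => ?_⟩
  have hle : #{F ∈ P ∪ Q | A ⊆ F} ≤ 2 := by
    rw [filter_union]
    exact (card_union_le _ _).trans (Nat.add_le_add (hPpack A hA) (hQpack A hA))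
  have hpos : 0 < #{F ∈ P ∪ Q | A ⊆ F} := by
    rw [card_pos]
    by_cases h : ∃ S ∈ P, A ⊆ S
    · obtain ⟨S, hS, hAS⟩ := h
      exact ⟨S, mem_filter.2 ⟨mem_union_left _ hS, hAS⟩⟩
    · push Not at h
      obtain ⟨S, hS, hAS⟩ := hcov A (mem_filter.2 ⟨mem_powersetCard_univ.2 hA, h⟩)
      exact ⟨S, mem_filter.2 ⟨mem_union_right _ hS, hAS⟩⟩
  omega
end

section
/- (Rödl) For all integers k and t with k > t ≥ 2 and every real ε > 0 there exists n₀ such that for every n ≥ n₀ there is a family 𝓕 of k-element subsets of an n-element set X in which every t-element subset of X is contained in at most one member of 𝓕, and the number of t-element subsets of X contained in no member of 𝓕 is at most ε · n^t. -/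
open Finset

namespace RodlNibble

/-- The expectation of `f C` for a random subset `C` of `E` that contains each element of `E`
independently with probability `p`. -/
noncomputable def expect {β : Type*} [DecidableEq β] (p : ℝ) (E : Finset β)
    (f : Finset β → ℝ) : ℝ :=
  ∑ C ∈ E.powerset, ((∏ _i ∈ C, p) * ∏ _i ∈ E \ C, (1 - p)) * f C

section Expect

variable {β : Type*} [DecidableEq β] {p : ℝ} {E : Finset β}

theorem expect_add (f g : Finset β → ℝ) :
    expect p E (fun C => f C + g C) = expect p E f + expect p E g := by
  simp only [expect, mul_add, sum_add_distrib]

theorem expect_sub (f g : Finset β → ℝ) :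
    expect p E (fun C => f C - g C) = expect p E f - expect p E g := by
  simp only [expect, mul_sub, sum_sub_distrib]

theorem expect_const_mul (c : ℝ) (f : Finset β → ℝ) :
    expect p E (fun C => c * f C) = c * expect p E f := by
  simp only [expect, mul_sum]
  exact sum_congr rfl fun C _ => by ring

theorem expect_sum {ι : Type*} (s : Finset ι) (f : ι → Finset β → ℝ) :
    expect p E (fun C => ∑ i ∈ s, f i C) = ∑ i ∈ s, expect p E (f i) := by
  simp only [expect, mul_sum]
  exact sum_comm

theorem expect_disjoint {S : Finset β} (hS : S ⊆ E) :
    expect p E (fun C => if Disjoint C S then 1 else 0) = (1 - p) ^ #S := by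
  have h : ∀ C ∈ E.powerset, ((∏ _i ∈ C, p) * ∏ _i ∈ E \ C, (1 - p)) *
      (if Disjoint C S then (1 : ℝ) else 0) =
      (∏ i ∈ C, if i ∈ S then 0 else p) * ∏ _i ∈ E \ C, (1 - p) := by
    intro C _
    split_ifs with hC
    · rw [mul_one]
      congr 1
      exact prod_congr rfl fun i hi => by rw [if_neg (disjoint_left.mp hC hi)]
    · obtain ⟨i, hi, hiS⟩ := not_disjoint_iff.mp hC
      rw [prod_eq_zero (f := fun i => if i ∈ S then (0 : ℝ) else p) hi (if_pos hiS)]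
      ring
  rw [expect, sum_congr rfl h, ← prod_add]
  have h' : ∀ i ∈ E, ((if i ∈ S then 0 else p) + (1 - p)) = if i ∈ S then 1 - p else 1 := by
    intro i _
    split_ifs <;> ring
  rw [prod_congr rfl h', prod_ite_mem, inter_eq_right.mpr hS, prod_const]

theorem expect_subset {S : Finset β} (hS : S ⊆ E) :
    expect p E (fun C => if S ⊆ C then 1 else 0) = p ^ #S := by
  have h : ∀ C ∈ E.powerset, ((∏ _i ∈ C, p) * ∏ _i ∈ E \ C, (1 - p)) *
      (if S ⊆ C then (1 : ℝ) else 0) =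
      (∏ _i ∈ C, p) * ∏ i ∈ E \ C, if i ∈ S then 0 else 1 - p := by
    intro C _
    split_ifs with hC
    · rw [mul_one]
      congr 1
      exact prod_congr rfl fun i hi => by
        rw [if_neg fun hiS => (mem_sdiff.mp hi).2 (hC hiS)]
    · obtain ⟨i, hiS, hi⟩ := not_subset.mp hC
      rw [prod_eq_zero (f := fun i => if i ∈ S then (0 : ℝ) else 1 - p)
        (mem_sdiff.mpr ⟨hS hiS, hi⟩) (if_pos hiS)]
      ring
  rw [expect, sum_congr rfl h, ← prod_add]
  have h' : ∀ i ∈ E, (p + if i ∈ S then 0 else 1 - p) = if i ∈ S then p else 1 := by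
    intro i _
    split_ifs <;> ring
  rw [prod_congr rfl h', prod_ite_mem, inter_eq_right.mpr hS, prod_const]

theorem exists_le_expect (hp0 : 0 < p) (hp1 : p < 1) (f : Finset β → ℝ) :
    ∃ C ⊆ E, f C ≤ expect p E f := by
  by_contra! h
  have hw : ∀ C : Finset β, 0 < (∏ _i ∈ C, p) * ∏ _i ∈ E \ C, (1 - p) := fun C =>
    mul_pos (prod_pos fun _ _ => hp0) (prod_pos fun _ _ => by linarith)
  have h1 : ∑ C ∈ E.powerset, ((∏ _i ∈ C, p) * ∏ _i ∈ E \ C, (1 - p)) = 1 := by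
    rw [← prod_add]
    simp
  have h2 : ∑ C ∈ E.powerset, ((∏ _i ∈ C, p) * ∏ _i ∈ E \ C, (1 - p)) * expect p E f <
      expect p E f :=
    sum_lt_sum_of_nonempty (powerset_nonempty E) fun C hC =>
      mul_lt_mul_of_pos_left (h C (mem_powerset.mp hC)) (hw C)
  rw [← sum_mul, h1, one_mul] at h2
  exact lt_irrefl _ h2

end Expect

theorem exp_neg_le_add {s t δ : ℝ} (hs : 0 ≤ s) (hδ : 0 ≤ δ) (h : t ≤ s + δ) :
    Real.exp (-s) ≤ Real.exp (-t) + δ := by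
  have h1 : Real.exp (-s) * (1 - δ) ≤ Real.exp (-t) :=
    calc Real.exp (-s) * (1 - δ) ≤ Real.exp (-s) * Real.exp (-δ) := by
          gcongr
          linarith [Real.add_one_le_exp (-δ)]
      _ = Real.exp (-s + -δ) := (Real.exp_add _ _).symm
      _ ≤ Real.exp (-t) := Real.exp_le_exp.mpr (by linarith)
  have h2 : Real.exp (-s) ≤ 1 := Real.exp_le_one_iff.mpr (by linarith)
  nlinarith

variable {α : Type*} [DecidableEq α]

/-- The number of edges of `E` that contain `v`. -/
def degree (E : Finset (Finset α)) (v : α) : ℕ := #{e ∈ E | v ∈ e}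

/-- The edges of `E` that meet `S`. -/
def meeting (E : Finset (Finset α)) (S : Finset α) : Finset (Finset α) :=
  {e ∈ E | ¬ Disjoint e S}

/-- The vertices of `W` lying on no edge of `C`. -/
def uncovered (W : Finset α) (C : Finset (Finset α)) : Finset α :=
  {v ∈ W | ∀ e ∈ C, v ∉ e}

theorem mem_uncovered {W : Finset α} {C : Finset (Finset α)} {v : α} :
    v ∈ uncovered W C ↔ v ∈ W ∧ ∀ e ∈ C, v ∉ e :=
  mem_filter

/-- `E` is an `r`-uniform hypergraph on `W` with maximum degree at most `K * D` and pair degrees at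
most `η * D`, whose degrees deviate from `D` by `η * D` in mean square, relative to `N`. -/
structure NearRegular (r : ℕ) (W : Finset α) (E : Finset (Finset α)) (D K η N : ℝ) : Prop where
  subset : ∀ e ∈ E, e ⊆ W
  card_eq : ∀ e ∈ E, #e = r
  degree_le : ∀ v ∈ W, (degree E v : ℝ) ≤ K * D
  codegree_le : ∀ u ∈ W, ∀ v ∈ W, u ≠ v → (#{e ∈ E | u ∈ e ∧ v ∈ e} : ℝ) ≤ η * D
  deviation_le : ∑ v ∈ W, ((degree E v : ℝ) / D - 1) ^ 2 ≤ η ^ 2 * N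

section Counting

variable {W : Finset α} {E : Finset (Finset α)}

theorem sum_filter_mem_comm (hE : ∀ e ∈ E, e ⊆ W) (f : α → Finset α → ℝ) :
    ∑ v ∈ W, ∑ e ∈ E with v ∈ e, f v e = ∑ e ∈ E, ∑ v ∈ e, f v e := by
  refine sum_comm' fun v e => ?_
  simp only [mem_filter]
  exact ⟨fun h => ⟨h.2.2, h.2.1⟩, fun h => ⟨hE e h.2 h.1, h.2, h.1⟩⟩

theorem sum_edges_sum (hE : ∀ e ∈ E, e ⊆ W) (f : α → ℝ) :
    ∑ e ∈ E, ∑ v ∈ e, f v = ∑ v ∈ W, degree E v * f v := by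
  rw [← sum_filter_mem_comm hE fun v _ => f v]
  exact sum_congr rfl fun v _ => by rw [sum_const, nsmul_eq_mul, degree]

theorem card_meeting_le (S : Finset α) : #(meeting E S) ≤ ∑ u ∈ S, degree E u := by
  refine le_trans (card_le_card ?_) (card_biUnion_le (s := S) (t := fun u => {e ∈ E | u ∈ e}))
  intro e he
  obtain ⟨he, hd⟩ := mem_filter.mp he
  obtain ⟨u, hu, huS⟩ := not_disjoint_iff.mp hd
  exact mem_biUnion.mpr ⟨u, huS, mem_filter.mpr ⟨he, hu⟩⟩

theorem sum_degree_le (S : Finset α) {κ : ℝ} (hκ0 : 0 ≤ κ)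
    (hκ : ∀ u ∈ S, ∀ v ∈ S, u ≠ v → (#{e ∈ E | u ∈ e ∧ v ∈ e} : ℝ) ≤ κ) :
    ∑ u ∈ S, (degree E u : ℝ) ≤ #(meeting E S) + #S ^ 2 * κ := by
  have h1 : ∑ u ∈ S, degree E u = ∑ e ∈ E, #{u ∈ S | u ∈ e} :=
    sum_card_bipartiteAbove_eq_sum_card_bipartiteBelow (fun (u : α) (e : Finset α) => u ∈ e)
  have h2 : ∑ x ∈ S.offDiag, #{e ∈ E | x.1 ∈ e ∧ x.2 ∈ e} =
      ∑ e ∈ E, #{x ∈ S.offDiag | x.1 ∈ e ∧ x.2 ∈ e} :=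
    sum_card_bipartiteAbove_eq_sum_card_bipartiteBelow
      (fun (x : α × α) (e : Finset α) => x.1 ∈ e ∧ x.2 ∈ e)
  have h3 : ∀ e ∈ E, #{u ∈ S | u ∈ e} ≤
      (if ¬ Disjoint e S then 1 else 0) + #{x ∈ S.offDiag | x.1 ∈ e ∧ x.2 ∈ e} := by
    intro e _
    have h4 : {x ∈ S.offDiag | x.1 ∈ e ∧ x.2 ∈ e} = ({u ∈ S | u ∈ e} : Finset α).offDiag := by
      ext x
      simp only [mem_filter, mem_offDiag]
      tauto
    rw [h4, offDiag_card]
    split_ifs with hd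
    · have : ({u ∈ S | u ∈ e} : Finset α) = ∅ :=
        filter_eq_empty_iff.mpr fun u hu hue => disjoint_left.mp hd hue hu
      simp [this]
    · generalize #{u ∈ S | u ∈ e} = c
      rcases c with _ | _ | c
      · simp
      · simp
      · have : (c + 2) * (c + 2) - (c + 2) = (c + 1) * (c + 2) := by
          rw [Nat.sub_eq_iff_eq_add (by nlinarith)]; ring
        rw [show c + 1 + 1 = c + 2 from rfl, this]
        nlinarith
  have h5 : ∑ u ∈ S, degree E u ≤
      #(meeting E S) + ∑ x ∈ S.offDiag, #{e ∈ E | x.1 ∈ e ∧ x.2 ∈ e} := by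
    rw [h1, h2, meeting, card_filter, ← sum_add_distrib]
    exact sum_le_sum h3
  have h6 : ∑ x ∈ S.offDiag, (#{e ∈ E | x.1 ∈ e ∧ x.2 ∈ e} : ℝ) ≤ #S ^ 2 * κ :=
    calc _ ≤ ∑ _x ∈ S.offDiag, κ := sum_le_sum fun x hx => by
          obtain ⟨h, h', hne⟩ := mem_offDiag.mp hx
          exact hκ _ h _ h' hne
      _ = (#S.offDiag : ℝ) * κ := by rw [sum_const, nsmul_eq_mul]
      _ ≤ _ := by
          gcongr
          rw [offDiag_card]
          have : #S * #S - #S ≤ #S ^ 2 := by rw [sq]; exact Nat.sub_le _ _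
          exact_mod_cast this
  have h7 : (∑ u ∈ S, (degree E u : ℝ)) ≤
      #(meeting E S) + ∑ x ∈ S.offDiag, (#{e ∈ E | x.1 ∈ e ∧ x.2 ∈ e} : ℝ) := by
    exact_mod_cast h5
  linarith

theorem subset_uncovered_iff {C : Finset (Finset α)} (hC : C ⊆ E) {S : Finset α} (hS : S ⊆ W) :
    S ⊆ uncovered W C ↔ Disjoint C (meeting E S) := by
  simp only [subset_iff, uncovered, mem_filter, disjoint_left (s := C), meeting, not_and, not_not]
  constructor
  · intro h e he _
    exact disjoint_right.mpr fun v hv => (h hv).2 e he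
  · intro h v hv
    exact ⟨hS hv, fun e he hve => disjoint_left.mp (h he (hC he)) hve hv⟩

end Counting

/-- The number of incidences of distinct edges of `C` sharing a vertex. -/
def conflicts (E C : Finset (Finset α)) : ℝ :=
  ∑ e ∈ E, ∑ u ∈ e, ∑ e' ∈ E with u ∈ e' ∧ e' ≠ e, if {e, e'} ⊆ C then 1 else 0

/-- The sum of the squared deviations from `T` of the degrees that remain after removing the
vertices of `C`, in expanded form. -/
def deviation (W : Finset α) (E : Finset (Finset α)) (T : ℝ) (C : Finset (Finset α)) : ℝ :=
  ∑ v ∈ W, ((∑ e ∈ E with v ∈ e, ∑ e' ∈ E with v ∈ e',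
      if Disjoint C (meeting E (e ∪ e')) then 1 else 0)
    - 2 * T * (∑ e ∈ E with v ∈ e, if Disjoint C (meeting E e) then 1 else 0)
    + T ^ 2 * if Disjoint C (meeting E {v}) then 1 else 0)

/-- The isolated edges of `C`. -/
def isolated (C : Finset (Finset α)) : Finset (Finset α) :=
  {e ∈ C | ∀ e' ∈ C, e' ≠ e → Disjoint e e'}

section Deterministic

variable {W : Finset α} {E C : Finset (Finset α)}

theorem deviation_eq (hE : ∀ e ∈ E, e ⊆ W) (hC : C ⊆ E) (T : ℝ) :
    deviation W E T C =
      ∑ v ∈ uncovered W C, ((degree {e ∈ E | e ⊆ uncovered W C} v : ℝ) - T) ^ 2 := by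
  have hsub : uncovered W C ⊆ W := filter_subset _ _
  rw [deviation, ← sum_subset hsub fun v hv hv' => ?_]
  · refine sum_congr rfl fun v hv => ?_
    have h1 : (if Disjoint C (meeting E {v}) then (1 : ℝ) else 0) = 1 :=
      if_pos ((subset_uncovered_iff hC (singleton_subset_iff.mpr (hsub hv))).mp
        (singleton_subset_iff.mpr hv))
    have h2 : (degree {e ∈ E | e ⊆ uncovered W C} v : ℝ) =
        ∑ e ∈ E with v ∈ e, if Disjoint C (meeting E e) then 1 else 0 := by
      rw [degree, filter_filter, sum_boole, filter_filter]
      congr 2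
      refine filter_congr fun e he => ?_
      rw [subset_uncovered_iff hC (hE e he), and_comm]
    have h3 : (∑ e ∈ E with v ∈ e, ∑ e' ∈ E with v ∈ e',
        if Disjoint C (meeting E (e ∪ e')) then (1 : ℝ) else 0) =
        (∑ e ∈ E with v ∈ e, if Disjoint C (meeting E e) then 1 else 0) ^ 2 := by
      rw [sq, sum_mul_sum]
      refine sum_congr rfl fun e he => sum_congr rfl fun e' he' => ?_
      have hW := hE e (mem_filter.mp he).1
      have hW' := hE e' (mem_filter.mp he').1
      simp only [← subset_uncovered_iff hC (union_subset hW hW'), ← subset_uncovered_iff hC hW,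
        ← subset_uncovered_iff hC hW', union_subset_iff, ite_and]
      split_ifs <;> simp
    rw [h1, h2, h3]
    ring
  · have h1 : ∀ S : Finset α, S ⊆ W → v ∈ S →
        (if Disjoint C (meeting E S) then (1 : ℝ) else 0) = 0 := fun S hS hvS =>
      if_neg fun hd => hv' ((subset_uncovered_iff hC hS).mpr hd hvS)
    rw [h1 {v} (singleton_subset_iff.mpr hv) (mem_singleton_self v),
      sum_eq_zero fun e he => h1 e (hE e (mem_filter.mp he).1) (mem_filter.mp he).2,
      sum_eq_zero fun e he => sum_eq_zero fun e' he' => h1 (e ∪ e')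
        (union_subset (hE e (mem_filter.mp he).1) (hE e' (mem_filter.mp he').1))
        (mem_union_left _ (mem_filter.mp he).2)]
    ring

theorem card_uncovered (hC : C ⊆ E) :
    (#(uncovered W C) : ℝ) = ∑ v ∈ W, if Disjoint C (meeting E {v}) then 1 else 0 := by
  rw [sum_boole]
  congr 2
  rw [uncovered]
  refine filter_congr fun v hv => ?_
  rw [← subset_uncovered_iff hC (singleton_subset_iff.mpr hv), singleton_subset_iff, uncovered,
    mem_filter, and_iff_right hv]

theorem card_wasted_le {r : ℕ} (hr : ∀ e ∈ E, #e = r) (hC : C ⊆ E) :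
    (#(uncovered W (isolated C) \ uncovered W C) : ℝ) ≤ r * conflicts E C := by
  have h1 : uncovered W (isolated C) \ uncovered W C ⊆ (C \ isolated C).biUnion id := by
    intro v hv
    simp only [uncovered, mem_sdiff, mem_filter, not_and, not_forall, not_not] at hv
    obtain ⟨⟨hvW, h⟩, h'⟩ := hv
    obtain ⟨e, he, hve⟩ := h' hvW
    exact mem_biUnion.mpr ⟨e, mem_sdiff.mpr ⟨he, fun hi => h e hi hve⟩, hve⟩
  have h2 : #(uncovered W (isolated C) \ uncovered W C) ≤ #(C \ isolated C) * r :=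
    (card_le_card h1).trans <| card_biUnion_le_card_mul _ _ _ fun e he =>
      (hr e (hC (mem_sdiff.mp he).1)).le
  have h3 : (#(C \ isolated C) : ℝ) ≤ conflicts E C := by
    rw [conflicts, card_eq_sum_ones, Nat.cast_sum]
    refine le_trans (sum_le_sum fun e he => ?_) (sum_le_sum_of_subset_of_nonneg
      (sdiff_subset.trans hC) fun e _ _ =>
        sum_nonneg fun u _ => sum_nonneg fun e' _ => by split_ifs <;> norm_num)
    simp only [isolated, mem_sdiff, mem_filter, not_and, not_forall] at he
    obtain ⟨heC, he⟩ := he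
    obtain ⟨e', he', hne, hd⟩ := he heC
    obtain ⟨u, hu, hu'⟩ := not_disjoint_iff.mp hd
    refine le_trans ?_ (single_le_sum (fun u _ => sum_nonneg fun e' _ => by
      split_ifs <;> norm_num) hu)
    refine le_trans ?_ (single_le_sum (fun e' _ => by split_ifs <;> norm_num)
      (mem_filter.mpr ⟨hC he', hu', hne⟩))
    rw [if_pos (insert_subset heC (singleton_subset_iff.mpr he'))]
    simp
  calc (#(uncovered W (isolated C) \ uncovered W C) : ℝ) ≤ #(C \ isolated C) * r := by
        exact_mod_cast h2
    _ ≤ conflicts E C * r := by gcongr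
    _ = r * conflicts E C := mul_comm _ _

end Deterministic

/-- The normalized deviation of the degree of `v` from `D`. -/
noncomputable def dev (E : Finset (Finset α)) (D : ℝ) (v : α) : ℝ := |(degree E v : ℝ) / D - 1|

theorem dev_nonneg (E : Finset (Finset α)) (D : ℝ) (v : α) : 0 ≤ dev E D v := abs_nonneg _

theorem sum_dev_nonneg (E : Finset (Finset α)) (D : ℝ) (S : Finset α) : 0 ≤ ∑ v ∈ S, dev E D v :=
  sum_nonneg fun v _ => dev_nonneg E D v

/-- The probability that a random set of edges of density `1 - exp (-θ / D)` avoids `S`. -/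
noncomputable def avoid (E : Finset (Finset α)) (D θ : ℝ) (S : Finset α) : ℝ :=
  Real.exp (-(θ / D)) ^ #(meeting E S)

namespace NearRegular

variable {W : Finset α} {E : Finset (Finset α)} {m : ℕ} {D K η N θ : ℝ}

theorem sum_dev_le (h : NearRegular (m + 1) W E D K η N) (hη : 0 < η) (hN : (#W : ℝ) ≤ N) :
    ∑ v ∈ W, dev E D v ≤ η * N := by
  have h1 : ∀ v ∈ W, 2 * η * dev E D v ≤ ((degree E v : ℝ) / D - 1) ^ 2 + η ^ 2 := by
    intro v _
    rw [dev]
    have := two_mul_le_add_sq η (|(degree E v : ℝ) / D - 1|)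
    rw [sq_abs] at this
    linarith
  have h2 := sum_le_sum h1
  rw [← mul_sum, sum_add_distrib, sum_const, nsmul_eq_mul] at h2
  have h3 : (#W : ℝ) * η ^ 2 ≤ N * η ^ 2 := by gcongr
  have h4 : 2 * η * ∑ v ∈ W, dev E D v ≤ 2 * η * (η * N) := by
    linarith [h.deviation_le]
  exact le_of_mul_le_mul_left h4 (by positivity)

theorem avoid_eq (S : Finset α) :
    avoid E D θ S = Real.exp (-(θ * (#(meeting E S) / D))) := by
  rw [avoid, ← Real.exp_nat_mul]
  congr 1
  ring

theorem avoid_le (h : NearRegular (m + 1) W E D K η N) (hD : 0 < D) (hη : 0 < η) (hθ0 : 0 ≤ θ)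
    (hθ1 : θ ≤ 1) {S : Finset α} (hS : S ⊆ W) :
    avoid E D θ S ≤ Real.exp (-θ) ^ #S + (∑ u ∈ S, dev E D u + #S ^ 2 * η) := by
  have h1 := sum_degree_le (E := E) S (κ := η * D) (by positivity) fun u hu v hv hne =>
    h.codegree_le u (hS hu) v (hS hv) hne
  have h2 : ∀ u ∈ S, (1 : ℝ) ≤ degree E u / D + dev E D u := fun u _ => by
    have := neg_abs_le ((degree E u : ℝ) / D - 1)
    rw [dev]
    linarith
  have h3 := sum_le_sum h2
  rw [sum_add_distrib, ← sum_div, sum_const, nsmul_eq_mul, mul_one] at h3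
  have h4 : (∑ u ∈ S, (degree E u : ℝ)) / D ≤ #(meeting E S) / D + #S ^ 2 * η := by
    rw [div_le_iff₀ hD, add_mul, div_mul_cancel₀ _ hD.ne']
    linarith
  have h5 : 0 ≤ ∑ u ∈ S, dev E D u := sum_dev_nonneg E D _
  have h6 : 0 ≤ (#S : ℝ) ^ 2 * η := by positivity
  rw [avoid_eq, ← Real.exp_nat_mul, mul_neg]
  refine exp_neg_le_add (by positivity) (by positivity) ?_
  have h7 : θ * #S ≤ θ * (#(meeting E S) / D + (∑ u ∈ S, dev E D u + #S ^ 2 * η)) := by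
    gcongr
    linarith
  have h8 : θ * (∑ u ∈ S, dev E D u + #S ^ 2 * η) ≤ ∑ u ∈ S, dev E D u + #S ^ 2 * η :=
    mul_le_of_le_one_left (by positivity) hθ1
  linarith

theorem le_avoid (hD : 0 < D) (hθ0 : 0 ≤ θ) (hθ1 : θ ≤ 1) (S : Finset α) :
    Real.exp (-θ) ^ #S ≤ avoid E D θ S + ∑ u ∈ S, dev E D u := by
  have h1 : (#(meeting E S) : ℝ) ≤ ∑ u ∈ S, (degree E u : ℝ) := by
    exact_mod_cast card_meeting_le S
  have h2 : ∀ u ∈ S, (degree E u : ℝ) / D ≤ 1 + dev E D u := fun u _ => by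
    have := le_abs_self ((degree E u : ℝ) / D - 1)
    rw [dev]
    linarith
  have h3 := sum_le_sum h2
  rw [sum_add_distrib, ← sum_div, sum_const, nsmul_eq_mul, mul_one] at h3
  have h5 : 0 ≤ ∑ u ∈ S, dev E D u := sum_dev_nonneg E D _
  rw [avoid_eq, ← Real.exp_nat_mul, mul_neg]
  refine exp_neg_le_add (by positivity) h5 ?_
  have h6 : θ * (#(meeting E S) / D) ≤ θ * (#S + ∑ u ∈ S, dev E D u) := by
    gcongr
    exact le_trans (by gcongr) h3
  have h8 : θ * (∑ u ∈ S, dev E D u) ≤ ∑ u ∈ S, dev E D u :=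
    mul_le_of_le_one_left h5 hθ1
  linarith

theorem avoid_singleton_le (hD : 0 < D) (hθ0 : 0 ≤ θ) (hθ1 : θ ≤ 1) (v : α) :
    avoid E D θ {v} ≤ Real.exp (-θ) + dev E D v := by
  have h1 : meeting E {v} = {e ∈ E | v ∈ e} :=
    filter_congr fun e _ => by simp
  rw [avoid_eq, h1]
  refine exp_neg_le_add (by positivity) (dev_nonneg _ _ _) ?_
  have := neg_abs_le ((degree E v : ℝ) / D - 1)
  have h2 : θ * (1 - dev E D v) ≤ θ * (#{e ∈ E | v ∈ e} / D) := by
    gcongr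
    simp only [degree, dev] at this ⊢
    linarith
  have h3 : θ * dev E D v ≤ dev E D v := mul_le_of_le_one_left (dev_nonneg _ _ _) hθ1
  linarith

/-- For `e, e'` edges through `v`, the two alternatives are `e ∩ e' = {v}` and `1 < #(e ∩ e')`. -/
theorem avoid_union_le (h : NearRegular (m + 1) W E D K η N) (hD : 0 < D) (hη : 0 < η)
    (hθ0 : 0 ≤ θ) (hθ1 : θ ≤ 1) {e e' : Finset α} (he : e ∈ E) (he' : e' ∈ E) {v : α}
    (hv : v ∈ e) (hv' : v ∈ e') :
    avoid E D θ (e ∪ e') ≤ Real.exp (-θ) ^ (2 * m + 1) +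
      (∑ u ∈ e, dev E D u + ∑ u ∈ e', dev E D u) + (2 * m + 1) ^ 2 * η +
      ∑ u ∈ e.erase v, if u ∈ e' then 1 else 0 := by
  have hnn : ∀ S : Finset α, 0 ≤ ∑ u ∈ S, dev E D u := fun S =>
    sum_dev_nonneg E D _
  by_cases hi : ∃ u ∈ e.erase v, u ∈ e'
  · obtain ⟨u, hu, hu'⟩ := hi
    have h1 : (1 : ℝ) ≤ ∑ u ∈ e.erase v, if u ∈ e' then 1 else 0 := by
      refine le_trans ?_ (single_le_sum (fun u _ => by split_ifs <;> norm_num) hu)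
      rw [if_pos hu']
    have h2 : avoid E D θ (e ∪ e') ≤ 1 :=
      pow_le_one₀ (Real.exp_nonneg _) (Real.exp_le_one_iff.mpr (by
        have : 0 ≤ θ / D := by positivity
        linarith))
    have h3 : 0 ≤ Real.exp (-θ) ^ (2 * m + 1) := by positivity
    have h4 : 0 ≤ (2 * (m : ℝ) + 1) ^ 2 * η := by positivity
    linarith [hnn e, hnn e']
  · push Not at hi
    have h1 : e ∩ e' = {v} := by
      ext u
      simp only [mem_inter, mem_singleton]
      constructor
      · rintro ⟨hu, hu'⟩
        by_contra hne
        exact hi u (mem_erase.mpr ⟨hne, hu⟩) hu'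
      · rintro rfl
        exact ⟨hv, hv'⟩
    have h2 : #(e ∪ e') = 2 * m + 1 := by
      have := card_union_add_card_inter e e'
      rw [h1, card_singleton, h.card_eq e he, h.card_eq e' he'] at this
      omega
    have h3 : ∑ u ∈ e ∪ e', dev E D u ≤ ∑ u ∈ e, dev E D u + ∑ u ∈ e', dev E D u := by
      rw [← sum_union_inter]
      linarith [hnn (e ∩ e')]
    have h4 := avoid_le h hD hη hθ0 hθ1 (union_subset (h.subset e he) (h.subset e' he'))
    have h5 : (0 : ℝ) ≤ ∑ u ∈ e.erase v, if u ∈ e' then 1 else 0 :=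
      sum_nonneg fun u _ => by split_ifs <;> norm_num
    rw [h2] at h4
    push_cast at h4
    linarith

theorem sum_edges_dev_le (h : NearRegular (m + 1) W E D K η N) (hD : 0 < D) (hK : 0 ≤ K)
    (hη : 0 < η) (hN : (#W : ℝ) ≤ N) :
    ∑ v ∈ W, ∑ e ∈ E with v ∈ e, ∑ u ∈ e, dev E D u ≤ (m + 1) * (K * D * (η * N)) := by
  rw [sum_filter_mem_comm h.subset fun _ e => ∑ u ∈ e, dev E D u]
  have h1 : ∀ e ∈ E, ∑ _v ∈ e, ∑ u ∈ e, dev E D u = (m + 1) * ∑ u ∈ e, dev E D u := by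
    intro e he
    rw [sum_const, nsmul_eq_mul, h.card_eq e he]
    push_cast
    rfl
  rw [sum_congr rfl h1, ← mul_sum, sum_edges_sum h.subset]
  gcongr
  calc ∑ v ∈ W, (degree E v : ℝ) * dev E D v ≤ ∑ v ∈ W, K * D * dev E D v :=
        sum_le_sum fun v hv => mul_le_mul_of_nonneg_right (h.degree_le v hv) (dev_nonneg _ _ _)
    _ = K * D * ∑ v ∈ W, dev E D v := (mul_sum _ _ _).symm
    _ ≤ K * D * (η * N) := by gcongr; exact sum_dev_le h hη hN

theorem sum_sq_degree_le (h : NearRegular (m + 1) W E D K η N) (hD : 0 < D) (hK : 0 ≤ K)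
    (hη : 0 < η) (hN : (#W : ℝ) ≤ N) :
    ∑ v ∈ W, ((degree E v : ℝ) / D) ^ 2 ≤ #W + (K + 1) * (η * N) := by
  have h1 : ∀ v ∈ W, ((degree E v : ℝ) / D) ^ 2 ≤ 1 + (K + 1) * dev E D v := by
    intro v hv
    have h2 : (degree E v : ℝ) / D ≤ K := (div_le_iff₀ hD).mpr (h.degree_le v hv)
    have h3 : 0 ≤ (degree E v : ℝ) / D := by positivity
    have h4 := le_abs_self ((degree E v : ℝ) / D - 1)
    have h5 : 0 ≤ |(degree E v : ℝ) / D - 1| := abs_nonneg _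
    rw [dev]
    nlinarith
  refine (sum_le_sum h1).trans ?_
  rw [sum_add_distrib, ← mul_sum, sum_const, nsmul_eq_mul, mul_one]
  gcongr
  exact sum_dev_le h hη hN

theorem expect_conflicts_le (h : NearRegular (m + 1) W E D K η N) (hD : 0 < D) (hK : 0 ≤ K)
    (hη : 0 < η) (hN : (#W : ℝ) ≤ N) (hθ0 : 0 ≤ θ) :
    expect (1 - Real.exp (-(θ / D))) E (conflicts E) ≤ θ ^ 2 * (#W + (K + 1) * (η * N)) := by
  set p := 1 - Real.exp (-(θ / D)) with hp
  have hθD : 0 ≤ θ / D := by positivity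
  have hp0 : 0 ≤ p := by
    have : Real.exp (-(θ / D)) ≤ 1 := Real.exp_le_one_iff.mpr (by linarith)
    linarith
  have hp1 : p ≤ θ / D := by linarith [Real.add_one_le_exp (-(θ / D))]
  have h1 : expect p E (conflicts E) = ∑ e ∈ E, ∑ u ∈ e, ∑ e' ∈ E with u ∈ e' ∧ e' ≠ e, p ^ 2 := by
    change expect p E (fun C => conflicts E C) = _
    simp only [conflicts, expect_sum]
    refine sum_congr rfl fun e he => sum_congr rfl fun u _ => sum_congr rfl fun e' he' => ?_
    obtain ⟨he', -, hne⟩ := mem_filter.mp he'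
    rw [expect_subset (insert_subset he (singleton_subset_iff.mpr he')), card_pair hne.symm]
  have h2 : expect p E (conflicts E) ≤ ∑ e ∈ E, ∑ u ∈ e, degree E u * p ^ 2 := by
    rw [h1]
    refine sum_le_sum fun e _ => sum_le_sum fun u _ => ?_
    rw [sum_const, nsmul_eq_mul, degree]
    gcongr with e' he'
    exact fun h => h.1
  have h3 : ∑ e ∈ E, ∑ u ∈ e, degree E u * p ^ 2 ≤
      θ ^ 2 * ∑ v ∈ W, ((degree E v : ℝ) / D) ^ 2 := by
    rw [sum_edges_sum h.subset, mul_sum]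
    refine sum_le_sum fun v _ => ?_
    calc (degree E v : ℝ) * (degree E v * p ^ 2) = (degree E v : ℝ) ^ 2 * p ^ 2 := by ring
      _ ≤ (degree E v : ℝ) ^ 2 * (θ / D) ^ 2 := by gcongr
      _ = θ ^ 2 * ((degree E v : ℝ) / D) ^ 2 := by ring
  refine h2.trans (h3.trans ?_)
  gcongr
  exact sum_sq_degree_le h hD hK hη hN

theorem expect_card_uncovered_le (h : NearRegular (m + 1) W E D K η N) (hD : 0 < D)
    (hη : 0 < η) (hN : (#W : ℝ) ≤ N) (hθ0 : 0 ≤ θ) (hθ1 : θ ≤ 1) :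
    expect (1 - Real.exp (-(θ / D))) E
      (fun C => ∑ v ∈ W, if Disjoint C (meeting E {v}) then 1 else 0) ≤
      Real.exp (-θ) * #W + η * N := by
  rw [expect_sum]
  calc _ ≤ ∑ v ∈ W, (Real.exp (-θ) + dev E D v) := sum_le_sum fun v _ => by
        rw [expect_disjoint (show meeting E {v} ⊆ E from filter_subset _ _), sub_sub_cancel]
        exact avoid_singleton_le hD hθ0 hθ1 v
    _ = Real.exp (-θ) * #W + ∑ v ∈ W, dev E D v := by
        rw [sum_add_distrib, sum_const, nsmul_eq_mul, mul_comm]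
    _ ≤ _ := by gcongr; exact sum_dev_le h hη hN

theorem sum_avoid_union_le (h : NearRegular (m + 1) W E D K η N) (hD : 0 < D)
    (hη : 0 < η) (hθ0 : 0 ≤ θ) (hθ1 : θ ≤ 1) {v : α} (hv : v ∈ W) :
    ∑ e ∈ E with v ∈ e, ∑ e' ∈ E with v ∈ e', avoid E D θ (e ∪ e') ≤
      (degree E v : ℝ) ^ 2 * Real.exp (-θ) ^ (2 * m + 1) +
        2 * K * D * ∑ e ∈ E with v ∈ e, ∑ u ∈ e, dev E D u +
          (2 * m + 1) ^ 2 * K ^ 2 * D ^ 2 * η + m * K * D ^ 2 * η := by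
  set a := Real.exp (-θ)
  set s : Finset α → ℝ := fun e => ∑ u ∈ e, dev E D u
  have hdv := h.degree_le v hv
  have hsnn : 0 ≤ ∑ e ∈ E with v ∈ e, s e :=
    sum_nonneg fun e _ => sum_dev_nonneg E D e
  have hov : ∑ e ∈ E with v ∈ e, ∑ e' ∈ E with v ∈ e',
      ∑ u ∈ e.erase v, (if u ∈ e' then (1 : ℝ) else 0) ≤ degree E v * (m * (η * D)) := by
    rw [degree, ← nsmul_eq_mul]
    refine sum_le_card_nsmul _ _ _ fun e he => ?_
    obtain ⟨he, hve⟩ := mem_filter.mp he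
    rw [sum_comm]
    have hc : #(e.erase v) = m := by rw [card_erase_of_mem hve, h.card_eq e he]; rfl
    rw [← hc, ← nsmul_eq_mul]
    refine sum_le_card_nsmul _ _ _ fun u hu => ?_
    rw [sum_boole, filter_filter]
    exact h.codegree_le v hv u (h.subset e he (mem_of_mem_erase hu)) (ne_of_mem_erase hu).symm
  calc _ ≤ ∑ e ∈ E with v ∈ e, ∑ e' ∈ E with v ∈ e', (a ^ (2 * m + 1) + (s e + s e') +
          (2 * m + 1) ^ 2 * η + ∑ u ∈ e.erase v, if u ∈ e' then 1 else 0) :=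
        sum_le_sum fun e he => sum_le_sum fun e' he' =>
          avoid_union_le h hD hη hθ0 hθ1 (mem_filter.mp he).1 (mem_filter.mp he').1
            (mem_filter.mp he).2 (mem_filter.mp he').2
    _ = (degree E v : ℝ) ^ 2 * a ^ (2 * m + 1) + 2 * degree E v * ∑ e ∈ E with v ∈ e, s e +
        (degree E v : ℝ) ^ 2 * ((2 * m + 1) ^ 2 * η) + ∑ e ∈ E with v ∈ e,
          ∑ e' ∈ E with v ∈ e', ∑ u ∈ e.erase v, if u ∈ e' then 1 else 0 := by
        simp only [sum_add_distrib, sum_const, nsmul_eq_mul, ← mul_sum, degree]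
        ring
    _ ≤ (degree E v : ℝ) ^ 2 * a ^ (2 * m + 1) + 2 * (K * D) * ∑ e ∈ E with v ∈ e, s e +
        (K * D) ^ 2 * ((2 * m + 1) ^ 2 * η) + (K * D) * (m * (η * D)) := by
        gcongr
        exact hov.trans (by gcongr)
    _ = _ := by ring

/-- The expected deviation from `exp (-θ) ^ m * D` of the degrees after a nibble. -/
theorem expect_deviation_le (h : NearRegular (m + 1) W E D K η N) (hD : 0 < D) (hK : 0 ≤ K)
    (hη : 0 < η) (hη1 : η ≤ 1) (hN : (#W : ℝ) ≤ N) (hθ0 : 0 ≤ θ) (hθ1 : θ ≤ 1) :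
    expect (1 - Real.exp (-(θ / D))) E (deviation W E (Real.exp (-θ) ^ m * D)) ≤
      (2 + 2 * (m + 1) * K ^ 2 + (2 * m + 1) ^ 2 * K ^ 2 + m * K + 2 * (m + 1) * K) *
        (η * N) * D ^ 2 := by
  set a := Real.exp (-θ) with ha
  have ha0 : 0 < a := Real.exp_pos _
  have ha1 : a ≤ 1 := Real.exp_le_one_iff.mpr (by linarith)
  set T := a ^ m * D with hT
  have hT0 : 0 ≤ T := by positivity
  have hTD : T ≤ D := mul_le_of_le_one_left hD.le (pow_le_one₀ ha0.le ha1)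
  have hN0 : 0 ≤ N := le_trans (Nat.cast_nonneg _) hN
  have h1 : expect (1 - Real.exp (-(θ / D))) E (deviation W E T) =
      ∑ v ∈ W, ((∑ e ∈ E with v ∈ e, ∑ e' ∈ E with v ∈ e', avoid E D θ (e ∪ e'))
        - 2 * T * (∑ e ∈ E with v ∈ e, avoid E D θ e) + T ^ 2 * avoid E D θ {v}) := by
    change expect _ E (fun C => deviation W E T C) = _
    simp only [avoid, deviation, expect_sum, expect_add, expect_sub, expect_const_mul]
    simp only [expect_disjoint (show meeting E _ ⊆ E from filter_subset _ _), sub_sub_cancel]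
  set s : Finset α → ℝ := fun e => ∑ u ∈ e, dev E D u with hs
  have hsingle : ∀ v ∈ W, (degree E v : ℝ) * a ^ (m + 1) - ∑ e ∈ E with v ∈ e, s e ≤
      ∑ e ∈ E with v ∈ e, avoid E D θ e := by
    intro v _
    rw [degree, ← nsmul_eq_mul, ← sum_const, ← sum_sub_distrib]
    refine sum_le_sum fun e he => ?_
    have := le_avoid (E := E) hD hθ0 hθ1 e
    rw [h.card_eq e (mem_filter.mp he).1] at this
    linarith
  have hmain : ∀ v ∈ W,
      (∑ e ∈ E with v ∈ e, ∑ e' ∈ E with v ∈ e', avoid E D θ (e ∪ e'))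
        - 2 * T * (∑ e ∈ E with v ∈ e, avoid E D θ e) + T ^ 2 * avoid E D θ {v} ≤
      D ^ 2 * ((degree E v : ℝ) / D - 1) ^ 2 + (2 * K * D + 2 * D) * ∑ e ∈ E with v ∈ e, s e +
        D ^ 2 * dev E D v + ((2 * m + 1) ^ 2 * K ^ 2 + m * K) * D ^ 2 * η := by
    intro v hv
    have hsnn : 0 ≤ ∑ e ∈ E with v ∈ e, s e :=
      sum_nonneg fun e _ => sum_dev_nonneg E D e
    have hdnn : 0 ≤ dev E D v := dev_nonneg _ _ _
    have e1 := sum_avoid_union_le h hD hη hθ0 hθ1 hv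
    have e2 := mul_le_mul_of_nonneg_left (hsingle v hv) (show 0 ≤ 2 * T by positivity)
    have e3 := mul_le_mul_of_nonneg_left (avoid_singleton_le (E := E) hD hθ0 hθ1 v) (sq_nonneg T)
    have e4 : 2 * T * ∑ e ∈ E with v ∈ e, s e ≤ 2 * D * ∑ e ∈ E with v ∈ e, s e :=
      mul_le_mul_of_nonneg_right (by linarith) hsnn
    have e5 : T ^ 2 * dev E D v ≤ D ^ 2 * dev E D v :=
      mul_le_mul_of_nonneg_right (pow_le_pow_left₀ hT0 hTD 2) hdnn
    have e6 : (degree E v : ℝ) ^ 2 * a ^ (2 * m + 1) - 2 * T * (degree E v * a ^ (m + 1)) +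
        T ^ 2 * a = a ^ (2 * m + 1) * (D ^ 2 * ((degree E v : ℝ) / D - 1) ^ 2) := by
      rw [hT]
      field_simp
      ring
    have e7 : a ^ (2 * m + 1) * (D ^ 2 * ((degree E v : ℝ) / D - 1) ^ 2) ≤
        D ^ 2 * ((degree E v : ℝ) / D - 1) ^ 2 :=
      mul_le_of_le_one_left (by positivity) (pow_le_one₀ ha0.le ha1)
    rw [mul_add] at e3
    rw [mul_sub] at e2
    linarith
  rw [h1]
  refine (sum_le_sum hmain).trans ?_
  rw [sum_add_distrib, sum_add_distrib, sum_add_distrib, ← mul_sum, ← mul_sum, ← mul_sum,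
    sum_const, nsmul_eq_mul]
  have f1 : D ^ 2 * ∑ v ∈ W, ((degree E v : ℝ) / D - 1) ^ 2 ≤ D ^ 2 * (η * N) := by
    gcongr
    refine h.deviation_le.trans ?_
    gcongr
    nlinarith
  have f2 : (2 * K * D + 2 * D) * ∑ v ∈ W, ∑ e ∈ E with v ∈ e, s e ≤
      (2 * K * D + 2 * D) * ((m + 1) * (K * D * (η * N))) := by
    gcongr
    exact sum_edges_dev_le h hD hK hη hN
  have f3 : D ^ 2 * ∑ v ∈ W, dev E D v ≤ D ^ 2 * (η * N) := by
    gcongr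
    exact sum_dev_le h hη hN
  have f4 : (#W : ℝ) * (((2 * m + 1) ^ 2 * K ^ 2 + m * K) * D ^ 2 * η) ≤
      N * (((2 * m + 1) ^ 2 * K ^ 2 + m * K) * D ^ 2 * η) := by gcongr
  refine (add_le_add (add_le_add (add_le_add f1 f2) f3) f4).trans (le_of_eq ?_)
  ring

end NearRegular

/-- The constant in `NearRegular.expect_deviation_le`. -/
def deviationConst (m : ℕ) (K : ℝ) : ℝ :=
  2 + 2 * (m + 1) * K ^ 2 + (2 * m + 1) ^ 2 * K ^ 2 + m * K + 2 * (m + 1) * K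

theorem conflicts_nonneg (E C : Finset (Finset α)) : 0 ≤ conflicts E C :=
  sum_nonneg fun _ _ => sum_nonneg fun _ _ => sum_nonneg fun _ _ => by split_ifs <;> norm_num

namespace NearRegular

variable {W : Finset α} {E : Finset (Finset α)} {m : ℕ} {D K η N θ : ℝ}

theorem exists_nibble (h : NearRegular (m + 1) W E D K η N) (hD : 0 < D) (hK : 0 ≤ K)
    (hη : 0 < η) (hη1 : η ≤ 1) (hN : (#W : ℝ) ≤ N) (hθ0 : 0 < θ) (hθ1 : θ ≤ 1)
    {b B : ℝ} (hb : 0 ≤ b) (hB : 0 ≤ B) :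
    ∃ C ⊆ E, (m + 1) * conflicts E C + b * #(uncovered W C) +
        B * ∑ v ∈ uncovered W C, ((degree {e ∈ E | e ⊆ uncovered W C} v : ℝ) -
          Real.exp (-θ) ^ m * D) ^ 2 ≤
      ((m + 1) * θ ^ 2 + b * Real.exp (-θ)) * #W +
        η * ((m + 1) * θ ^ 2 * (K + 1) + b + B * D ^ 2 * deviationConst m K) * N := by
  have hθD : 0 < θ / D := by positivity
  have hp1 : 1 - Real.exp (-(θ / D)) < 1 := by linarith [Real.exp_pos (-(θ / D))]
  have hp0 : 0 < 1 - Real.exp (-(θ / D)) := by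
    have : Real.exp (-(θ / D)) < 1 := Real.exp_lt_one_iff.mpr (by linarith)
    linarith
  obtain ⟨C, hC, hCle⟩ := exists_le_expect (E := E) hp0 hp1 fun C =>
    (m + 1) * conflicts E C +
      b * (∑ v ∈ W, if Disjoint C (meeting E {v}) then 1 else 0) +
      B * deviation W E (Real.exp (-θ) ^ m * D) C
  rw [← card_uncovered hC, deviation_eq h.subset hC, expect_add, expect_add, expect_const_mul,
    expect_const_mul, expect_const_mul] at hCle
  refine ⟨C, hC, hCle.trans ?_⟩
  have e1 := mul_le_mul_of_nonneg_left (h.expect_conflicts_le hD hK hη hN hθ0.le)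
    (show (0 : ℝ) ≤ m + 1 by positivity)
  have e2 := mul_le_mul_of_nonneg_left (h.expect_card_uncovered_le hD hη hN hθ0.le hθ1) hb
  have e3 := mul_le_mul_of_nonneg_left (h.expect_deviation_le hD hK hη hη1 hN hθ0.le hθ1) hB
  refine (add_le_add (add_le_add e1 e2) e3).trans (le_of_eq ?_)
  rw [deviationConst]
  ring

theorem restrict (h : NearRegular (m + 1) W E D K η N) {W' : Finset α} (hW' : W' ⊆ W)
    {T K' η' : ℝ} (hT : 0 < T) (hK' : K * D ≤ K' * T) (hη' : η * D ≤ η' * T)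
    (hdev : ∑ v ∈ W', ((degree {e ∈ E | e ⊆ W'} v : ℝ) - T) ^ 2 ≤ η' ^ 2 * T ^ 2 * N) :
    NearRegular (m + 1) W' {e ∈ E | e ⊆ W'} T K' η' N where
  subset e he := (mem_filter.mp he).2
  card_eq e he := h.card_eq e (mem_filter.mp he).1
  degree_le v hv := by
    refine le_trans ?_ ((h.degree_le v (hW' hv)).trans hK')
    exact_mod_cast card_le_card (filter_subset_filter _ (filter_subset _ _))
  codegree_le u hu v hv hne := by
    refine le_trans ?_ ((h.codegree_le u (hW' hu) v (hW' hv) hne).trans hη')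
    exact_mod_cast card_le_card (filter_subset_filter _ (filter_subset _ _))
  deviation_le := by
    have h1 : ∀ v ∈ W', ((degree {e ∈ E | e ⊆ W'} v : ℝ) / T - 1) ^ 2 =
        ((degree {e ∈ E | e ⊆ W'} v : ℝ) - T) ^ 2 / T ^ 2 := fun v _ => by
      field_simp
    rw [sum_congr rfl h1, ← sum_div, div_le_iff₀ (by positivity)]
    linarith

end NearRegular

theorem uncovered_union_subset (W : Finset α) (C M : Finset (Finset α)) :
    uncovered W (isolated C ∪ M) ⊆
      (uncovered W (isolated C) \ uncovered W C) ∪ uncovered (uncovered W C) M := by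
  intro v hv
  simp only [uncovered, mem_filter, mem_union, mem_sdiff] at hv ⊢
  by_cases h : ∀ e ∈ C, v ∉ e
  · exact Or.inr ⟨⟨hv.1, h⟩, fun e he => hv.2 e (Or.inr he)⟩
  · exact Or.inl ⟨⟨hv.1, fun e he => hv.2 e (Or.inl he)⟩, fun h' => h h'.2⟩

theorem exp_neg_le_one_sub_half {θ : ℝ} (h0 : 0 ≤ θ) (h1 : θ ≤ 1) :
    Real.exp (-θ) ≤ 1 - θ / 2 := by
  rw [Real.exp_neg]
  refine inv_le_of_inv_le₀ (by linarith) ?_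
  refine le_trans ?_ (Real.add_one_le_exp θ)
  rw [inv_le_iff_one_le_mul₀ (by linarith)]
  nlinarith

/-- Iterating the nibble `s` times. -/
theorem exists_matching_of_nearRegular.{u} (m : ℕ) {θ : ℝ} (hθ0 : 0 < θ) (hθ1 : θ ≤ 1) (s : ℕ) :
    ∀ K : ℝ, 0 ≤ K → ∀ ε : ℝ, 0 < ε → ∃ η : ℝ, 0 < η ∧
      ∀ (α : Type u) [DecidableEq α] (W : Finset α) (E : Finset (Finset α)) (D N : ℝ), 0 < D →
        (#W : ℝ) ≤ N → NearRegular (m + 1) W E D K η N →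
        ∃ M ⊆ E, (∀ e ∈ M, ∀ e' ∈ M, e ≠ e' → Disjoint e e') ∧
          (#(uncovered W M) : ℝ) ≤ (2 * (m + 1) * θ + Real.exp (-θ) ^ s) * #W + ε * N := by
  induction s with
  | zero =>
    intro K _ ε hε
    refine ⟨1, one_pos, fun α _ W E D N _ hN _ => ⟨∅, empty_subset _, by simp, ?_⟩⟩
    have hN0 : 0 ≤ N := le_trans (Nat.cast_nonneg _) hN
    have h1 : (#(uncovered W ∅) : ℝ) ≤ #W := by exact_mod_cast card_le_card (filter_subset _ _)
    have h2 : 0 ≤ 2 * ((m : ℝ) + 1) * θ * #W := by positivity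
    have h3 : 0 ≤ ε * N := by positivity
    linarith [add_mul (2 * ((m : ℝ) + 1) * θ) (Real.exp (-θ) ^ 0) (#W : ℝ),
      show Real.exp (-θ) ^ 0 * (#W : ℝ) = #W by simp]
  | succ s ih =>
    intro K hK ε hε
    set a := Real.exp (-θ) with ha
    have ha0 : 0 < a := Real.exp_pos _
    have haθ : a ≤ 1 - θ / 2 := exp_neg_le_one_sub_half hθ0.le hθ1
    obtain ⟨η₁, hη₁, ih⟩ := ih (K / a ^ m) (by positivity) (ε / 2) (by positivity)
    set b := 2 * ((m : ℝ) + 1) * θ + a ^ s with hb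
    have hb0 : 0 ≤ b := by positivity
    set B₀ := ((m + 1) * θ ^ 2 + b * a + 1) / η₁ ^ 2 with hB₀
    have hB₀0 : 0 < B₀ := by positivity
    have hc0 : 0 ≤ deviationConst m K := by rw [deviationConst]; positivity
    set G := (m + 1) * θ ^ 2 * (K + 1) + b + B₀ / (a ^ m) ^ 2 * deviationConst m K + 1 with hG
    have hG0 : 0 < G := by positivity
    set η := min (min 1 (η₁ * a ^ m)) (min 1 (ε / 2) / G) with hη
    have hη0 : 0 < η := by positivity
    refine ⟨η, hη0, fun α _ W E D N hD hN h => ?_⟩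
    have hN0 : 0 ≤ N := le_trans (Nat.cast_nonneg _) hN
    have hη1 : η ≤ 1 := (min_le_left _ _).trans (min_le_left _ _)
    have hηη₁ : η ≤ η₁ * a ^ m := (min_le_left _ _).trans (min_le_right _ _)
    have hηG : η * G ≤ min 1 (ε / 2) := (le_div_iff₀ hG0).mp (min_le_right _ _)
    have hηG1 := hηG.trans (min_le_left _ _)
    have hηG2 := hηG.trans (min_le_right _ _)
    set T := a ^ m * D with hT
    have hT0 : 0 < T := by positivity
    obtain ⟨C, hC, hCle⟩ := h.exists_nibble hD hK hη0 hη1 hN hθ0 hθ1 hb0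
      (show 0 ≤ B₀ / T ^ 2 by positivity)
    rw [← ha, ← hT] at hCle
    set W' := uncovered W C with hW'
    set Z := ∑ v ∈ W', ((degree {e ∈ E | e ⊆ W'} v : ℝ) - T) ^ 2 with hZ
    have hZ0 : 0 ≤ Z := sum_nonneg fun _ _ => sq_nonneg _
    have herr : η * ((m + 1) * θ ^ 2 * (K + 1) + b + B₀ / T ^ 2 * D ^ 2 * deviationConst m K) ≤
        η * G := by
      have : B₀ / T ^ 2 * D ^ 2 = B₀ / (a ^ m) ^ 2 := by
        rw [hT]
        field_simp
      rw [this]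
      gcongr
      linarith
    have herrN := mul_le_mul_of_nonneg_right herr hN0
    have hconf : 0 ≤ ((m : ℝ) + 1) * conflicts E C :=
      mul_nonneg (by positivity) (conflicts_nonneg E C)
    have hbW' : 0 ≤ b * (#W' : ℝ) := by positivity
    have hBZ : 0 ≤ B₀ / T ^ 2 * Z := by positivity
    have hdev : Z ≤ η₁ ^ 2 * T ^ 2 * N := by
      have h1 : ((m + 1) * θ ^ 2 + b * a) * #W ≤ ((m + 1) * θ ^ 2 + b * a) * N := by gcongr
      have h2 : η * G * N ≤ 1 * N := by gcongr
      have h3 : B₀ / T ^ 2 * Z ≤ ((m + 1) * θ ^ 2 + b * a + 1) * N := by linarith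
      have h4 : B₀ / T ^ 2 * (η₁ ^ 2 * T ^ 2 * N) = ((m + 1) * θ ^ 2 + b * a + 1) * N := by
        rw [hB₀]
        field_simp
      rw [← h4] at h3
      exact le_of_mul_le_mul_left h3 (by positivity)
    have hcount : (m + 1) * conflicts E C + b * #W' ≤
        ((m + 1) * θ ^ 2 + b * a) * #W + ε / 2 * N := by
      have h2 : η * G * N ≤ ε / 2 * N := by gcongr
      linarith
    have hreg : NearRegular (m + 1) W' {e ∈ E | e ⊆ W'} T (K / a ^ m) η₁ N := by
      refine h.restrict (filter_subset _ _) hT0 (le_of_eq ?_) ?_ hdev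
      · rw [hT]
        field_simp
      · rw [hT, ← mul_assoc]
        gcongr
    have hW'W : (#W' : ℝ) ≤ #W := by exact_mod_cast card_le_card (filter_subset _ _)
    obtain ⟨M, hM, hMd, hMle⟩ := ih α W' {e ∈ E | e ⊆ W'} T N hT0 (hW'W.trans hN) hreg
    have hcross : ∀ e ∈ isolated C, ∀ e' ∈ M, Disjoint e e' := fun e he e' he' =>
      disjoint_left.mpr fun v hv hv' =>
        (mem_filter.mp ((mem_filter.mp (hM he')).2 hv')).2 e (mem_filter.mp he).1 hv
    refine ⟨isolated C ∪ M, union_subset ((filter_subset _ _).trans hC)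
      (hM.trans (filter_subset _ _)), ?_, ?_⟩
    · intro e he e' he' hne
      rcases mem_union.mp he with he | he <;> rcases mem_union.mp he' with he' | he'
      · exact (mem_filter.mp he).2 e' (mem_filter.mp he').1 hne.symm
      · exact hcross e he e' he'
      · exact (hcross e' he' e he).symm
      · exact hMd e he e' he' hne
    · have h1 : (#(uncovered W (isolated C ∪ M)) : ℝ) ≤
          #(uncovered W (isolated C) \ uncovered W C) + #(uncovered W' M) := by
        exact_mod_cast (card_le_card (uncovered_union_subset W C M)).trans (card_union_le _ _)
      have h2 := card_wasted_le (W := W) h.card_eq hC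
      push_cast at h2
      have h3 : ((m + 1) * θ ^ 2 + b * a) * (#W : ℝ) ≤
          (2 * (m + 1) * θ + a ^ (s + 1)) * #W := by
        refine mul_le_mul_of_nonneg_right ?_ (Nat.cast_nonneg _)
        have h4 : (m + 1) * θ ^ 2 + b * a =
            2 * (m + 1) * θ + a ^ (s + 1) - (m + 1) * θ * (2 * (1 - a) - θ) := by
          rw [hb, pow_succ]
          ring
        rw [h4]
        exact sub_le_self _ (mul_nonneg (by positivity) (by linarith))
      linarith

/-- **Pippenger's theorem**, for regular hypergraphs: a regular uniform hypergraph with small pair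
degrees has a matching that covers almost all vertices. -/
theorem exists_matching_of_regular.{u} (m : ℕ) {ε : ℝ} (hε : 0 < ε) :
    ∃ η : ℝ, 0 < η ∧ ∀ (α : Type u) [DecidableEq α] (W : Finset α) (E : Finset (Finset α)) (D : ℝ),
      0 < D → (∀ e ∈ E, e ⊆ W) → (∀ e ∈ E, #e = m + 1) → (∀ v ∈ W, (degree E v : ℝ) = D) →
      (∀ u ∈ W, ∀ v ∈ W, u ≠ v → (#{e ∈ E | u ∈ e ∧ v ∈ e} : ℝ) ≤ η * D) →
      ∃ M ⊆ E, (∀ e ∈ M, ∀ e' ∈ M, e ≠ e' → Disjoint e e') ∧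
        (#(uncovered W M) : ℝ) ≤ ε * #W := by
  obtain ⟨θ, hθ0, hθ1, hθε⟩ : ∃ θ : ℝ, 0 < θ ∧ θ ≤ 1 ∧ θ * (2 * (m + 1)) ≤ ε / 4 :=
    ⟨min 1 (ε / 4 / (2 * (m + 1))), by positivity, min_le_left _ _,
      (le_div_iff₀ (by positivity)).mp (min_le_right _ _)⟩
  obtain ⟨s, hs⟩ := exists_pow_lt_of_lt_one (show 0 < ε / 4 by positivity)
    (Real.exp_lt_one_iff.mpr (neg_lt_zero.mpr hθ0))
  obtain ⟨η, hη, H⟩ :=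
    exists_matching_of_nearRegular m hθ0 hθ1 s 1 zero_le_one (ε / 2) (by positivity)
  refine ⟨η, hη, fun α _ W E D hD hsub hcard hdeg hcodeg => ?_⟩
  obtain ⟨M, hM, hMd, hMle⟩ := H α W E D #W hD le_rfl
    { subset := hsub
      card_eq := hcard
      degree_le := fun v hv => by rw [hdeg v hv, one_mul]
      codegree_le := hcodeg
      deviation_le := by
        rw [sum_eq_zero fun v hv => by rw [hdeg v hv, div_self hD.ne']; ring]
        positivity }
  refine ⟨M, hM, hMd, hMle.trans ?_⟩
  rw [← add_mul]
  gcongr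
  linarith

section Designs

variable {n k t : ℕ}

theorem card_powersetCard_filter_superset {S : Finset (Fin n)} (hS : #S ≤ k) :
    #{F ∈ powersetCard k (univ : Finset (Fin n)) | S ⊆ F} = (n - #S).choose (k - #S) := by
  rw [card_filter_powersetCard_subset S univ k (subset_univ S) hS, card_univ, Fintype.card_fin]

/-- The hypergraph whose vertices are the `t`-subsets and whose edges are the families of all
`t`-subsets of a `k`-subset of `Fin n`. -/
def blockEdges (n k t : ℕ) : Finset (Finset (Finset (Fin n))) :=
  (powersetCard k univ).image (powersetCard t)

theorem powersetCard_injOn (ht : t ≠ 0) (htk : t ≤ k) :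
    Set.InjOn (powersetCard t) (powersetCard k (univ : Finset (Fin n)) : Set (Finset (Fin n))) := by
  have key : ∀ F ∈ powersetCard k (univ : Finset (Fin n)),
      (powersetCard t F).biUnion id = F := by
    intro F hF
    have hc := (mem_powersetCard.mp hF).2
    ext x
    simp only [mem_biUnion, id, mem_powersetCard]
    constructor
    · rintro ⟨A, ⟨hA, -⟩, hx⟩
      exact hA hx
    · intro hx
      obtain ⟨A, hxA, hAF, hA⟩ := exists_subsuperset_card_eq (singleton_subset_iff.mpr hx)
        (show #{x} ≤ t by rw [card_singleton]; omega) (hc ▸ htk)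
      exact ⟨A, ⟨hAF, hA⟩, singleton_subset_iff.mp hxA⟩
  intro F hF F' hF' heq
  rw [← key F hF, ← key F' hF']
  exact congrArg (fun s => s.biUnion id) heq

theorem card_blockEdges_filter (ht : t ≠ 0) (htk : t ≤ k) (P : Finset (Finset (Fin n)) → Prop)
    [DecidablePred P] :
    #{e ∈ blockEdges n k t | P e} =
      #{F ∈ powersetCard k (univ : Finset (Fin n)) | P (powersetCard t F)} := by
  rw [blockEdges, filter_image, card_image_of_injOn]
  exact (powersetCard_injOn ht htk).mono fun F hF => (mem_filter.mp hF).1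

theorem degree_blockEdges (ht : t ≠ 0) (htk : t ≤ k) {A : Finset (Fin n)} (hA : #A = t) :
    degree (blockEdges n k t) A = (n - t).choose (k - t) := by
  rw [degree, card_blockEdges_filter ht htk, ← hA, ← card_powersetCard_filter_superset (hA ▸ htk)]
  simp [mem_powersetCard]

theorem codegree_blockEdges_le (ht : t ≠ 0) (htk : t < k) {A B : Finset (Fin n)} (hA : #A = t)
    (hB : #B = t) (hAB : A ≠ B) :
    #{e ∈ blockEdges n k t | A ∈ e ∧ B ∈ e} ≤ (n - (t + 1)).choose (k - (t + 1)) := by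
  obtain ⟨b, hb, hbA⟩ : ∃ b ∈ B, b ∉ A := by
    by_contra! h
    exact hAB (eq_of_subset_of_card_le h (by rw [hA, hB])).symm
  have hc : #(insert b A) = t + 1 := by rw [card_insert_of_notMem hbA, hA]
  rw [card_blockEdges_filter ht htk.le, ← hc, ← card_powersetCard_filter_superset (by omega)]
  refine card_le_card (monotone_filter_right _ fun F _ hF => ?_)
  exact insert_subset ((mem_powersetCard.mp hF.2).1 hb) (mem_powersetCard.mp hF.1).1

end Designs

end RodlNibble

open RodlNibble

/-- (Rödl) For all integers `k > t ≥ 2` and every `ε > 0`, for all sufficiently large `n` there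
is a partial Steiner system with parameters `t, k, n` covering all but at most `ε · n^t` of the
`t`-element subsets. -/
theorem rodl_partial_steiner :
    ∀ k t : ℕ, t < k → 2 ≤ t → ∀ ε : ℝ, 0 < ε →
      ∃ n₀ : ℕ, ∀ n : ℕ, n₀ ≤ n →
        ∃ 𝓕 : Finset (Finset (Fin n)),
          (∀ F ∈ 𝓕, F.card = k) ∧
          (∀ A : Finset (Fin n), A.card = t → (𝓕.filter fun F => A ⊆ F).card ≤ 1) ∧
          ((((Finset.powersetCard t (Finset.univ : Finset (Fin n))).filter
              fun A => ∀ F ∈ 𝓕, ¬ A ⊆ F).card : ℝ)) ≤ ε * (n : ℝ) ^ t := by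
  intro k t htk ht ε hε
  have ht0 : t ≠ 0 := by omega
  obtain ⟨m, hm⟩ : ∃ m, k.choose t = m + 1 :=
    Nat.exists_eq_succ_of_ne_zero (Nat.choose_pos htk.le).ne'
  obtain ⟨η, hη, H⟩ := exists_matching_of_regular m hε
  refine ⟨k + t + ⌈k / η⌉₊, fun n hn => ?_⟩
  have hDpos : 0 < (n - t).choose (k - t) := Nat.choose_pos (by omega)
  have hratio : (((n - (t + 1)).choose (k - (t + 1)) : ℕ) : ℝ) ≤
      η * ((n - t).choose (k - t) : ℕ) := by
    have h1 := Nat.add_one_mul_choose_eq (n - (t + 1)) (k - (t + 1))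
    rw [show n - (t + 1) + 1 = n - t by omega, show k - (t + 1) + 1 = k - t by omega] at h1
    have h2 : (k : ℝ) ≤ η * (n - t : ℕ) := by
      rw [mul_comm, ← div_le_iff₀ hη]
      exact (Nat.le_ceil _).trans (by exact_mod_cast (by omega : ⌈(k : ℝ) / η⌉₊ ≤ n - t))
    have h3 : ((k - t : ℕ) : ℝ) ≤ k := by exact_mod_cast Nat.sub_le k t
    have hnt : (0 : ℝ) < (n - t : ℕ) := by exact_mod_cast (by omega : 0 < n - t)
    have h4 : ((n - t : ℕ) : ℝ) * ((n - (t + 1)).choose (k - (t + 1)) : ℕ) =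
        ((n - t).choose (k - t) : ℕ) * (k - t : ℕ) := by exact_mod_cast h1
    refine le_of_mul_le_mul_left ?_ hnt
    calc _ = (((n - t).choose (k - t) : ℕ) : ℝ) * (k - t : ℕ) := h4
      _ ≤ (((n - t).choose (k - t) : ℕ) : ℝ) * (η * (n - t : ℕ)) := by gcongr; exact h3.trans h2
      _ = _ := by ring
  obtain ⟨M, hM, hMd, hMle⟩ := H (Finset (Fin n)) (powersetCard t univ) (blockEdges n k t)
    ((n - t).choose (k - t) : ℕ) (by exact_mod_cast hDpos)
    (fun e he => by
      obtain ⟨F, -, rfl⟩ := mem_image.mp he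
      exact powersetCard_mono (subset_univ F))
    (fun e he => by
      obtain ⟨F, hF, rfl⟩ := mem_image.mp he
      rw [card_powersetCard, (mem_powersetCard.mp hF).2, hm])
    (fun A hA => by rw [degree_blockEdges ht0 htk.le (mem_powersetCard.mp hA).2])
    (fun A hA B hB hAB => le_trans (by
      exact_mod_cast codegree_blockEdges_le ht0 htk (mem_powersetCard.mp hA).2
        (mem_powersetCard.mp hB).2 hAB) hratio)
  refine ⟨{F ∈ powersetCard k (univ : Finset (Fin n)) | powersetCard t F ∈ M},
    fun F hF => (mem_powersetCard.mp (mem_filter.mp hF).1).2, fun A hA => ?_, ?_⟩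
  · refine card_le_one.mpr fun F hF F' hF' => ?_
    obtain ⟨hF, hAF⟩ := mem_filter.mp hF
    obtain ⟨hF', hAF'⟩ := mem_filter.mp hF'
    obtain ⟨hF, hFM⟩ := mem_filter.mp hF
    obtain ⟨hF', hFM'⟩ := mem_filter.mp hF'
    refine powersetCard_injOn ht0 htk.le hF hF' ?_
    by_contra hne
    exact disjoint_left.mp (hMd _ hFM _ hFM' hne) (mem_powersetCard.mpr ⟨hAF, hA⟩)
      (mem_powersetCard.mpr ⟨hAF', hA⟩)
  · have hle : (#(powersetCard t (univ : Finset (Fin n))) : ℝ) ≤ (n : ℝ) ^ t := by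
      rw [card_powersetCard, card_univ, Fintype.card_fin]
      exact_mod_cast Nat.choose_le_pow n t
    refine le_trans (Nat.cast_le.mpr (card_le_card fun A hA => ?_)) (hMle.trans (by gcongr))
    obtain ⟨hA, h⟩ := mem_filter.mp hA
    refine mem_uncovered.mpr ⟨hA, fun e he hAe => ?_⟩
    obtain ⟨F, hF, rfl⟩ := mem_image.mp (hM he)
    exact h F (mem_filter.mpr ⟨hF, he⟩) (mem_powersetCard.mp hAe).1
end

section
/- For all integers k and t with k > t ≥ 2 and every real ε > 0 there exists n₀ such that for every n ≥ n₀ there is a family 𝓕 of k-element subsets of an n-element set X such that every t-element subset of X is contained in at least one member of 𝓕 and |𝓕| ≤ (1 + ε) · C(n,t)/C(k,t), where C(a,b) denotes the binomial coefficient. -/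
open Finset

section Nodes

open Polynomial

variable {K L : Type*} [Field K] [Field L] [Algebra K L] {N : ℕ} {θ : L}

lemma node_sub_node_ne_zero (hθ : ∀ G : K[X], G.degree < (2 ^ N : ℕ) → aeval θ G = 0 → G = 0)
    {i j : Fin N} (hij : j < i) : θ ^ 2 ^ (j : ℕ) - θ ^ 2 ^ (i : ℕ) ≠ 0 := by
  intro h
  have hlt : 2 ^ (j : ℕ) < 2 ^ (i : ℕ) := Nat.pow_lt_pow_right (by norm_num) hij
  have hd : (X ^ 2 ^ (j : ℕ) - X ^ 2 ^ (i : ℕ) : K[X]).degree = (2 ^ (i : ℕ) : ℕ) := by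
    rw [degree_sub_eq_right_of_degree_lt] <;> simp only [degree_X_pow]
    exact_mod_cast hlt
  have h0 := hθ (X ^ 2 ^ (j : ℕ) - X ^ 2 ^ (i : ℕ)) (by
    rw [hd]
    exact_mod_cast Nat.pow_lt_pow_right (by norm_num) i.2) (by simpa using h)
  rw [h0, degree_zero] at hd
  exact WithBot.natCast_ne_bot _ hd.symm

lemma linearIndependent_prod_inv_node_sub
    (hθ : ∀ G : K[X], G.degree < (2 ^ N : ℕ) → aeval θ G = 0 → G = 0) (j : Fin N) :
    LinearIndependent K (fun U : {U : Finset (Fin N) // U ⊆ Ioi j} ↦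
      ∏ i ∈ U.1, (θ ^ 2 ^ (j : ℕ) - θ ^ 2 ^ (i : ℕ))⁻¹) := by
  set d : Fin N → K[X] := fun i ↦ X ^ 2 ^ (j : ℕ) - X ^ 2 ^ (i : ℕ)
  have hd : ∀ i, j < i → (d i).degree = (2 ^ (i : ℕ) : ℕ) := by
    intro i hij
    have hlt : 2 ^ (j : ℕ) < 2 ^ (i : ℕ) := Nat.pow_lt_pow_right (by norm_num) hij
    simp only [d]
    rw [degree_sub_eq_right_of_degree_lt] <;> simp only [degree_X_pow]
    exact_mod_cast hlt
  have hdQ : ∀ U : Finset (Fin N), U ⊆ Ioi j →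
      (∏ i ∈ U, d i).degree = ((∑ i ∈ U.map Fin.valEmbedding, 2 ^ i : ℕ) : WithBot ℕ) := by
    intro U hU
    rw [degree_prod, Finset.sum_congr rfl fun i hi ↦ hd i (mem_Ioi.1 (hU hi))]
    simp
  apply LinearIndependent.of_comp
    (LinearMap.mulLeft K (∏ i ∈ Ioi j, (θ ^ 2 ^ (j : ℕ) - θ ^ 2 ^ (i : ℕ))))
  have hcomp : (LinearMap.mulLeft K (∏ i ∈ Ioi j, (θ ^ 2 ^ (j : ℕ) - θ ^ 2 ^ (i : ℕ)))) ∘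
      (fun U : {U : Finset (Fin N) // U ⊆ Ioi j} ↦
        ∏ i ∈ U.1, (θ ^ 2 ^ (j : ℕ) - θ ^ 2 ^ (i : ℕ))⁻¹) =
      fun U ↦ aeval θ (∏ i ∈ Ioi j \ U.1, d i) := by
    funext U
    have hne : ∏ i ∈ U.1, (θ ^ 2 ^ (j : ℕ) - θ ^ 2 ^ (i : ℕ)) ≠ 0 :=
      prod_ne_zero_iff.2 fun i hi ↦ node_sub_node_ne_zero hθ (mem_Ioi.1 (U.2 hi))
    simp only [Function.comp_apply, LinearMap.mulLeft_apply, map_prod, d, map_sub, map_pow,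
      aeval_X, prod_inv_distrib]
    rw [← prod_sdiff U.2, mul_assoc, mul_inv_cancel₀ hne, mul_one]
  rw [hcomp, Fintype.linearIndependent_iff]
  intro g hg
  set G : K[X] := ∑ U : {U : Finset (Fin N) // U ⊆ Ioi j}, g U • ∏ i ∈ Ioi j \ U.1, d i
  have hQ0 : ∀ U : Finset (Fin N), ∏ i ∈ Ioi j \ U, d i ≠ 0 := fun U h0 ↦ by
    have := hdQ _ (sdiff_subset (s := Ioi j) (t := U))
    rw [h0, degree_zero] at this
    exact WithBot.natCast_ne_bot _ this.symm
  have hG : G = 0 := by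
    apply hθ
    · refine (degree_sum_le _ _).trans_lt ((Finset.sup_lt_iff (WithBot.bot_lt_coe _)).2 ?_)
      intro U _
      refine (degree_smul_le _ _).trans_lt ?_
      rw [hdQ _ sdiff_subset]
      refine Nat.cast_lt.2 ((Nat.geomSum_lt le_rfl fun i hi ↦ ?_))
      obtain ⟨a, _, rfl⟩ := mem_map.1 hi
      exact a.2
    · simpa [G, map_sum] using hg
  intro U
  by_contra hU
  have hsup := degree_sum_eq_of_disjoint
    (fun U : {U : Finset (Fin N) // U ⊆ Ioi j} ↦ g U • ∏ i ∈ Ioi j \ U.1, d i) univ (by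
      rintro V ⟨-, hV⟩ W ⟨-, hW⟩ hVW heq
      apply hVW
      simp only [Function.comp_apply] at heq
      have hgV : g V ≠ 0 := fun h ↦ hV (by simp [h])
      have hgW : g W ≠ 0 := fun h ↦ hW (by simp [h])
      rw [degree_smul_of_smul_regular _ (IsSMulRegular.of_ne_zero hgV),
        degree_smul_of_smul_regular _ (IsSMulRegular.of_ne_zero hgW),
        hdQ _ sdiff_subset, hdQ _ sdiff_subset, Nat.cast_inj] at heq
      have := Finset.map_injective _ (Finset.geomSum_injective le_rfl heq)
      rw [Subtype.ext_iff, ← Finset.sdiff_sdiff_eq_self V.2, this,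
        Finset.sdiff_sdiff_eq_self W.2])
  rw [show (∑ U : {U : Finset (Fin N) // U ⊆ Ioi j}, g U • ∏ i ∈ Ioi j \ U.1, d i) = 0 from hG,
    degree_zero] at hsup
  have := (Finset.le_sup (f := fun U : {U : Finset (Fin N) // U ⊆ Ioi j} ↦
    (g U • ∏ i ∈ Ioi j \ U.1, d i).degree) (mem_univ U)).trans hsup.ge
  rw [le_bot_iff, degree_eq_bot, smul_eq_zero] at this
  exact this.elim hU (hQ0 _)

lemma exists_trace_mul_eq [FiniteDimensional K L] [Algebra.IsSeparable K L] {ι : Type*}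
    {v : ι → L} (hv : LinearIndependent K v) (g : ι → K) :
    ∃ y : L, ∀ i, Algebra.trace K L (y * v i) = g i := by
  obtain ⟨φ, hφ⟩ : ∃ φ : L →ₗ[K] K, ∀ i, φ (v i) = g i := by
    obtain ⟨φ, hφ⟩ := (((Module.Basis.span hv).constr K) g).exists_extend
    refine ⟨φ, fun i ↦ ?_⟩
    have h := LinearMap.congr_fun hφ (Module.Basis.span hv i)
    rw [Module.Basis.constr_basis] at h
    simpa [Module.Basis.span_apply] using h
  refine ⟨((Algebra.traceForm K L).toDual (traceForm_nondegenerate K L)).symm φ, fun i ↦ ?_⟩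
  rw [← hφ i]
  exact LinearMap.BilinForm.apply_toDual_symm_apply (hB := traceForm_nondegenerate K L) φ (v i)

/-- The shift vector `b` can be chosen so that the divided differences of `b` over all `t`-sets of
nodes have prescribed traces. -/
lemma exists_shift_trace_dividedDifference [FiniteDimensional K L] [Algebra.IsSeparable K L]
    (hθ : ∀ G : K[X], G.degree < (2 ^ N : ℕ) → aeval θ G = 0 → G = 0) {t : ℕ} (ht : 0 < t)
    (h : Finset (Fin N) → K) :
    ∃ b : Fin N → L, ∀ T : Finset (Fin N), T.card = t →
      Algebra.trace K L (∑ j ∈ T, b j / ∏ i ∈ T.erase j, (θ ^ 2 ^ (j : ℕ) - θ ^ 2 ^ (i : ℕ)))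
        = h T := by
  suffices H : ∀ m ≤ N, ∃ b : Fin N → L, ∀ T : Finset (Fin N), T.card = t →
      (∀ i ∈ T, m ≤ (i : ℕ)) →
      Algebra.trace K L (∑ j ∈ T, b j / ∏ i ∈ T.erase j, (θ ^ 2 ^ (j : ℕ) - θ ^ 2 ^ (i : ℕ)))
        = h T by
    obtain ⟨b, hb⟩ := H 0 (Nat.zero_le _)
    exact ⟨b, fun T hT ↦ hb T hT fun _ _ ↦ Nat.zero_le _⟩
  intro m hm
  induction hm using Nat.decreasingInduction with
  | self =>
    refine ⟨0, fun T hT hN ↦ ?_⟩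
    obtain ⟨i, hi⟩ := Finset.card_pos.1 (hT ▸ ht)
    exact absurd (hN i hi) (not_le.2 i.2)
  | @of_succ m hm ih =>
    obtain ⟨b, hb⟩ := ih
    set j : Fin N := ⟨m, hm⟩
    obtain ⟨y, hy⟩ := exists_trace_mul_eq (linearIndependent_prod_inv_node_sub hθ j) fun U ↦
      h (insert j U.1) - Algebra.trace K L (∑ l ∈ U.1, b l /
        ∏ i ∈ (insert j U.1).erase l, (θ ^ 2 ^ (l : ℕ) - θ ^ 2 ^ (i : ℕ)))
    refine ⟨Function.update b j y, fun T hT hmT ↦ ?_⟩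
    by_cases hj : j ∈ T
    · have hU : T.erase j ⊆ Ioi j := by
        intro i hi
        rw [mem_Ioi, lt_iff_le_and_ne]
        exact ⟨hmT i (mem_of_mem_erase hi), (ne_of_mem_erase hi).symm⟩
      have hyT := hy ⟨T.erase j, hU⟩
      simp only [insert_erase hj] at hyT
      have hsum : ∑ l ∈ T.erase j, Function.update b j y l /
            ∏ i ∈ T.erase l, (θ ^ 2 ^ (l : ℕ) - θ ^ 2 ^ (i : ℕ)) =
          ∑ l ∈ T.erase j, b l / ∏ i ∈ T.erase l, (θ ^ 2 ^ (l : ℕ) - θ ^ 2 ^ (i : ℕ)) :=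
        sum_congr rfl fun l hl ↦ by rw [Function.update_of_ne (ne_of_mem_erase hl)]
      rw [← add_sum_erase _ _ hj, map_add, Function.update_self, div_eq_mul_inv,
        ← prod_inv_distrib, hyT, hsum, sub_add_cancel]
    · have hsum : ∑ l ∈ T, Function.update b j y l /
            ∏ i ∈ T.erase l, (θ ^ 2 ^ (l : ℕ) - θ ^ 2 ^ (i : ℕ)) =
          ∑ l ∈ T, b l / ∏ i ∈ T.erase l, (θ ^ 2 ^ (l : ℕ) - θ ^ 2 ^ (i : ℕ)) :=
        sum_congr rfl fun l hl ↦ by rw [Function.update_of_ne (ne_of_mem_of_not_mem hl hj)]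
      rw [hsum]
      refine hb T hT fun i hi ↦ Nat.lt_of_le_of_ne (hmT i hi) fun h ↦ hj ?_
      rwa [show j = i from Fin.ext h]

end Nodes

section Codes

open Polynomial

lemma exists_finite_field_generic_element (p : ℕ) [Fact p.Prime] {s : ℕ} (hs : s ≠ 0) :
    ∃ (F : Type) (_ : Field F) (_ : Fintype F) (_ : Algebra (ZMod p) F) (θ : F),
      ∀ G : (ZMod p)[X], G.degree < s → aeval θ G = 0 → G = 0 := by
  obtain ⟨θ, hθ⟩ := Field.exists_primitive_element (ZMod p) (GaloisField p s)
  rw [Field.primitive_element_iff_minpoly_degree_eq, GaloisField.finrank p hs] at hθ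
  refine ⟨GaloisField p s, inferInstance, Fintype.ofFinite _, inferInstance, θ, fun G hG h0 ↦ ?_⟩
  by_contra hne
  exact absurd (minpoly.degree_le_of_ne_zero (ZMod p) θ hne h0) (not_le.2 (hθ ▸ hG))

lemma mul_card_filter_val_lt {G : Type*} [AddGroup G] [Fintype G] {p : ℕ} [NeZero p]
    (f : G →+ ZMod p) (hf : Function.Surjective f) {w : ℕ} (hw : w ≤ p) :
    p * #{g | (f g).val < w} = w * Fintype.card G := by
  have key : ∀ u ≤ p, #{g | (f g).val < u} = u * #{g | f g = 0} := by
    intro u hu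
    rw [card_eq_sum_card_fiberwise (f := fun g ↦ (f g).val) (t := range u)
      (fun g hg ↦ by simpa using hg), sum_const_nat (m := #{g | f g = 0}), card_range]
    intro v hv
    have hvu := mem_range.1 hv
    rw [AddMonoidHom.card_fiber_eq_of_mem_range f (hf 0) (hf (v : ZMod p))]
    congr 1
    ext g
    simp only [mem_filter, mem_univ, true_and]
    constructor
    · rintro ⟨-, rfl⟩
      simp
    · intro hg
      rw [hg, ZMod.val_natCast_of_lt (hvu.trans_le hu)]
      exact ⟨hvu, rfl⟩
  have hall : Fintype.card G = p * #{g | f g = 0} := by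
    rw [← key p le_rfl, ← card_univ, filter_true_of_mem fun g _ ↦ ZMod.val_lt _]
  rw [key w hw, hall]
  ring

lemma exists_sum_mul_pow_eq {R : Type*} [CommRing R] {N t : ℕ} {x : Fin N → R}
    (hx : ∀ i j, i < j → IsUnit (x j - x i)) {T : Finset (Fin N)} (hT : #T = t) (a : Fin N → R) :
    ∃ c : Fin t → R, ∀ j ∈ T, ∑ i, c i * x j ^ (i : ℕ) = a j := by
  have hdet : IsUnit (Matrix.vandermonde fun r ↦ x (T.orderEmbOfFin hT r)) := by
    rw [Matrix.isUnit_iff_isUnit_det, Matrix.det_vandermonde]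
    simp only [IsUnit.prod_iff, mem_univ, mem_Ioi, true_imp_iff]
    exact fun i j hij ↦ hx _ _ ((T.orderEmbOfFin hT).strictMono hij)
  obtain ⟨c, hc⟩ := Matrix.mulVec_surjective_iff_isUnit.2 hdet fun r ↦ a (T.orderEmbOfFin hT r)
  refine ⟨c, fun j hj ↦ ?_⟩
  obtain ⟨r, rfl⟩ : j ∈ Set.range (T.orderEmbOfFin hT) := by simpa using hj
  rw [← congrFun hc r]
  simp [Matrix.mulVec, dotProduct, Matrix.vandermonde_apply, mul_comm]

lemma ZMod.isUnit_natCast_sub_natCast {m N i j : ℕ} (hm : m.Coprime N.factorial) (hij : i < j)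
    (hj : j ≤ N) : IsUnit ((j : ZMod m) - (i : ZMod m)) := by
  rw [← Nat.cast_sub hij.le, ZMod.isUnit_iff_coprime]
  exact (hm.coprime_dvd_right (Nat.dvd_factorial (by lia) (by lia))).symm

/-- There are labellings `ℓ T` of `T`-words over an alphabet of size `q * m` such that,
for every shift `h` of the labels, a small code contains an extension of every
`T`-word with shifted label below `w`, simultaneously for all `t`-sets `T` of coordinates. -/
lemma exists_labelled_code (p : ℕ) [Fact p.Prime] (N : ℕ) {t : ℕ} (ht : 0 < t) :
    ∃ q, 0 < q ∧ ∀ m, 0 < m → m.Coprime N.factorial →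
      ∃ ℓ : Finset (Fin N) → (Fin N → Fin (q * m)) → ZMod p,
        ∀ h : Finset (Fin N) → ZMod p, ∀ w ≤ p,
          ∃ W : Finset (Fin N → Fin (q * m)), p * #W ≤ w * (q * m) ^ t ∧
            ∀ T : Finset (Fin N), #T = t → ∀ a, (ℓ T a - h T).val < w →
              ∃ c ∈ W, ∀ j ∈ T, c j = a j := by
  obtain ⟨F, _, _, _, θ, hθ⟩ := exists_finite_field_generic_element p (s := 2 ^ N) (by positivity)
  refine ⟨Fintype.card F, Fintype.card_pos, fun m hm hmN ↦ ?_⟩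
  have : NeZero m := ⟨hm.ne'⟩
  have hcard : Fintype.card (F × ZMod m) = Fintype.card F * m := by simp [ZMod.card]
  set e : F × ZMod m ≃ Fin (Fintype.card F * m) := Fintype.equivFinOfCardEq hcard
  set x : Fin N → F := fun j ↦ θ ^ 2 ^ (j : ℕ)
  set X : Fin N → F × ZMod m := fun j ↦ (x j, ((j : ℕ) : ZMod m))
  have hx : ∀ i j, i < j → x j - x i ≠ 0 := fun i j hij ↦ by
    rw [← neg_sub, neg_ne_zero]
    exact node_sub_node_ne_zero hθ hij
  have hX : ∀ i j, i < j → IsUnit (X j - X i) := fun i j hij ↦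
    Prod.isUnit_iff.2 ⟨(hx i j hij).isUnit, ZMod.isUnit_natCast_sub_natCast hmN hij j.2.le⟩
  have hinj : Function.Injective x := by
    intro i j hij
    rcases lt_trichotomy i j with h | h | h
    · exact absurd (sub_eq_zero.2 hij.symm) (hx _ _ h)
    · exact h
    · exact absurd (sub_eq_zero.2 hij) (hx _ _ h)
  set δ : Finset (Fin N) → (Fin N → F) → F :=
    fun T a ↦ ∑ j ∈ T, a j / ∏ i ∈ T.erase j, (x j - x i)
  set f : (Fin t → F × ZMod m) →+ ZMod p :=
    (Algebra.trace (ZMod p) F).toAddMonoidHom.comp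
      ((AddMonoidHom.fst F (ZMod m)).comp (Pi.evalAddMonoidHom _ (⟨t - 1, by lia⟩ : Fin t)))
  have hf : Function.Surjective f := by
    intro v
    obtain ⟨y, hy⟩ := Algebra.trace_surjective (ZMod p) F v
    exact ⟨fun _ ↦ (y, 0), by simpa [f] using hy⟩
  refine ⟨fun T a ↦ Algebra.trace (ZMod p) F (δ T fun j ↦ (e.symm (a j)).1), fun h w hw ↦ ?_⟩
  obtain ⟨b, hb⟩ := exists_shift_trace_dividedDifference hθ ht h
  set B : Fin N → F × ZMod m := fun j ↦ (b j, 0)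
  refine ⟨({c | (f c).val < w} : Finset (Fin t → F × ZMod m)).image fun c j ↦
    e (∑ i : Fin t, c i * X j ^ (i : ℕ) + B j), ?_, fun T hT a ha ↦ ?_⟩
  · calc _ ≤ p * #{c | (f c).val < w} := Nat.mul_le_mul_left _ card_image_le
      _ = _ := by rw [mul_card_filter_val_lt f hf hw]; simp [ZMod.card]
  · obtain ⟨c, hc⟩ := exists_sum_mul_pow_eq hX hT fun j ↦ e.symm (a j) - B j
    refine ⟨_, mem_image_of_mem _ (mem_filter.2 ⟨mem_univ c, ?_⟩), fun j hj ↦ by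
      simp [hc j hj]⟩
    convert ha
    rw [← hb T hT, ← map_sub]
    change Algebra.trace (ZMod p) F (c _).1 = _
    congr 1
    set P : F[X] := ∑ i : Fin t, C (c i).1 * Polynomial.X ^ (i : ℕ)
    have hP : P.degree < #T := by
      rw [hT]
      exact degree_sum_fin_lt _
    have hcoeff : P.coeff (#T - 1) = (c ⟨t - 1, by lia⟩).1 := by
      simp only [P, finsetSum_coeff, coeff_C_mul, coeff_X_pow, hT]
      rw [Finset.sum_eq_single ⟨t - 1, by lia⟩] <;> simp [Fin.ext_iff]
      grind
    rw [← hcoeff, Lagrange.coeff_eq_sum (v := x) hinj.injOn hP, ← sum_sub_distrib]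
    refine sum_congr rfl fun j hj ↦ ?_
    rw [← sub_div]
    congr 1
    have := congrArg Prod.fst (hc j hj)
    simpa [P, eval_finsetSum, Prod.fst_sum, X, B] using this

end Codes

section Coverings

/-- If words over `Fin N` extend as in `exists_labelled_code`, then all transversal `t`-sets of the
complete `N`-partite structure with parts of size `Q` can be covered economically. -/
lemma exists_transversal_covering {p N t k Q w : ℕ} [NeZero p] (ht : 0 < t) (htk : t ≤ k)
    (hwp : w ≤ p) (hpw : p ≤ (N - t).choose (k - t) * w)
    {ℓ : Finset (Fin N) → (Fin N → Fin Q) → ZMod p}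
    (hℓ : ∀ h : Finset (Fin N) → ZMod p, ∀ w ≤ p,
      ∃ W : Finset (Fin N → Fin Q), p * #W ≤ w * Q ^ t ∧
        ∀ T : Finset (Fin N), #T = t → ∀ a, (ℓ T a - h T).val < w →
          ∃ c ∈ W, ∀ j ∈ T, c j = a j) :
    ∃ 𝓑 : Finset (Finset (Fin N × Fin Q)), (∀ B ∈ 𝓑, #B = k) ∧
      (∀ A : Finset (Fin N × Fin Q), #A = t → Set.InjOn Prod.fst (A : Set (Fin N × Fin Q)) →
        ∃ B ∈ 𝓑, A ⊆ B) ∧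
      p * #𝓑 ≤ N.choose k * (w * Q ^ t) := by
  classical
  obtain ⟨idx, hidx⟩ : ∃ idx : Finset (Fin N) → Finset (Fin N) → ℕ, ∀ T, #T = t →
      ∀ v < (N - t).choose (k - t), ∃ f, T ⊆ f ∧ #f = k ∧ idx f T = v := by
    refine ⟨fun f T ↦ if h : f \ T ∈ powersetCard (k - t) Tᶜ then
      (powersetCard (k - t) Tᶜ).equivFin ⟨_, h⟩ else 0, fun T hT v hv ↦ ?_⟩
    have hcard : #(powersetCard (k - t) Tᶜ) = (N - t).choose (k - t) := by
      rw [card_powersetCard, card_compl, Fintype.card_fin, hT]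
    obtain ⟨⟨g, hg⟩, hgv⟩ := (powersetCard (k - t) Tᶜ).equivFin.surjective ⟨v, hcard ▸ hv⟩
    have hg' := mem_powersetCard.1 hg
    have hdisj : Disjoint g T := by
      rw [← subset_compl_iff_disjoint_right]
      exact hg'.1
    have hgT : (T ∪ g) \ T = g := by
      rw [union_sdiff_left, sdiff_eq_self_of_disjoint hdisj]
    refine ⟨T ∪ g, subset_union_left, ?_, ?_⟩
    · rw [card_union_of_disjoint hdisj.symm, hT, hg'.2]
      lia
    · simp only [hgT, hg, dite_true, hgv]
  choose W hWcard hW using fun f ↦ hℓ (fun T ↦ ((w * idx f T : ℕ) : ZMod p)) w hwp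
  refine ⟨(powersetCard k univ).biUnion fun f ↦ (W f).image fun c ↦
    f.image fun j ↦ (j, c j), ?_, ?_, ?_⟩
  · simp only [mem_biUnion, mem_image, mem_powersetCard]
    rintro _ ⟨f, ⟨-, hf⟩, c, -, rfl⟩
    rw [card_image_of_injective _ fun i j h ↦ congrArg Prod.fst h, hf]
  · intro A hA hinj
    set T := A.image Prod.fst
    have hT : #T = t := by rw [card_image_of_injOn hinj, hA]
    obtain ⟨a, ha⟩ : ∃ a : Fin N → Fin Q, ∀ y ∈ A, a y.1 = y.2 := by
      obtain ⟨y₀, -⟩ := card_pos.1 (hA ▸ ht)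
      refine ⟨fun j ↦ if h : ∃ y ∈ A, y.1 = j then h.choose.2 else y₀.2, fun y hy ↦ ?_⟩
      have h : ∃ z ∈ A, z.1 = y.1 := ⟨y, hy, rfl⟩
      simp only [h, dite_true]
      rw [hinj h.choose_spec.1 hy h.choose_spec.2]
    set v := (ℓ T a).val
    have hv : v < p := ZMod.val_lt _
    have hw0 : 0 < w := Nat.pos_of_ne_zero fun h ↦ by simp [h] at hpw; lia
    obtain ⟨f, hTf, hf, hfv⟩ := hidx T hT (v / w)
      (Nat.div_lt_of_lt_mul (by rw [mul_comm]; lia))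
    have hlt : (ℓ T a - ((w * idx f T : ℕ) : ZMod p)).val < w := by
      have : ℓ T a - ((w * idx f T : ℕ) : ZMod p) = ((v % w : ℕ) : ZMod p) := by
        rw [hfv, sub_eq_iff_eq_add, ← Nat.cast_add, Nat.mod_add_div, ZMod.natCast_zmod_val]
      rw [this, ZMod.val_natCast_of_lt ((Nat.mod_le _ _).trans_lt hv)]
      exact Nat.mod_lt _ hw0
    obtain ⟨c, hcW, hc⟩ := hW f T hT a hlt
    refine ⟨f.image fun j ↦ (j, c j), mem_biUnion.2 ⟨f, by simp [hf],
      mem_image_of_mem _ hcW⟩, fun y hy ↦ ?_⟩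
    have hyT : y.1 ∈ T := mem_image_of_mem _ hy
    exact mem_image.2 ⟨y.1, hTf hyT, Prod.ext rfl (by rw [hc _ hyT, ha y hy])⟩
  · calc _ ≤ p * ∑ f ∈ powersetCard k (univ : Finset (Fin N)), #(W f) :=
        Nat.mul_le_mul_left _ (card_biUnion_le.trans (sum_le_sum fun _ _ ↦ card_image_le))
      _ = ∑ f ∈ powersetCard k (univ : Finset (Fin N)), p * #(W f) := mul_sum ..
      _ ≤ _ := by
        refine (sum_le_card_nsmul _ _ _ fun f _ ↦ hWcard f).trans ?_
        simp

open scoped Classical in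
lemma card_not_injOn_fst_le (N Q t : ℕ) :
    #((powersetCard (t + 2) univ).filter fun A : Finset (Fin N × Fin Q) ↦
      ¬ Set.InjOn Prod.fst (A : Set (Fin N × Fin Q))) ≤ N * Q ^ 2 * (N * Q) ^ t := by
  set I := (Fin N × Fin Q × Fin Q) × (Fin t → Fin N × Fin Q)
  have hI : Fintype.card I = N * Q ^ 2 * (N * Q) ^ t := by
    simp [I, sq]
  rw [← hI, ← card_univ]
  refine (card_le_card ?_).trans (card_image_le (f := fun z : I ↦
    insert (z.1.1, z.1.2.1) (insert (z.1.1, z.1.2.2) (univ.image z.2))))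
  intro A hA
  simp only [mem_filter, mem_powersetCard, subset_univ, true_and, Set.InjOn, not_forall,
    mem_coe] at hA
  obtain ⟨hA, ⟨j, r⟩, hr, ⟨j', r'⟩, hr', hj, hne⟩ := hA
  obtain rfl : j = j' := hj
  set A' := (A.erase (j, r)).erase (j, r')
  have hr'' : (j, r') ∈ A.erase (j, r) := mem_erase.2 ⟨fun h ↦ hne h.symm, hr'⟩
  have hA' : #A' = t := by
    rw [card_erase_of_mem hr'', card_erase_of_mem hr, hA]
    rfl
  refine mem_image.2 ⟨((j, r, r'), fun i ↦ (A'.equivFinOfCardEq hA').symm i), mem_univ _, ?_⟩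
  have : univ.image (fun i ↦ ((A'.equivFinOfCardEq hA').symm i : Fin N × Fin Q)) = A' := by
    ext y
    simp only [mem_image, mem_univ, true_and]
    exact ⟨fun ⟨i, hi⟩ ↦ hi ▸ Subtype.prop _, fun hy ↦
      ⟨A'.equivFinOfCardEq hA' ⟨y, hy⟩, by simp⟩⟩
  simp only [this, A', insert_erase hr'', insert_erase hr]

lemma exists_covering_of_embedding {α : Type*} {n k t : ℕ} (hkn : k ≤ n) (e : Fin n ↪ α)
    {𝓑 : Finset (Finset α)} (hk : ∀ B ∈ 𝓑, #B ≤ k)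
    (hcov : ∀ A : Finset α, #A = t → ∃ B ∈ 𝓑, A ⊆ B) :
    ∃ 𝓕 : Finset (Finset (Fin n)), (∀ F ∈ 𝓕, #F = k) ∧
      (∀ A : Finset (Fin n), #A = t → ∃ F ∈ 𝓕, A ⊆ F) ∧ #𝓕 ≤ #𝓑 := by
  classical
  have hext : ∀ B ∈ 𝓑, ∃ F : Finset (Fin n), B.preimage e e.injective.injOn ⊆ F ∧ #F = k := by
    intro B hB
    have hcard : #(B.preimage e e.injective.injOn) ≤ k := by
      refine le_trans ?_ (hk B hB)
      rw [← card_map e]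
      exact card_le_card fun y hy ↦ by
        obtain ⟨x, hx, rfl⟩ := mem_map.1 hy
        exact mem_preimage.1 hx
    obtain ⟨F, hF, -, hFk⟩ := exists_subsuperset_card_eq (subset_univ _) hcard
      (by simpa using hkn)
    exact ⟨F, hF, hFk⟩
  choose! g hg using hext
  refine ⟨𝓑.image g, fun F hF ↦ ?_, fun A hA ↦ ?_, card_image_le⟩
  · obtain ⟨B, hB, rfl⟩ := mem_image.1 hF
    exact (hg B hB).2
  · obtain ⟨B, hB, hAB⟩ := hcov (A.map e) (by rwa [card_map])
    refine ⟨g B, mem_image_of_mem _ hB, fun x hx ↦ (hg B hB).1 ?_⟩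
    exact mem_preimage.2 (hAB (mem_map_of_mem e hx))

lemma exists_add_pow_le_mul_factorial_mul_choose (t C : ℕ) {η : ℝ} (hη : 0 < η) :
    ∃ n₀ : ℕ, ∀ n ≥ n₀, ((n + C : ℕ) : ℝ) ^ t ≤ (1 + η) * (t.factorial * n.choose t) := by
  rcases t.eq_zero_or_pos with rfl | ht
  · exact ⟨0, fun n _ ↦ by simpa using hη.le⟩
  set c : ℝ := (1 + η) ^ ((t : ℝ)⁻¹)
  have hc : c ^ t = 1 + η := Real.rpow_inv_natCast_pow (by linarith) ht.ne'
  have hc1 : 1 < c := Real.one_lt_rpow (by linarith) (by positivity)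
  obtain ⟨n₀, hn₀⟩ := exists_nat_ge ((C + c * t) / (c - 1))
  refine ⟨n₀ + t, fun n hn ↦ ?_⟩
  have hn' : (C + c * t) / (c - 1) ≤ n := hn₀.trans (by exact_mod_cast (by lia : n₀ ≤ n))
  rw [div_le_iff₀ (by linarith)] at hn'
  have hdesc : ((n + 1 - t : ℕ) : ℝ) ^ t ≤ t.factorial * n.choose t := by
    exact_mod_cast (Nat.pow_sub_le_descFactorial n t).trans
      (Nat.descFactorial_eq_factorial_mul_choose n t).le
  calc ((n + C : ℕ) : ℝ) ^ t ≤ (c * (n + 1 - t : ℕ)) ^ t := by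
        gcongr
        rw [Nat.cast_sub (by lia)]
        push_cast
        nlinarith
    _ = (1 + η) * ((n + 1 - t : ℕ) : ℝ) ^ t := by rw [mul_pow, hc]
    _ ≤ _ := by gcongr

lemma covering_size_bound {N Q n k t p w : ℕ} {ε x y : ℝ} (hε : 0 < ε) (ht : 2 ≤ t) (htk : t ≤ k)
    (hkN : k ≤ N) (hp : 0 < p) (hw : w * (N - t).choose (k - t) ≤ p + (N - t).choose (k - t))
    (hpε : ((N - t).choose (k - t) : ℝ) ≤ ε / 4 * p)
    (hNε : (t.factorial * k.choose t : ℝ) ≤ ε / 4 * N)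
    (hx : p * x ≤ N.choose k * (w * (Q : ℝ) ^ t))
    (hy : y ≤ N * (Q : ℝ) ^ 2 * (N * Q) ^ (t - 2))
    (hn : ((N * Q : ℕ) : ℝ) ^ t ≤ (1 + ε / (2 + ε)) * (t.factorial * n.choose t)) :
    x + y ≤ (1 + ε) * n.choose t / k.choose t := by
  set D := (N - t).choose (k - t)
  have hD : (0 : ℝ) < D := by exact_mod_cast Nat.choose_pos (by lia)
  have hK : (0 : ℝ) < k.choose t := by exact_mod_cast Nat.choose_pos htk
  have hN : (0 : ℝ) < N := by exact_mod_cast (by lia : 0 < N)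
  have hp' : (0 : ℝ) < p := by exact_mod_cast hp
  have ht0 : (0 : ℝ) < t.factorial := by exact_mod_cast t.factorial_pos
  have hmul : (N.choose k : ℝ) * k.choose t = N.choose t * D := by
    exact_mod_cast Nat.choose_mul htk
  have hw' : (w : ℝ) * D ≤ p * (1 + ε / 4) := by
    have : (w : ℝ) * D ≤ p + D := by exact_mod_cast hw
    linarith
  set M : ℝ := ((N * Q : ℕ) : ℝ) ^ t
  have hchoose : (N.choose t : ℝ) * Q ^ t * t.factorial ≤ M := by
    have : (N.choose t : ℝ) ≤ N ^ t / t.factorial := Nat.choose_le_pow_div t N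
    rw [le_div_iff₀ ht0] at this
    calc (N.choose t : ℝ) * Q ^ t * t.factorial = N.choose t * t.factorial * Q ^ t := by ring
      _ ≤ N ^ t * Q ^ t := by gcongr
      _ = M := by simp only [M]; push_cast; ring
  have hx' : x * (t.factorial * k.choose t) ≤ M * (1 + ε / 4) := by
    have h1 : (p * D) * (x * (t.factorial * k.choose t)) ≤ (p * D) * (M * (1 + ε / 4)) :=
      calc (p * D) * (x * (t.factorial * k.choose t))
          = p * x * (D * t.factorial * k.choose t) := by ring
        _ ≤ N.choose k * (w * (Q : ℝ) ^ t) * (D * t.factorial * k.choose t) := by gcongr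
        _ = (N.choose k * k.choose t) * (w * D) * (Q ^ t * t.factorial) := by ring
        _ = D * (N.choose t * Q ^ t * t.factorial) * (w * D) := by rw [hmul]; ring
        _ ≤ D * M * (p * (1 + ε / 4)) := by gcongr
        _ = _ := by ring
    exact le_of_mul_le_mul_left h1 (by positivity)
  have hy' : y * (t.factorial * k.choose t) ≤ M * (ε / 4) := by
    obtain ⟨s, rfl⟩ := Nat.exists_eq_add_of_le' ht
    calc y * ((s + 2).factorial * k.choose (s + 2))
        ≤ (N * (Q : ℝ) ^ 2 * (N * Q) ^ (s + 2 - 2)) * (ε / 4 * N) := by gcongr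
      _ = M * (ε / 4) := by simp only [M, Nat.add_sub_cancel]; push_cast; ring
  rw [le_div_iff₀ hK]
  refine le_of_mul_le_mul_right (a := (t.factorial : ℝ)) ?_ ht0
  calc (x + y) * k.choose t * t.factorial ≤ M * (1 + ε / 2) := by linarith
    _ ≤ (1 + ε / (2 + ε)) * (t.factorial * n.choose t) * (1 + ε / 2) := by gcongr
    _ = (1 + ε) * n.choose t * t.factorial := by field_simp; ring

end Coverings

/-- For all integers `k > t ≥ 2` and every `ε > 0`, for all sufficiently large `n` there is a
covering design with parameters `t, k, n` having at most `(1+ε) · C(n,t)/C(k,t)` edges. -/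
theorem covering_design_exists :
    ∀ k t : ℕ, t < k → 2 ≤ t → ∀ ε : ℝ, 0 < ε →
      ∃ n₀ : ℕ, ∀ n : ℕ, n₀ ≤ n →
        ∃ 𝓕 : Finset (Finset (Fin n)),
          (∀ F ∈ 𝓕, F.card = k) ∧
          (∀ A : Finset (Fin n), A.card = t → ∃ F ∈ 𝓕, A ⊆ F) ∧
          (𝓕.card : ℝ) ≤ (1 + ε) * (n.choose t : ℝ) / (k.choose t : ℝ) := by
  classical
  intro k t htk ht ε hε
  obtain ⟨N₀, hN₀⟩ := exists_nat_ge ((t.factorial * k.choose t : ℝ) / (ε / 4))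
  set N := N₀ + k
  have hNε : (t.factorial * k.choose t : ℝ) ≤ ε / 4 * N := by
    rw [div_le_iff₀ (by positivity)] at hN₀
    simp only [N]
    push_cast
    nlinarith [(Nat.cast_nonneg k : (0 : ℝ) ≤ k)]
  set D := (N - t).choose (k - t)
  have hD : 0 < D := Nat.choose_pos (by lia)
  obtain ⟨p₀, hp₀⟩ := exists_nat_ge ((D : ℝ) / (ε / 4))
  obtain ⟨p, hp₀p, hp⟩ := Nat.exists_infinite_primes p₀
  have : Fact p.Prime := ⟨hp⟩
  have hpε : (D : ℝ) ≤ ε / 4 * p := by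
    rw [div_le_iff₀ (by positivity)] at hp₀
    have : (p₀ : ℝ) ≤ p := by exact_mod_cast hp₀p
    nlinarith
  set w := (p + D - 1) / D
  have hwD : w * D ≤ p + D := (Nat.div_mul_le_self _ _).trans (Nat.sub_le _ _)
  have hwp : w ≤ p := by
    refine Nat.div_le_of_le_mul ?_
    obtain ⟨a, ha⟩ := Nat.exists_eq_add_of_le hp.one_le
    obtain ⟨b, hb⟩ := Nat.exists_eq_add_of_le hD
    rw [ha, hb]
    ring_nf
    lia
  have hpw : p ≤ D * w := by
    have := Nat.lt_mul_div_succ (p + D - 1) hD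
    rw [mul_add] at this
    lia
  obtain ⟨q, hq, hcode⟩ := exists_labelled_code p N (by lia : 0 < t)
  set r := N * q * N.factorial
  have hr : 0 < r := by
    have : 0 < N := by lia
    positivity
  obtain ⟨n₁, hn₁⟩ := exists_add_pow_le_mul_factorial_mul_choose t (r + N * q)
    (by positivity : 0 < ε / (2 + ε))
  refine ⟨n₁ + k, fun n hn ↦ ?_⟩
  set m := N.factorial * (n / r + 1) + 1
  have hM : N * (q * m) = r * (n / r + 1) + N * q := by simp only [m, r]; ring
  have hnM : n ≤ N * (q * m) := by
    rw [hM]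
    have := Nat.lt_mul_div_succ n hr
    lia
  have hMn : N * (q * m) ≤ n + (r + N * q) := by
    rw [hM]
    have := Nat.mul_div_le n r
    lia
  obtain ⟨ℓ, hℓ⟩ := hcode m (by simp [m]) (by simp [m])
  obtain ⟨𝓑, h𝓑k, h𝓑cov, h𝓑card⟩ := exists_transversal_covering (by lia) htk.le hwp hpw hℓ
  set 𝓝 := (powersetCard t univ).filter fun A : Finset (Fin N × Fin (q * m)) ↦
    ¬ Set.InjOn Prod.fst (A : Set (Fin N × Fin (q * m)))
  have h𝓝 : #𝓝 ≤ N * (q * m) ^ 2 * (N * (q * m)) ^ (t - 2) := by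
    have := card_not_injOn_fst_le N (q * m) (t - 2)
    rwa [Nat.sub_add_cancel ht] at this
  obtain ⟨e⟩ : Nonempty (Fin n ↪ Fin N × Fin (q * m)) :=
    Function.Embedding.nonempty_of_card_le (by simpa using hnM)
  obtain ⟨𝓕, hk, hcov, hcard⟩ := exists_covering_of_embedding (t := t) (𝓑 := 𝓑 ∪ 𝓝)
    (by lia : k ≤ n) e
    (by
      intro B hB
      rcases mem_union.1 hB with hB | hB
      · exact (h𝓑k B hB).le
      · exact ((mem_powersetCard.1 (mem_filter.1 hB).1).2.trans_lt htk).le)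
    (by
      intro A hA
      by_cases hinj : Set.InjOn Prod.fst (A : Set (Fin N × Fin (q * m)))
      · obtain ⟨B, hB, hAB⟩ := h𝓑cov A hA hinj
        exact ⟨B, mem_union_left _ hB, hAB⟩
      · exact ⟨A, mem_union_right _ (mem_filter.2
          ⟨mem_powersetCard.2 ⟨subset_univ _, hA⟩, hinj⟩), Subset.rfl⟩)
  refine ⟨𝓕, hk, hcov, ?_⟩
  calc (#𝓕 : ℝ) ≤ #𝓑 + #𝓝 := by exact_mod_cast hcard.trans (card_union_le _ _)
    _ ≤ _ := by
      refine covering_size_bound hε ht htk.le (by lia : k ≤ N) hp.pos hwD hpε hNε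
        (Q := q * m) (by exact_mod_cast h𝓑card) (by exact_mod_cast h𝓝) ?_
      refine le_trans ?_ (hn₁ n (by lia))
      gcongr
end
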